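/- For the 1-helper JSCC problem (L = 1) with bandwidth ratio τ > 0, R(τ) = inf_W H(V|W,Z), where the infimum is over all finite auxiliary random variables W jointly distributed with (U,V,Z) such that (Z,V)−U−W is a Markov chain, |𝒲| ≤ |𝒰|+4, and I(U;W|Z) ≤ τC, with C = max_{P_X} I(X;Y) the capacity of the channel P_{Y|X}. -/

import Mathlib

open Filter Real

noncomputable section

namespace DHT

/-- Real-valued indicator of a proposition. -/
def ind (P : Prop) : ℝ := by classical exact if P then 1 else 0

/-- `p` is a probability mass function on the finite type `α`. -/
def IsPMF {α : Type*} [Fintype α] (p : α → ℝ) : Prop :=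
  (∀ a, 0 ≤ p a) ∧ ∑ a, p a = 1

/-- `f` is a stochastic kernel: every row is a pmf. -/
def IsKernel {α β : Type*} [Fintype β] (f : α → β → ℝ) : Prop :=
  ∀ a, (∀ b, 0 ≤ f a b) ∧ ∑ b, f a b = 1

/-- Pushforward of a pmf along a map. -/
def pushf {α β : Type*} [Fintype α] (p : α → ℝ) (f : α → β) : β → ℝ :=
  fun b => ∑ a, ind (f a = b) * p a

/-- Probability of a set under a pmf. -/
def probIn {α : Type*} [Fintype α] (p : α → ℝ) (A : Set α) : ℝ :=
  ∑ a, ind (a ∈ A) * p a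

/-- Shannon entropy, in bits. -/
def entropy {α : Type*} [Fintype α] (p : α → ℝ) : ℝ :=
  -∑ a, p a * Real.logb 2 (p a)

/-- Kullback–Leibler divergence, in bits. -/
def klDiv {α : Type*} [Fintype α] (p q : α → ℝ) : ℝ :=
  ∑ a, p a * Real.logb 2 (p a / q a)

/-- Conditional entropy `H(α | β)` of a joint pmf on `α × β`, in bits. -/
def condEntropy {α β : Type*} [Fintype α] [Fintype β] (p : α × β → ℝ) : ℝ :=
  -∑ x : α × β, p x * Real.logb 2 (p x / ∑ a, p (a, x.2))

/-- Mutual information `I(α;β)`, in bits. -/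
def mutualInfo {α β : Type*} [Fintype α] [Fintype β] (p : α × β → ℝ) : ℝ :=
  ∑ x : α × β, p x * Real.logb 2 (p x / ((∑ b, p (x.1, b)) * (∑ a, p (a, x.2))))

/-- Conditional mutual information `I(α;β|γ)`, in bits. -/
def condMI {α β γ : Type*} [Fintype α] [Fintype β] [Fintype γ] (p : α × β × γ → ℝ) : ℝ :=
  ∑ x : α × β × γ, p x * Real.logb 2
    (p x * (∑ a, ∑ b, p (a, b, x.2.2)) /
      ((∑ b, p (x.1, b, x.2.2)) * (∑ a, p (a, x.2.1, x.2.2))))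

/-- Markov chain `α − β − γ`: the first and third components are conditionally
independent given the middle one. -/
def MarkovChain {α β γ : Type*} [Fintype α] [Fintype γ] (p : α × β × γ → ℝ) : Prop :=
  ∀ a b c, p (a, b, c) * (∑ a', ∑ c', p (a', b, c')) =
    (∑ c', p (a, b, c')) * (∑ a', p (a', b, c))

/-- Shannon capacity of a discrete memoryless channel, in bits per use. -/
def capacity {X Y : Type*} [Fintype X] [Fintype Y] (Ch : X → Y → ℝ) : ℝ :=
  sSup {c | ∃ q : X → ℝ, IsPMF q ∧ c = mutualInfo (fun xy : X × Y => q xy.1 * Ch xy.1 xy.2)}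

/-- Empirical distribution (type) of a length-`j` sequence. -/
def empDist {α : Type*} [Fintype α] {j : ℕ} (w : Fin j → α) : α → ℝ :=
  fun a => (∑ i, ind (w i = a)) / j

/-- δ-typicality: the empirical distribution is within δ of `p` in every coordinate. -/
def IsTypical {α : Type*} [Fintype α] (p : α → ℝ) (δ : ℝ) {j : ℕ} (w : Fin j → α) : Prop :=
  ∀ a, |empDist w a - p a| ≤ δ

section System

variable {L : ℕ} {U X Y : Fin L → Type} {V Z : Type}
variable [∀ l, Fintype (U l)] [∀ l, Fintype (X l)] [∀ l, Fintype (Y l)]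
variable [Fintype V] [Fintype Z]

/-- Joint pmf of the channel outputs `(Y₁ⁿ,…,Y_Lⁿ)`, `V^k` and `Z^k` induced by `k` i.i.d.
copies of the source `R`, the stochastic encoders `f` and the memoryless channels `Ch`. -/
def inducedDist (R : (((l : Fin L) → U l) × V × Z) → ℝ)
    (Ch : (l : Fin L) → X l → Y l → ℝ) (k n : ℕ)
    (f : (l : Fin L) → (Fin k → U l) → (Fin n → X l) → ℝ) :
    (((l : Fin L) → Fin n → Y l) × (Fin k → V) × (Fin k → Z)) → ℝ :=
  fun yvz =>
    ∑ u : (l : Fin L) → Fin k → U l, ∑ x : (l : Fin L) → Fin n → X l,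
      (∏ i : Fin k, R ((fun l => u l i), yvz.2.1 i, yvz.2.2 i)) *
        ((∏ l, f l (u l) (x l)) * ∏ l, ∏ j : Fin n, Ch l (x l j) (yvz.1 l j))

/-- `P` and `Q` have the same single-variable marginals. -/
def SameMarginals (P Q : (((l : Fin L) → U l) × V × Z) → ℝ) : Prop :=
  (∀ (l : Fin L) (a : U l),
      (∑ x : ((l : Fin L) → U l) × V × Z, ind (x.1 l = a) * P x) =
        ∑ x : ((l : Fin L) → U l) × V × Z, ind (x.1 l = a) * Q x) ∧
  (∀ v : V, (∑ x : ((l : Fin L) → U l) × V × Z, ind (x.2.1 = v) * P x) =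
      ∑ x : ((l : Fin L) → U l) × V × Z, ind (x.2.1 = v) * Q x) ∧
  (∀ z : Z, (∑ x : ((l : Fin L) → U l) × V × Z, ind (x.2.2 = z) * P x) =
      ∑ x : ((l : Fin L) → U l) × V × Z, ind (x.2.2 = z) * Q x)

/-- Testing against conditional independence: `Q = P_{U_𝓛|Z} P_{V|Z} P_Z`. -/
def IsTACI (P Q : (((l : Fin L) → U l) × V × Z) → ℝ) : Prop :=
  ∀ x : ((l : Fin L) → U l) × V × Z,
    Q x = (∑ v : V, P (x.1, v, x.2.2)) * (∑ u : (l : Fin L) → U l, P (u, x.2.1, x.2.2)) /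
      (∑ u : (l : Fin L) → U l, ∑ v : V, P (u, v, x.2.2))

/-- Optimal type-2 error probability `β(k,τ,ε)`. -/
def beta (P Q : (((l : Fin L) → U l) × V × Z) → ℝ)
    (Ch : (l : Fin L) → X l → Y l → ℝ) (τ ε : ℝ) (k : ℕ) : ℝ :=
  sInf {b | ∃ n : ℕ, (n : ℝ) ≤ τ * k ∧
    ∃ f : (l : Fin L) → (Fin k → U l) → (Fin n → X l) → ℝ,
      (∀ l, IsKernel (f l)) ∧
      ∃ A : Set (((l : Fin L) → Fin n → Y l) × (Fin k → V) × (Fin k → Z)),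
        probIn (inducedDist P Ch k n f) Aᶜ ≤ ε ∧
        b = probIn (inducedDist Q Ch k n f) A}

/-- `θ(k,τ)`. -/
def thetaK (P Q : (((l : Fin L) → U l) × V × Z) → ℝ)
    (Ch : (l : Fin L) → X l → Y l → ℝ) (τ : ℝ) (k : ℕ) : ℝ :=
  sSup {d | ∃ n : ℕ, (n : ℝ) ≤ τ * k ∧
    ∃ f : (l : Fin L) → (Fin k → U l) → (Fin n → X l) → ℝ,
      (∀ l, IsKernel (f l)) ∧
      d = klDiv (inducedDist P Ch k n f) (inducedDist Q Ch k n f) / k}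

/-- `θ(τ) = sup_{k ≥ 1} θ(k,τ)`. -/
def theta (P Q : (((l : Fin L) → U l) × V × Z) → ℝ)
    (Ch : (l : Fin L) → X l → Y l → ℝ) (τ : ℝ) : ℝ :=
  sSup {d | ∃ k : ℕ, 1 ≤ k ∧ d = thetaK P Q Ch τ k}

/-- Optimal type-2 error exponent `κ(τ,ε)`. -/
def kappa (P Q : (((l : Fin L) → U l) × V × Z) → ℝ)
    (Ch : (l : Fin L) → X l → Y l → ℝ) (τ ε : ℝ) : ℝ :=
  sSup {κ : ℝ | 0 ≤ κ ∧ ∀ δ : ℝ, 0 < δ →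
    Filter.limsup (fun k : ℕ => Real.logb 2 (beta P Q Ch τ ε k) / k) Filter.atTop ≤ -(κ - δ)}

/-- `I(V^k; Y₁ⁿ,…,Y_Lⁿ | Z^k)` of the induced distribution. -/
def miVY (P : (((l : Fin L) → U l) × V × Z) → ℝ)
    (Ch : (l : Fin L) → X l → Y l → ℝ) (k n : ℕ)
    (f : (l : Fin L) → (Fin k → U l) → (Fin n → X l) → ℝ) : ℝ :=
  condMI (fun x : (Fin k → V) × ((l : Fin L) → Fin n → Y l) × (Fin k → Z) =>
    inducedDist P Ch k n f (x.2.1, x.1, x.2.2))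

/-- `H(V^k | Y₁ⁿ,…,Y_Lⁿ, Z^k)` of the induced distribution. -/
def condEntV (P : (((l : Fin L) → U l) × V × Z) → ℝ)
    (Ch : (l : Fin L) → X l → Y l → ℝ) (k n : ℕ)
    (f : (l : Fin L) → (Fin k → U l) → (Fin n → X l) → ℝ) : ℝ :=
  condEntropy (fun x : (Fin k → V) × (((l : Fin L) → Fin n → Y l) × (Fin k → Z)) =>
    inducedDist P Ch k n f (x.2.1, x.1, x.2.2))

/-- Probability of correct decoding in the `L`-helper JSCC problem. -/
def probCorrect (P : (((l : Fin L) → U l) × V × Z) → ℝ)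
    (Ch : (l : Fin L) → X l → Y l → ℝ) (k n m : ℕ)
    (f : (l : Fin L) → (Fin k → U l) → (Fin n → X l) → ℝ)
    (φ : (Fin k → V) → Fin m)
    (g : Fin m × ((l : Fin L) → Fin n → Y l) × (Fin k → Z) → (Fin k → V)) : ℝ :=
  ∑ w : ((l : Fin L) → Fin n → Y l) × (Fin k → V) × (Fin k → Z),
    ind (g (φ w.2.1, w.1, w.2.2) = w.2.1) * inducedDist P Ch k n f w

/-- Achievability of rate `R` in the `L`-helper JSCC problem with bandwidth ratio `τ`. -/
def JSCCAchievable (P : (((l : Fin L) → U l) × V × Z) → ℝ)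
    (Ch : (l : Fin L) → X l → Y l → ℝ) (τ R : ℝ) : Prop :=
  ∀ lam : ℝ, 0 < lam → lam ≤ 1 →
    ∃ (nseq mseq : ℕ → ℕ) (δ : ℕ → ℝ)
      (f : (k : ℕ) → (l : Fin L) → (Fin k → U l) → (Fin (nseq k) → X l) → ℝ)
      (φ : (k : ℕ) → (Fin k → V) → Fin (mseq k))
      (g : (k : ℕ) → Fin (mseq k) × ((l : Fin L) → Fin (nseq k) → Y l) × (Fin k → Z) →
        (Fin k → V)),
      (∀ k, 0 ≤ δ k) ∧ Filter.Tendsto δ Filter.atTop (nhds 0) ∧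
      ∀ k : ℕ, 1 ≤ k →
        (nseq k : ℝ) ≤ τ * k ∧ 1 ≤ mseq k ∧ (∀ l, IsKernel (f k l)) ∧
        1 - lam ≤ probCorrect P Ch k (nseq k) (mseq k) (f k) (φ k) (g k) ∧
        Real.logb 2 (mseq k) / k ≤ R + δ k

/-- Optimal rate `R(τ)` of the `L`-helper JSCC problem. -/
def Rjscc (P : (((l : Fin L) → U l) × V × Z) → ℝ)
    (Ch : (l : Fin L) → X l → Y l → ℝ) (τ : ℝ) : ℝ :=
  sInf {R | JSCCAchievable P Ch τ R}

/-- `R_k`: infimum of `H(V^k|Y^n,Z^k)/k` over block lengths `n ≤ τk` and encoders. -/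
def Rk (P : (((l : Fin L) → U l) × V × Z) → ℝ)
    (Ch : (l : Fin L) → X l → Y l → ℝ) (τ : ℝ) (k : ℕ) : ℝ :=
  sInf {r | ∃ n : ℕ, (n : ℝ) ≤ τ * k ∧
    ∃ f : (l : Fin L) → (Fin k → U l) → (Fin n → X l) → ℝ,
      (∀ l, IsKernel (f l)) ∧ r = condEntV P Ch k n f / k}

end System

section SingleObserver

variable {Uu Xx Yy V Z : Type}
variable [Fintype Uu] [Fintype Xx] [Fintype Yy] [Fintype V] [Fintype Z]

/-- Single-observer induced joint pmf of `(Yⁿ, V^k, Z^k)`. -/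
def inducedDist1 (R : Uu × V × Z → ℝ) (Ch : Xx → Yy → ℝ) (k n : ℕ)
    (f : (Fin k → Uu) → (Fin n → Xx) → ℝ) :
    ((Fin n → Yy) × (Fin k → V) × (Fin k → Z)) → ℝ :=
  fun yvz => ∑ u : Fin k → Uu, ∑ x : Fin n → Xx,
    (∏ i : Fin k, R (u i, yvz.2.1 i, yvz.2.2 i)) *
      (f u x * ∏ j : Fin n, Ch (x j) (yvz.1 j))

end SingleObserver

section Aux

variable {Uu V Z Wt : Type} [Fintype Uu] [Fintype V] [Fintype Z] [Fintype Wt]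

/-- Markov chain `(Z,V) − U − W` for a joint pmf on `(U × V × Z) × W`. -/
def MarkovZVUW (J : (Uu × V × Z) × Wt → ℝ) : Prop :=
  MarkovChain (fun x : (Z × V) × Uu × Wt => J ((x.2.1, x.1.2, x.1.1), x.2.2))

/-- `I(U;W|Z)` for a joint pmf on `(U × V × Z) × W`. -/
def miUW_Z (J : (Uu × V × Z) × Wt → ℝ) : ℝ :=
  condMI (fun x : Uu × Wt × Z => ∑ v, J ((x.1, v, x.2.2), x.2.1))

/-- `I(V;W|Z)` for a joint pmf on `(U × V × Z) × W`. -/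
def miVW_Z (J : (Uu × V × Z) × Wt → ℝ) : ℝ :=
  condMI (fun x : V × Wt × Z => ∑ u, J ((u, x.1, x.2.2), x.2.1))

/-- `I(U;W|V,Z)` for a joint pmf on `(U × V × Z) × W`. -/
def miUW_VZ (J : (Uu × V × Z) × Wt → ℝ) : ℝ :=
  condMI (fun x : Uu × Wt × (V × Z) => J ((x.1, x.2.2.1, x.2.2.2), x.2.1))

/-- `H(V|W,Z)` for a joint pmf on `(U × V × Z) × W`. -/
def entV_WZ (J : (Uu × V × Z) × Wt → ℝ) : ℝ :=
  condEntropy (fun x : V × (Wt × Z) => ∑ u, J ((u, x.1, x.2.2), x.2.1))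

/-- `H(V|Z)` for a joint pmf on `U × V × Z`. -/
def entV_Z (P : Uu × V × Z → ℝ) : ℝ :=
  condEntropy (fun x : V × Z => ∑ u, P (u, x.1, x.2))

end Aux

end DHT

open DHT Filter Real

namespace DHT

set_option linter.unusedSectionVars false

/-- Entropy in bits of a nonnegative measure on a finite type, normalised so as to be positively
homogeneous. -/
def massEntropy {α : Type*} [Fintype α] (g : α → ℝ) : ℝ :=
  -∑ a, g a * logb 2 (g a / ∑ b, g b)

section MassEntropy

variable {α β ι : Type*} [Fintype α] [Fintype β] [Fintype ι]

lemma condEntropy_eq_sum_massEntropy (p : α × β → ℝ) :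
    condEntropy p = ∑ b, massEntropy (fun a => p (a, b)) := by
  simp only [condEntropy, massEntropy, Finset.sum_neg_distrib]
  rw [Fintype.sum_prod_type_right]

lemma massEntropy_smul (c : ℝ) (g : α → ℝ) :
    massEntropy (fun a => c * g a) = c * massEntropy g := by
  unfold massEntropy
  rcases eq_or_ne c 0 with rfl | hc
  · simp
  · simp only [← Finset.mul_sum, mul_div_mul_left _ _ hc]
    rw [mul_neg, Finset.mul_sum]
    simp only [mul_assoc]

lemma massEntropy_comp_equiv (e : α ≃ β) (g : β → ℝ) :
    massEntropy (fun a => g (e a)) = massEntropy g := by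
  unfold massEntropy
  rw [Equiv.sum_comp e g, Equiv.sum_comp e (fun b => g b * logb 2 (g b / ∑ b, g b))]

lemma sum_pos_of_nonneg_of_pos {g : α → ℝ} (hg : ∀ a, 0 ≤ g a) {a : α} (ha : 0 < g a) :
    0 < ∑ b, g b :=
  lt_of_lt_of_le ha (Finset.single_le_sum (fun b _ => hg b) (Finset.mem_univ a))

lemma massEntropy_nonneg {g : α → ℝ} (hg : ∀ a, 0 ≤ g a) : 0 ≤ massEntropy g := by
  unfold massEntropy
  rw [neg_nonneg]
  refine Finset.sum_nonpos fun a _ => mul_nonpos_of_nonneg_of_nonpos (hg a) ?_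
  have h0 : 0 ≤ ∑ b, g b := Finset.sum_nonneg fun b _ => hg b
  refine Real.logb_nonpos one_lt_two (div_nonneg (hg a) h0) ?_
  exact div_le_one_of_le₀ (Finset.single_le_sum (fun b _ => hg b) (Finset.mem_univ a)) h0

lemma massEntropy_of_subsingleton [Subsingleton α] (g : α → ℝ) : massEntropy g = 0 := by
  unfold massEntropy
  rw [neg_eq_zero]
  refine Finset.sum_eq_zero fun a _ => ?_
  rw [Fintype.sum_subsingleton g a]
  rcases eq_or_ne (g a) 0 with h | h
  · simp [h]
  · simp [div_self h]

/-- Gibbs' inequality. -/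
lemma massEntropy_le_crossEntropy {g q : α → ℝ} (hg : ∀ a, 0 ≤ g a) (hq : ∀ a, 0 ≤ q a)
    (hq1 : ∑ a, q a ≤ 1) (hgq : ∀ a, 0 < g a → 0 < q a) :
    massEntropy g ≤ -∑ a, g a * logb 2 (q a) := by
  unfold massEntropy
  rw [neg_le_neg_iff]
  set G := ∑ b, g b with hG
  have hG0 : 0 ≤ G := Finset.sum_nonneg fun b _ => hg b
  have hl : 0 < Real.log 2 := Real.log_pos one_lt_two
  have key : ∀ a, (g a - G * q a) / Real.log 2 + g a * logb 2 (q a) ≤ g a * logb 2 (g a / G) := by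
    intro a
    rcases (hg a).eq_or_lt with h | h
    · rw [← h]
      have : 0 ≤ G * q a / Real.log 2 := by have := hq a; positivity
      simp only [zero_sub, neg_div, zero_mul, add_zero]; linarith
    · have hqa := hgq a h
      have hGp : 0 < G := sum_pos_of_nonneg_of_pos hg h
      have h1 := Real.one_sub_inv_le_log_of_pos (div_pos h (mul_pos hGp hqa))
      have h2 : Real.log (g a / (G * q a)) = Real.log (g a / G) - Real.log (q a) := by
        rw [← div_div, Real.log_div (div_pos h hGp).ne' hqa.ne']
      rw [h2, inv_div] at h1
      have h3 : g a * (1 - G * q a / g a) = g a - G * q a := by field_simp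
      have h4 := mul_le_mul_of_nonneg_left h1 h.le
      rw [h3] at h4
      simp only [Real.logb]
      rw [div_add' _ _ _ hl.ne', ← mul_div_assoc (g a) (Real.log (g a / G)),
        div_le_div_iff_of_pos_right hl]
      have : g a * (Real.log (q a) / Real.log 2) * Real.log 2 = g a * Real.log (q a) := by
        field_simp
      rw [this]; linarith
  have hs := Finset.sum_le_sum fun a (_ : a ∈ Finset.univ) => key a
  rw [Finset.sum_add_distrib, ← Finset.sum_div, Finset.sum_sub_distrib, ← Finset.mul_sum,
    ← hG] at hs
  have : 0 ≤ (G - G * ∑ a, q a) / Real.log 2 := by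
    refine div_nonneg ?_ hl.le
    nlinarith
  linarith

/-- Superadditivity (concavity) of the entropy. -/
lemma sum_massEntropy_le {g : ι → α → ℝ} (hg : ∀ i a, 0 ≤ g i a) :
    ∑ i, massEntropy (g i) ≤ massEntropy (fun a => ∑ i, g i a) := by
  set G : α → ℝ := fun a => ∑ i, g i a with hG
  have hG0 : ∀ a, 0 ≤ G a := fun a => Finset.sum_nonneg fun i _ => hg i a
  have hs0 : 0 ≤ ∑ b, G b := Finset.sum_nonneg fun b _ => hG0 b
  have h : ∀ i, massEntropy (g i) ≤ -∑ a, g i a * logb 2 (G a / ∑ b, G b) := by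
    intro i
    refine massEntropy_le_crossEntropy (hg i) (fun a => div_nonneg (hG0 a) hs0) ?_ ?_
    · rw [← Finset.sum_div]; exact div_self_le_one _
    · intro a ha
      have : 0 < G a := sum_pos_of_nonneg_of_pos (fun i => hg i a) ha
      exact div_pos this (sum_pos_of_nonneg_of_pos hG0 this)
  refine (Finset.sum_le_sum fun i _ => h i).trans (le_of_eq ?_)
  rw [massEntropy, Finset.sum_neg_distrib, Finset.sum_comm]
  congr 1
  refine Finset.sum_congr rfl fun a _ => ?_
  rw [← Finset.sum_mul]

/-- Chain rule. -/
lemma massEntropy_prod {g : α × β → ℝ} (hg : ∀ x, 0 ≤ g x) :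
    massEntropy g =
      massEntropy (fun a => ∑ b, g (a, b)) + ∑ a, massEntropy (fun b => g (a, b)) := by
  unfold massEntropy
  rw [Finset.sum_neg_distrib, ← neg_add, Fintype.sum_prod_type, ← Finset.sum_add_distrib]
  congr 1
  refine Finset.sum_congr rfl fun a _ => ?_
  rw [Finset.sum_mul, ← Finset.sum_add_distrib]
  refine Finset.sum_congr rfl fun b _ => ?_
  rcases (hg (a, b)).eq_or_lt with h | h
  · simp [← h]
  · have h1 : 0 < ∑ b, g (a, b) := sum_pos_of_nonneg_of_pos (fun b => hg (a, b)) h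
    have h2 : 0 < ∑ a, ∑ b, g (a, b) :=
      sum_pos_of_nonneg_of_pos (fun a => Finset.sum_nonneg fun b _ => hg (a, b)) h1
    rw [Fintype.sum_prod_type, ← mul_add, ← Real.logb_mul (by positivity) (by positivity)]
    congr 2
    field_simp

lemma massEntropy_prod' {g : α × β → ℝ} (hg : ∀ x, 0 ≤ g x) :
    massEntropy g =
      massEntropy (fun b => ∑ a, g (a, b)) + ∑ b, massEntropy (fun a => g (a, b)) := by
  rw [← massEntropy_comp_equiv (Equiv.prodComm β α) g]
  exact massEntropy_prod fun x => hg _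

/-- Symmetry of mutual information. -/
lemma massEntropy_swap {g : α → β → ℝ} (hg : ∀ a b, 0 ≤ g a b) :
    massEntropy (fun a => ∑ b, g a b) - ∑ b, massEntropy (fun a => g a b) =
      massEntropy (fun b => ∑ a, g a b) - ∑ a, massEntropy (g a) := by
  have h1 := massEntropy_prod (g := fun x : α × β => g x.1 x.2) fun x => hg _ _
  have h2 := massEntropy_prod' (g := fun x : α × β => g x.1 x.2) fun x => hg _ _
  simp only at h1 h2
  linarith

/-- Subadditivity of the entropy of a pair. -/
lemma massEntropy_prod_le {g : α × β → ℝ} (hg : ∀ x, 0 ≤ g x) :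
    massEntropy g ≤ massEntropy (fun a => ∑ b, g (a, b)) + massEntropy (fun b => ∑ a, g (a, b)) := by
  rw [massEntropy_prod hg]
  gcongr
  exact sum_massEntropy_le fun a b => hg (a, b)

lemma massEntropy_le_logb_card {g : α → ℝ} (hg : ∀ a, 0 ≤ g a) :
    massEntropy g ≤ (∑ a, g a) * logb 2 (Fintype.card α) := by
  have := massEntropy_le_crossEntropy (q := fun _ : α => (Fintype.card α : ℝ)⁻¹) hg
    (fun a => by positivity) (by simpa using mul_inv_le_one) (fun a _ => by
      have : 0 < Fintype.card α := Fintype.card_pos_iff.2 ⟨a⟩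
      positivity)
  simpa [Real.logb_inv, ← Finset.sum_mul] using this

lemma condMI_eq {γ : Type*} [Fintype γ] {p : α × β × γ → ℝ} (hp : ∀ x, 0 ≤ p x) :
    condMI p = (∑ c, massEntropy (fun a => ∑ b, p (a, b, c))) -
      ∑ b, ∑ c, massEntropy (fun a => p (a, b, c)) := by
  have e : (∑ b, ∑ c, massEntropy (fun a => p (a, b, c))) =
      -∑ c, ∑ a, ∑ b, p (a, b, c) * logb 2 (p (a, b, c) / ∑ a', p (a', b, c)) := by
    rw [Finset.sum_comm]
    simp only [massEntropy, Finset.sum_neg_distrib]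
    congr 1
    refine Finset.sum_congr rfl fun c _ => ?_
    rw [Finset.sum_comm]
  rw [e]
  simp only [massEntropy, condMI, Finset.sum_neg_distrib]
  rw [neg_sub_neg, ← Finset.sum_sub_distrib]
  rw [show (∑ x : α × β × γ, p x * logb 2
    (p x * (∑ a, ∑ b, p (a, b, x.2.2)) /
      ((∑ b, p (x.1, b, x.2.2)) * (∑ a, p (a, x.2.1, x.2.2))))) = ∑ c, ∑ a, ∑ b,
      p (a, b, c) * logb 2 (p (a, b, c) * (∑ a, ∑ b, p (a, b, c)) /
      ((∑ b, p (a, b, c)) * (∑ a, p (a, b, c)))) by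
    simp only [Fintype.sum_prod_type]
    rw [Finset.sum_congr rfl fun a _ => Finset.sum_comm, Finset.sum_comm]]
  refine Finset.sum_congr rfl fun c _ => ?_
  rw [← Finset.sum_sub_distrib]
  refine Finset.sum_congr rfl fun a _ => ?_
  rw [Finset.sum_mul, ← Finset.sum_sub_distrib]
  refine Finset.sum_congr rfl fun b _ => ?_
  rcases (hp (a, b, c)).eq_or_lt with h | h
  · simp [← h]
  · have h1 : 0 < ∑ b, p (a, b, c) := sum_pos_of_nonneg_of_pos (fun b => hp (a, b, c)) h
    have h2 : 0 < ∑ a, ∑ b, p (a, b, c) :=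
      sum_pos_of_nonneg_of_pos (fun a => Finset.sum_nonneg fun b _ => hp (a, b, c)) h1
    have h3 : 0 < ∑ a, p (a, b, c) := sum_pos_of_nonneg_of_pos (fun a => hp (a, b, c)) h
    rw [← mul_sub, ← Real.logb_div (by positivity) (by positivity)]
    congr 2
    field_simp

lemma sum_sum_mul_kernel {q : α → ℝ} {Ch : α → β → ℝ} (hC : IsKernel Ch) :
    (∑ b, ∑ a, q a * Ch a b) = ∑ a, q a := by
  rw [Finset.sum_comm]
  simp only [← Finset.mul_sum, (hC _).2, mul_one]

lemma mutualInfo_channel_eq {q : α → ℝ} {Ch : α → β → ℝ} (hq : IsPMF q)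
    (hC : IsKernel Ch) :
    mutualInfo (fun xy : α × β => q xy.1 * Ch xy.1 xy.2) =
      massEntropy (fun b => ∑ a, q a * Ch a b) - ∑ a, q a * massEntropy (Ch a) := by
  simp only [massEntropy, mutualInfo, mul_neg, Finset.sum_neg_distrib,
    sum_sum_mul_kernel hC, hq.2, (hC _).2, div_one]
  rw [neg_sub_neg, Fintype.sum_prod_type]
  have e : (∑ b, (∑ a, q a * Ch a b) * logb 2 (∑ a, q a * Ch a b)) =
      ∑ a, ∑ b, q a * Ch a b * logb 2 (∑ a, q a * Ch a b) := by
    simp only [Finset.sum_mul]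
    rw [Finset.sum_comm]
  rw [e, ← Finset.sum_sub_distrib]
  refine Finset.sum_congr rfl fun a _ => ?_
  rw [Finset.mul_sum, ← Finset.sum_sub_distrib]
  refine Finset.sum_congr rfl fun b _ => ?_
  simp only [← Finset.mul_sum, (hC _).2, mul_one]
  rcases (hq.1 a).eq_or_lt with h | h
  · simp [← h]
  rcases ((hC a).1 b).eq_or_lt with h' | h'
  · simp [← h']
  have h1 : 0 < ∑ a, q a * Ch a b :=
    sum_pos_of_nonneg_of_pos (fun a => mul_nonneg (hq.1 a) ((hC a).1 b)) (mul_pos h h')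
  rw [mul_div_mul_left _ _ h.ne', Real.logb_div h'.ne' h1.ne']
  ring

end MassEntropy

section Slices

variable {U V Z W : Type} [Fintype U] [Fintype V] [Fintype Z] [Fintype W]

/-- `H(V|Z)` of the source `P` reweighted by `t` on the `U` coordinate. -/
def sliceV (P : U × V × Z → ℝ) (t : U → ℝ) : ℝ :=
  ∑ z, massEntropy (fun v => ∑ u, P (u, v, z) * t u)

/-- `H(U|Z)` of the source `P` reweighted by `t` on the `U` coordinate. -/
def sliceU (P : U × V × Z → ℝ) (t : U → ℝ) : ℝ :=
  ∑ z, massEntropy (fun u => (∑ v, P (u, v, z)) * t u)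

lemma sliceV_smul (P : U × V × Z → ℝ) (c : ℝ) (t : U → ℝ) :
    sliceV P (c • t) = c * sliceV P t := by
  simp only [sliceV, Finset.mul_sum, ← massEntropy_smul]
  simp [mul_left_comm]

lemma sliceU_smul (P : U × V × Z → ℝ) (c : ℝ) (t : U → ℝ) :
    sliceU P (c • t) = c * sliceU P t := by
  simp only [sliceU, Finset.mul_sum, ← massEntropy_smul]
  simp [mul_left_comm]

lemma sliceV_nonneg {P : U × V × Z → ℝ} (hP : ∀ x, 0 ≤ P x) {t : U → ℝ} (ht : ∀ u, 0 ≤ t u) :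
    0 ≤ sliceV P t :=
  Finset.sum_nonneg fun _ _ => massEntropy_nonneg fun _ =>
    Finset.sum_nonneg fun _ _ => mul_nonneg (hP _) (ht _)

/-- Joint pmf of the source and the output of the kernel `f` applied to its `U` coordinate. -/
def jointOf (P : U × V × Z → ℝ) (f : U → W → ℝ) : (U × V × Z) × W → ℝ :=
  fun x => P x.1 * f x.1.1 x.2

lemma entV_WZ_jointOf (P : U × V × Z → ℝ) (f : U → W → ℝ) :
    entV_WZ (jointOf P f) = ∑ w, sliceV P (fun u => f u w) := by
  rw [entV_WZ, condEntropy_eq_sum_massEntropy, Fintype.sum_prod_type]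
  rfl

lemma miUW_Z_jointOf {P : U × V × Z → ℝ} (hP : ∀ x, 0 ≤ P x) {f : U → W → ℝ} (hf : IsKernel f) :
    miUW_Z (jointOf P f) = sliceU P 1 - ∑ w, sliceU P (fun u => f u w) := by
  have h0 : ∀ x, 0 ≤ jointOf P f x := fun x => mul_nonneg (hP _) ((hf _).1 _)
  rw [miUW_Z, condMI_eq fun x => Finset.sum_nonneg fun v _ => h0 _]
  simp only [jointOf, sliceU, ← Finset.sum_mul, ← Finset.mul_sum, (hf _).2, Pi.one_apply]

lemma isPMF_jointOf {P : U × V × Z → ℝ} (hP : IsPMF P) {f : U → W → ℝ} (hf : IsKernel f) :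
    IsPMF (jointOf P f) := by
  refine ⟨fun x => mul_nonneg (hP.1 _) ((hf _).1 _), ?_⟩
  rw [Fintype.sum_prod_type]
  simp only [jointOf, ← Finset.mul_sum, (hf _).2, mul_one, hP.2]

lemma sum_jointOf (P : U × V × Z → ℝ) {f : U → W → ℝ} (hf : IsKernel f) (x : U × V × Z) :
    ∑ w, jointOf P f (x, w) = P x := by
  simp only [jointOf, ← Finset.mul_sum, (hf _).2, mul_one]

lemma markov_jointOf (P : U × V × Z → ℝ) {f : U → W → ℝ} (hf : IsKernel f) :
    MarkovZVUW (jointOf P f) := by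
  rintro ⟨z, v⟩ u w
  simp only [jointOf, ← Finset.mul_sum, (hf _).2, mul_one, ← Finset.sum_mul]
  ring

/-- A joint pmf with `(Z,V) − U − W` Markov comes from a kernel `U → W`. -/
lemma exists_kernel_of_markov [Nonempty W] {P : U × V × Z → ℝ} (hP : IsPMF P)
    {J : (U × V × Z) × W → ℝ} (hJ : IsPMF J) (hJP : ∀ x, (∑ w, J (x, w)) = P x)
    (hM : MarkovZVUW J) : ∃ f : U → W → ℝ, IsKernel f ∧ J = jointOf P f := by
  classical
  set pU : U → ℝ := fun u => ∑ a : Z × V, P (u, a.2, a.1) with hpU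
  have hp0 : ∀ u, 0 ≤ pU u := fun u => Finset.sum_nonneg fun _ _ => hP.1 _
  obtain ⟨w0⟩ := ‹Nonempty W›
  refine ⟨fun u w => if pU u = 0 then (if w = w0 then 1 else 0) else
    (∑ a : Z × V, J ((u, a.2, a.1), w)) / pU u, ?_, ?_⟩
  · intro u
    by_cases h : pU u = 0
    · simp only [h, if_true]
      refine ⟨fun b => by split_ifs <;> norm_num, by simp⟩
    · simp only [h, if_false]
      refine ⟨fun b => div_nonneg (Finset.sum_nonneg fun _ _ => hJ.1 _) (hp0 u), ?_⟩
      rw [← Finset.sum_div, Finset.sum_comm]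
      simp only [hJP]
      exact div_self h
  · funext ⟨⟨u, v, z⟩, w⟩
    simp only [jointOf]
    have hm := hM (z, v) u w
    simp only [hJP] at hm
    by_cases h : pU u = 0
    · have hPz : P (u, v, z) = 0 :=
        (Finset.sum_eq_zero_iff_of_nonneg (fun a _ => hP.1 (u, a.2, a.1))).1 h (z, v)
          (Finset.mem_univ _)
      have := hJP (u, v, z)
      rw [hPz] at this
      rw [hPz, zero_mul]
      exact (Finset.sum_eq_zero_iff_of_nonneg (fun a _ => hJ.1 _)).1 this w (Finset.mem_univ _)
    · simp only [h, if_false]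
      rw [mul_div_assoc', eq_div_iff h]
      exact hm

/-- Data processing: `I(V;W|Z) ≤ I(U;W|Z)`. -/
lemma sliceV_sub_le_sliceU_sub {P : U × V × Z → ℝ} (hP : ∀ x, 0 ≤ P x) {f : U → W → ℝ}
    (hf : IsKernel f) :
    sliceV P 1 - ∑ w, sliceV P (fun u => f u w) ≤
      sliceU P 1 - ∑ w, sliceU P (fun u => f u w) := by
  unfold sliceV sliceU
  rw [Finset.sum_comm (s := (Finset.univ : Finset W)),
    Finset.sum_comm (s := (Finset.univ : Finset W)), ← Finset.sum_sub_distrib, ← Finset.sum_sub_distrib]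
  refine Finset.sum_le_sum fun z _ => ?_
  have hf0 : ∀ u w, 0 ≤ f u w := fun u => (hf u).1
  have h1 := massEntropy_swap (g := fun v w => ∑ u, P (u, v, z) * f u w)
    fun v w => Finset.sum_nonneg fun u _ => mul_nonneg (hP _) (hf0 _ _)
  have h2 := massEntropy_swap (g := fun u w => (∑ v, P (u, v, z)) * f u w)
    fun u w => mul_nonneg (Finset.sum_nonneg fun v _ => hP _) (hf0 _ _)
  have h3 : (fun v => ∑ w, ∑ u, P (u, v, z) * f u w) = fun v => ∑ u, P (u, v, z) * (1 : U → ℝ) u := by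
    funext v
    rw [Finset.sum_comm]
    simp only [← Finset.mul_sum, (hf _).2, Pi.one_apply]
  have h4 : (fun u => ∑ w, (∑ v, P (u, v, z)) * f u w) =
      fun u => (∑ v, P (u, v, z)) * (1 : U → ℝ) u := by
    funext u
    simp only [← Finset.mul_sum, (hf _).2, Pi.one_apply]
  have h5 : (fun w => ∑ u, (∑ v, P (u, v, z)) * f u w) =
      fun w => ∑ v, ∑ u, P (u, v, z) * f u w := by
    funext w
    rw [Finset.sum_comm]
    simp only [Finset.sum_mul]
  rw [h3] at h1
  rw [h4, h5] at h2
  rw [h1, h2]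
  gcongr
  have h6 : ∀ v, ∑ u, P (u, v, z) * massEntropy (f u) ≤
      massEntropy (fun w => ∑ u, P (u, v, z) * f u w) := by
    intro v
    simp only [← massEntropy_smul]
    exact sum_massEntropy_le fun u w => mul_nonneg (hP _) (hf0 _ _)
  refine le_trans (le_of_eq ?_) (Finset.sum_le_sum fun v _ => h6 v)
  rw [Finset.sum_comm]
  refine Finset.sum_congr rfl fun u _ => ?_
  rw [massEntropy_smul, Finset.sum_mul]

end Slices

section Product

variable {U V Z U₁ V₁ Z₁ U₂ V₂ Z₂ : Type} [Fintype U] [Fintype V] [Fintype Z]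
  [Fintype U₁] [Fintype V₁] [Fintype Z₁] [Fintype U₂] [Fintype V₂] [Fintype Z₂]

/-- Product of two sources. -/
def prodSource (P₁ : U₁ × V₁ × Z₁ → ℝ) (P₂ : U₂ × V₂ × Z₂ → ℝ) :
    (U₁ × U₂) × (V₁ × V₂) × (Z₁ × Z₂) → ℝ :=
  fun x => P₁ (x.1.1, x.2.1.1, x.2.2.1) * P₂ (x.1.2, x.2.1.2, x.2.2.2)

/-- `k` independent copies of a source. -/
def seqSource (P : U × V × Z → ℝ) (k : ℕ) : (Fin k → U) × (Fin k → V) × (Fin k → Z) → ℝ :=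
  fun x => ∏ i, P (x.1 i, x.2.1 i, x.2.2 i)

lemma sliceU_prodSource {P₁ : U₁ × V₁ × Z₁ → ℝ} {P₂ : U₂ × V₂ × Z₂ → ℝ} (h₁ : ∀ x, 0 ≤ P₁ x)
    (h₂ : ∀ x, 0 ≤ P₂ x) {t : U₁ × U₂ → ℝ} (ht : ∀ u, 0 ≤ t u) :
    sliceU (prodSource P₁ P₂) t =
      (∑ z₂, sliceU P₁ (fun u₁ => ∑ u₂, (∑ v₂, P₂ (u₂, v₂, z₂)) * t (u₁, u₂))) +
      ∑ u₁, ∑ z₁, sliceU P₂ (fun u₂ => (∑ v₁, P₁ (u₁, v₁, z₁)) * t (u₁, u₂)) := by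
  have hm : ∀ u₁ u₂ z₁ z₂, (∑ v : V₁ × V₂, prodSource P₁ P₂ ((u₁, u₂), v, (z₁, z₂))) =
      (∑ v₁, P₁ (u₁, v₁, z₁)) * ∑ v₂, P₂ (u₂, v₂, z₂) := by
    intro u₁ u₂ z₁ z₂
    rw [Fintype.sum_prod_type, Finset.sum_mul_sum]; rfl
  have hn₁ : ∀ u z, 0 ≤ ∑ v₁, P₁ (u, v₁, z) := fun u z => Finset.sum_nonneg fun _ _ => h₁ _
  have hn₂ : ∀ u z, 0 ≤ ∑ v₁, P₂ (u, v₁, z) := fun u z => Finset.sum_nonneg fun _ _ => h₂ _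
  have h3 : ∀ z₁ z₂, massEntropy (fun u : U₁ × U₂ =>
      (∑ v : V₁ × V₂, prodSource P₁ P₂ (u, v, (z₁, z₂))) * t u) =
      massEntropy (fun u₁ => (∑ v₁, P₁ (u₁, v₁, z₁)) *
        ∑ u₂, (∑ v₂, P₂ (u₂, v₂, z₂)) * t (u₁, u₂)) +
      ∑ u₁, massEntropy (fun u₂ => (∑ v₂, P₂ (u₂, v₂, z₂)) *
        ((∑ v₁, P₁ (u₁, v₁, z₁)) * t (u₁, u₂))) := by
    intro z₁ z₂
    rw [massEntropy_prod]
    · simp only [hm]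
      congr 1
      · congr 1; funext u₁
        rw [Finset.mul_sum]
        refine Finset.sum_congr rfl fun u₂ _ => ?_
        ring
      refine Finset.sum_congr rfl fun u₁ _ => ?_
      congr 1; funext u₂; ring
    · rintro ⟨u₁, u₂⟩
      rw [hm]
      exact mul_nonneg (mul_nonneg (hn₁ _ _) (hn₂ _ _)) (ht _)
  unfold sliceU
  rw [Fintype.sum_prod_type]
  simp only [h3, Finset.sum_add_distrib]
  congr 1
  · exact Finset.sum_comm
  · rw [Finset.sum_congr rfl fun z₁ _ => Finset.sum_comm]
    exact Finset.sum_comm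

lemma le_sliceV_prodSource {P₁ : U₁ × V₁ × Z₁ → ℝ} {P₂ : U₂ × V₂ × Z₂ → ℝ} (h₁ : ∀ x, 0 ≤ P₁ x)
    (h₂ : ∀ x, 0 ≤ P₂ x) {t : U₁ × U₂ → ℝ} (ht : ∀ u, 0 ≤ t u) :
    (∑ z₂, sliceV P₁ (fun u₁ => ∑ u₂, (∑ v₂, P₂ (u₂, v₂, z₂)) * t (u₁, u₂))) +
      ∑ u₁, ∑ z₁, sliceV P₂ (fun u₂ => (∑ v₁, P₁ (u₁, v₁, z₁)) * t (u₁, u₂)) ≤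
      sliceV (prodSource P₁ P₂) t := by
  have h3 : ∀ z₁ z₂, massEntropy (fun v₁ => ∑ u₁, P₁ (u₁, v₁, z₁) *
        ∑ u₂, (∑ v₂, P₂ (u₂, v₂, z₂)) * t (u₁, u₂)) +
      ∑ u₁, massEntropy (fun v₂ => ∑ u₂, P₂ (u₂, v₂, z₂) *
        ((∑ v₁, P₁ (u₁, v₁, z₁)) * t (u₁, u₂))) ≤ massEntropy (fun v : V₁ × V₂ =>
      ∑ u : U₁ × U₂, prodSource P₁ P₂ (u, v, (z₁, z₂)) * t u) := by
    intro z₁ z₂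
    have h0 : ∀ x, 0 ≤ prodSource P₁ P₂ x := fun x => mul_nonneg (h₁ _) (h₂ _)
    rw [massEntropy_prod fun v => Finset.sum_nonneg fun u _ => mul_nonneg (h0 _) (ht _)]
    refine add_le_add (le_of_eq ?_) ?_
    · congr 1; funext v₁
      simp only [Fintype.sum_prod_type, prodSource]
      rw [Finset.sum_comm]
      refine Finset.sum_congr rfl fun u₁ _ => ?_
      rw [Finset.sum_comm, Finset.mul_sum]
      refine Finset.sum_congr rfl fun u₂ _ => ?_
      rw [Finset.sum_mul, Finset.mul_sum]
      refine Finset.sum_congr rfl fun v₂ _ => ?_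
      ring
    · have h4 : ∀ v₁, ∑ u₁, P₁ (u₁, v₁, z₁) *
          massEntropy (fun v₂ => ∑ u₂, P₂ (u₂, v₂, z₂) * t (u₁, u₂)) ≤
          massEntropy (fun v₂ => ∑ u : U₁ × U₂, prodSource P₁ P₂ (u, (v₁, v₂), (z₁, z₂)) * t u) := by
        intro v₁
        simp only [← massEntropy_smul]
        refine (sum_massEntropy_le fun u₁ v₂ => mul_nonneg (h₁ _) (Finset.sum_nonneg fun _ _ =>
          mul_nonneg (h₂ _) (ht _))).trans (le_of_eq ?_)
        congr 1; funext v₂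
        simp only [Fintype.sum_prod_type, prodSource, Finset.mul_sum, mul_assoc]
      refine le_trans (le_of_eq ?_) (Finset.sum_le_sum fun v₁ _ => h4 v₁)
      rw [Finset.sum_comm]
      refine Finset.sum_congr rfl fun u₁ _ => ?_
      rw [← Finset.sum_mul, ← massEntropy_smul]
      congr 1; funext v₂
      rw [Finset.mul_sum]
      refine Finset.sum_congr rfl fun u₂ _ => ?_
      ring
  unfold sliceV
  rw [Fintype.sum_prod_type]
  refine le_trans (le_of_eq ?_)
    (Finset.sum_le_sum fun z₁ _ => Finset.sum_le_sum fun z₂ _ => h3 z₁ z₂)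
  simp only [Finset.sum_add_distrib]
  congr 1
  · exact Finset.sum_comm
  · rw [Finset.sum_comm]
    refine Finset.sum_congr rfl fun z₁ _ => ?_
    exact Finset.sum_comm

lemma sum_fin_succ_fun {α : Type*} [Fintype α] {M : Type*} [AddCommMonoid M] (k : ℕ)
    (F : (Fin (k + 1) → α) → M) :
    ∑ x, F x = ∑ a, ∑ x : Fin k → α, F (Fin.cons a x) := by
  rw [← Fintype.sum_prod_type' (f := fun a (x : Fin k → α) => F (Fin.cons a x))]
  exact ((Fin.consEquiv fun _ : Fin (k + 1) => α).sum_comp F).symm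

lemma seqSource_cons (P : U × V × Z → ℝ) (k : ℕ) (u : U) (v : V) (z : Z) (u' : Fin k → U)
    (v' : Fin k → V) (z' : Fin k → Z) :
    seqSource P (k + 1) (Fin.cons u u', Fin.cons v v', Fin.cons z z') =
      prodSource P (seqSource P k) ((u, u'), (v, v'), (z, z')) := by
  simp [seqSource, prodSource, Fin.prod_univ_succ]

lemma sliceV_seqSource_succ (P : U × V × Z → ℝ) (k : ℕ) (t : (Fin (k + 1) → U) → ℝ) :
    sliceV (seqSource P (k + 1)) t =
      sliceV (prodSource P (seqSource P k)) (fun u => t (Fin.cons u.1 u.2)) := by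
  unfold sliceV
  rw [sum_fin_succ_fun, Fintype.sum_prod_type]
  refine Finset.sum_congr rfl fun z _ => Finset.sum_congr rfl fun z' _ => ?_
  rw [← massEntropy_comp_equiv (Fin.consEquiv fun _ : Fin (k + 1) => V)]
  congr 1; funext ⟨v, v'⟩
  rw [sum_fin_succ_fun, Fintype.sum_prod_type]
  simp [Fin.consEquiv, seqSource_cons]

lemma sliceU_seqSource_succ (P : U × V × Z → ℝ) (k : ℕ) (t : (Fin (k + 1) → U) → ℝ) :
    sliceU (seqSource P (k + 1)) t =
      sliceU (prodSource P (seqSource P k)) (fun u => t (Fin.cons u.1 u.2)) := by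
  unfold sliceU
  rw [sum_fin_succ_fun, Fintype.sum_prod_type]
  refine Finset.sum_congr rfl fun z _ => Finset.sum_congr rfl fun z' _ => ?_
  rw [← massEntropy_comp_equiv (Fin.consEquiv fun _ : Fin (k + 1) => U)]
  congr 1; funext ⟨u, u'⟩
  rw [sum_fin_succ_fun, Fintype.sum_prod_type]
  simp [Fin.consEquiv, seqSource_cons]

lemma sum_pi_prod {ι α : Type*} [Fintype ι] [DecidableEq ι] [Fintype α] (g : ι → α → ℝ) :
    ∑ x : ι → α, ∏ i, g i (x i) = ∏ i, ∑ a, g i a := by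
  rw [Finset.prod_univ_sum, Fintype.piFinset_univ]

/-- A sequence of triples is a triple of sequences. -/
def seqEquiv (U V Z : Type) (k : ℕ) :
    (Fin k → U × V × Z) ≃ (Fin k → U) × (Fin k → V) × (Fin k → Z) where
  toFun x := (fun i => (x i).1, fun i => (x i).2.1, fun i => (x i).2.2)
  invFun y i := (y.1 i, y.2.1 i, y.2.2 i)
  left_inv _ := rfl
  right_inv _ := rfl

lemma isPMF_prod {α : Type*} [Fintype α] {p : α → ℝ} (hp : IsPMF p) (k : ℕ) :
    IsPMF (fun x : Fin k → α => ∏ i, p (x i)) :=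
  ⟨fun _ => Finset.prod_nonneg fun _ _ => hp.1 _, by
    rw [sum_pi_prod fun _ => p]; simp [hp.2]⟩

lemma isPMF_seqSource {P : U × V × Z → ℝ} (hP : IsPMF P) (k : ℕ) : IsPMF (seqSource P k) := by
  refine ⟨fun x => Finset.prod_nonneg fun i _ => hP.1 _, ?_⟩
  rw [← (seqEquiv U V Z k).sum_comp]
  exact (isPMF_prod hP k).2

lemma sum_sum_sum_eq_one {P : U × V × Z → ℝ} (hP : IsPMF P) : ∑ z, ∑ u, ∑ v, P (u, v, z) = 1 := by
  rw [← hP.2, Finset.sum_comm, Fintype.sum_prod_type]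
  refine Finset.sum_congr rfl fun u _ => ?_
  rw [Fintype.sum_prod_type_right]

lemma sliceU_prodSource_one {P₁ : U₁ × V₁ × Z₁ → ℝ} {P₂ : U₂ × V₂ × Z₂ → ℝ} (h₁ : IsPMF P₁)
    (h₂ : IsPMF P₂) : sliceU (prodSource P₁ P₂) 1 = sliceU P₁ 1 + sliceU P₂ 1 := by
  rw [sliceU_prodSource h₁.1 h₂.1 (t := 1) fun _ => zero_le_one]
  simp only [Pi.one_apply, mul_one]
  have e1 : ∀ c : ℝ, (fun _ : U₁ => c) = c • 1 := fun c => by funext; simp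
  have e2 : ∀ c : ℝ, (fun _ : U₂ => c) = c • 1 := fun c => by funext; simp
  simp only [e1, e2, sliceU_smul, ← Finset.sum_mul]
  rw [sum_sum_sum_eq_one h₂, Finset.sum_comm (s := (Finset.univ : Finset U₁)),
    sum_sum_sum_eq_one h₁, one_mul, one_mul]

lemma sliceU_seqSource_zero (P : U × V × Z → ℝ) (t : (Fin 0 → U) → ℝ) :
    sliceU (seqSource P 0) t = 0 :=
  Finset.sum_eq_zero fun _ _ => massEntropy_of_subsingleton _

lemma sliceU_seqSource_one {P : U × V × Z → ℝ} (hP : IsPMF P) (k : ℕ) :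
    sliceU (seqSource P k) 1 = k * sliceU P 1 := by
  induction k with
  | zero => simp [sliceU_seqSource_zero]
  | succ k ih =>
    rw [sliceU_seqSource_succ]
    refine (sliceU_prodSource_one hP (isPMF_seqSource hP k)).trans ?_
    rw [ih]; push_cast; ring

end Product

section SingleLetter

variable {U V Z : Type} [Fintype U] [Fintype V] [Fintype Z]

/-- Finite sums of the triples `(t, H(V|Z), H(U|Z))` over nonnegative reweightings `t`. -/
def sliceCone (P : U × V × Z → ℝ) : AddSubmonoid ((U → ℝ) × ℝ × ℝ) :=
  AddSubmonoid.closure {s | ∃ t : U → ℝ, (∀ u, 0 ≤ t u) ∧ s = (t, sliceV P t, sliceU P t)}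

lemma mem_sliceCone (P : U × V × Z → ℝ) {t : U → ℝ} (ht : ∀ u, 0 ≤ t u) :
    (t, sliceV P t, sliceU P t) ∈ sliceCone P :=
  AddSubmonoid.subset_closure ⟨t, ht, rfl⟩

lemma smul_mem_sliceCone {P : U × V × Z → ℝ} {c : ℝ} (hc : 0 ≤ c) {s : (U → ℝ) × ℝ × ℝ}
    (hs : s ∈ sliceCone P) : c • s ∈ sliceCone P := by
  induction hs using AddSubmonoid.closure_induction with
  | mem s h =>
    obtain ⟨t, ht, rfl⟩ := h
    have := mem_sliceCone P (t := c • t) fun u => mul_nonneg hc (ht u)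
    rwa [sliceV_smul, sliceU_smul] at this
  | zero => rw [smul_zero]; exact zero_mem _
  | add a b _ _ ha hb => rw [smul_add]; exact add_mem ha hb

/-- Single-letterisation of a reweighting of the `k`-fold source. -/
lemma exists_singleLetter {P : U × V × Z → ℝ} (hP : IsPMF P) (k : ℕ) :
    ∃ Λ : ((Fin k → U) → ℝ) →+ (U → ℝ), Λ 1 = (k : ℝ) • 1 ∧ ∀ t : (Fin k → U) → ℝ,
      (∀ u, 0 ≤ t u) → ∃ x y, (Λ t, x, y) ∈ sliceCone P ∧ x ≤ sliceV (seqSource P k) t ∧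
        sliceU (seqSource P k) t ≤ y := by
  induction k with
  | zero =>
    refine ⟨0, by simp, fun t ht => ⟨0, 0, zero_mem _, ?_, ?_⟩⟩
    · exact sliceV_nonneg (isPMF_seqSource hP 0).1 ht
    · exact (sliceU_seqSource_zero P t).le
  | succ k ih =>
    obtain ⟨Λ, hΛ1, hΛ⟩ := ih
    have hk := isPMF_seqSource hP k
    let A (t : (Fin (k + 1) → U) → ℝ) (z : Fin k → Z) : U → ℝ := fun u =>
      ∑ u', (∑ v', seqSource P k (u', v', z)) * t (Fin.cons u u')
    let B (t : (Fin (k + 1) → U) → ℝ) (u : U) (z : Z) : (Fin k → U) → ℝ := fun u' =>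
      (∑ v, P (u, v, z)) * t (Fin.cons u u')
    have hA : ∀ s t, (∑ z, A (s + t) z) = (∑ z, A s z) + ∑ z, A t z := by
      intro s t
      rw [← Finset.sum_add_distrib]
      refine Finset.sum_congr rfl fun z _ => ?_
      funext u
      simp only [A, Pi.add_apply, mul_add, Finset.sum_add_distrib]
    have hB : ∀ s t u z, B (s + t) u z = B s u z + B t u z := by
      intro s t u z
      funext u'
      simp only [B, Pi.add_apply, mul_add]
    refine ⟨AddMonoidHom.mk' (fun t => (∑ z, A t z) + ∑ u, ∑ z, Λ (B t u z)) ?_, ?_, ?_⟩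
    · intro s t
      simp only [hA, hB, map_add, Finset.sum_add_distrib]
      abel
    · have h1 : (∑ z, A 1 z) = 1 := by
        funext u
        simp only [A, Finset.sum_apply, Pi.one_apply, mul_one]
        exact sum_sum_sum_eq_one hk
      have h2 : (∑ u, ∑ z, B 1 u z) = 1 := by
        funext u'
        simp only [B, Finset.sum_apply, Pi.one_apply, mul_one]
        rw [Finset.sum_comm]
        exact sum_sum_sum_eq_one hP
      simp only [AddMonoidHom.mk'_apply, ← map_sum, h1, h2, hΛ1]
      push_cast
      rw [add_smul, one_smul, add_comm]
    · intro t ht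
      have hA0 : ∀ z u, 0 ≤ A t z u := fun z u => Finset.sum_nonneg fun u' _ =>
        mul_nonneg (Finset.sum_nonneg fun v' _ => hk.1 _) (ht _)
      have hB0 : ∀ u z u', 0 ≤ B t u z u' := fun u z u' =>
        mul_nonneg (Finset.sum_nonneg fun v' _ => hP.1 _) (ht _)
      choose x y hxy hx hy using fun u z => hΛ (B t u z) (hB0 u z)
      refine ⟨(∑ z, sliceV P (A t z)) + ∑ u, ∑ z, x u z,
        (∑ z, sliceU P (A t z)) + ∑ u, ∑ z, y u z, ?_, ?_, ?_⟩
      · have h1 : (∑ z, ((A t z, sliceV P (A t z), sliceU P (A t z)) : (U → ℝ) × ℝ × ℝ)) +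
            ∑ u, ∑ z, ((Λ (B t u z), x u z, y u z) : (U → ℝ) × ℝ × ℝ) ∈ sliceCone P :=
          add_mem (sum_mem fun z _ => mem_sliceCone P (hA0 z))
            (sum_mem fun u _ => sum_mem fun z _ => hxy u z)
        convert h1 using 1
        ext <;> simp [Prod.fst_sum, Prod.snd_sum]
      · rw [sliceV_seqSource_succ]
        refine le_trans ?_ (le_sliceV_prodSource hP.1 hk.1 fun u => ht _)
        gcongr
        exact hx _ _
      · rw [sliceU_seqSource_succ]
        refine (sliceU_prodSource hP.1 hk.1 fun u => ht _).le.trans ?_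
        gcongr
        exact hy _ _

lemma exists_mem_sliceCone_of_kernel {P : U × V × Z → ℝ} (hP : IsPMF P) {k : ℕ} (hk : 1 ≤ k)
    {W : Type} [Fintype W] {f : (Fin k → U) → W → ℝ} (hf : IsKernel f) :
    ∃ x y, (1, x, y) ∈ sliceCone P ∧
      k * x ≤ ∑ w, sliceV (seqSource P k) (fun u => f u w) ∧
      ∑ w, sliceU (seqSource P k) (fun u => f u w) ≤ k * y := by
  obtain ⟨Λ, hΛ1, hΛ⟩ := exists_singleLetter hP k
  choose x y hxy hx hy using fun w => hΛ (fun u => f u w) fun u => (hf u).1 w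
  have hk0 : (k : ℝ) ≠ 0 := by positivity
  refine ⟨(k : ℝ)⁻¹ * ∑ w, x w, (k : ℝ)⁻¹ * ∑ w, y w, ?_, ?_, ?_⟩
  · have h1 : (k : ℝ)⁻¹ • (∑ w, ((Λ (fun u => f u w), x w, y w) : (U → ℝ) × ℝ × ℝ)) ∈
        sliceCone P :=
      smul_mem_sliceCone (by positivity) (sum_mem fun w _ => hxy w)
    convert h1 using 1
    have h2 : (∑ w, fun u => f u w) = 1 := by
      funext u; simp [(hf u).2]
    have h3 : (k : ℝ)⁻¹ • ∑ w, Λ (fun u => f u w) = 1 := by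
      rw [← map_sum, h2, hΛ1, smul_smul, inv_mul_cancel₀ hk0, one_smul]
    rw [← h3]
    ext <;> simp [Prod.fst_sum, Prod.snd_sum]
  · rw [mul_inv_cancel_left₀ hk0]; exact Finset.sum_le_sum fun w _ => hx w
  · rw [mul_inv_cancel_left₀ hk0]; exact Finset.sum_le_sum fun w _ => hy w

end SingleLetter

section Caratheodory

variable {U V Z : Type} [Fintype U] [Fintype V] [Fintype Z]

/-- The generators of `sliceCone P` normalised to have total weight `|U|`. -/
def normalizedSlices (P : U × V × Z → ℝ) : Set ((U → ℝ) × ℝ × ℝ) :=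
  {s | ∃ t : U → ℝ, (∀ u, 0 ≤ t u) ∧ ∑ u, t u = Fintype.card U ∧ s = (t, sliceV P t, sliceU P t)}

lemma exists_smul_convexHull_of_mem_sliceCone [Nonempty U] {P : U × V × Z → ℝ}
    {a : (U → ℝ) × ℝ × ℝ} (ha : a ∈ sliceCone P) :
    ∃ c : ℝ, 0 ≤ c ∧ ∃ s ∈ convexHull ℝ (normalizedSlices P), a = c • s := by
  have hU : (0 : ℝ) < Fintype.card U := by exact_mod_cast Fintype.card_pos
  have hone : ((1 : U → ℝ), sliceV P 1, sliceU P 1) ∈ convexHull ℝ (normalizedSlices P) :=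
    subset_convexHull ℝ _ ⟨1, fun _ => zero_le_one, by simp, rfl⟩
  induction ha using AddSubmonoid.closure_induction with
  | mem a h =>
    obtain ⟨t, ht, rfl⟩ := h
    have hs : 0 ≤ ∑ u, t u := Finset.sum_nonneg fun u _ => ht u
    set c := (∑ u, t u) / Fintype.card U with hc
    have hc0 : 0 ≤ c := by positivity
    rcases hc0.eq_or_lt with h | h
    · have h0 : ∑ u, t u = 0 := by
        rw [eq_comm, hc, div_eq_zero_iff] at h
        exact h.resolve_right hU.ne'
      have ht0 : t = 0 := by
        funext u
        exact (Finset.sum_eq_zero_iff_of_nonneg fun u _ => ht u).1 h0 u (Finset.mem_univ _)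
      refine ⟨0, le_rfl, _, hone, ?_⟩
      have hV := sliceV_smul P 0 t
      have hUU := sliceU_smul P 0 t
      rw [ht0, smul_zero, zero_mul] at hV hUU
      rw [ht0, hV, hUU, zero_smul]; rfl
    · refine ⟨c, hc0, (c⁻¹ • t, sliceV P (c⁻¹ • t), sliceU P (c⁻¹ • t)),
        subset_convexHull ℝ _ ⟨c⁻¹ • t, fun u => mul_nonneg (by positivity) (ht u), ?_, rfl⟩, ?_⟩
      · simp only [Pi.smul_apply, smul_eq_mul, ← Finset.mul_sum]
        rw [inv_mul_eq_iff_eq_mul₀ h.ne', hc, div_mul_cancel₀ _ hU.ne']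
      · simp only [sliceV_smul, sliceU_smul, Prod.smul_mk, smul_smul, smul_eq_mul,
          mul_inv_cancel_left₀ h.ne', mul_inv_cancel₀ h.ne', one_smul]
  | zero => exact ⟨0, le_rfl, _, hone, by rw [zero_smul]⟩
  | add a b _ _ ha hb =>
    obtain ⟨c, hc, s, hs, rfl⟩ := ha
    obtain ⟨d, hd, r, hr, rfl⟩ := hb
    rcases (add_nonneg hc hd).eq_or_lt with h | h
    · have h1 : c = 0 := by linarith
      have h2 : d = 0 := by linarith
      exact ⟨0, le_rfl, s, hs, by simp [h1, h2]⟩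
    · refine ⟨c + d, h.le, (c / (c + d)) • s + (d / (c + d)) • r,
        convex_convexHull ℝ _ hs hr (by positivity) (by positivity) (by field_simp), ?_⟩
      rw [smul_add, smul_smul, smul_smul, mul_div_cancel₀ _ h.ne', mul_div_cancel₀ _ h.ne']

lemma sum_fst_of_mem_convexHull {P : U × V × Z → ℝ} {s : (U → ℝ) × ℝ × ℝ}
    (hs : s ∈ convexHull ℝ (normalizedSlices P)) : ∑ u, s.1 u = Fintype.card U := by
  have hconv : Convex ℝ {s : (U → ℝ) × ℝ × ℝ | ∑ u, s.1 u = Fintype.card U} := by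
    intro a ha b hb c d _ _ hcd
    simp only [Set.mem_ofPred_eq] at *
    simp only [Prod.fst_add, Prod.smul_fst, Pi.add_apply, Pi.smul_apply, smul_eq_mul,
      Finset.sum_add_distrib, ← Finset.mul_sum, ha, hb, ← add_mul, hcd, one_mul]
  refine convexHull_min ?_ hconv hs
  rintro _ ⟨t, _, h, rfl⟩
  exact h

/-- Cardinality bound for the auxiliary alphabet. -/
lemma exists_kernel_of_mem_sliceCone [Nonempty U] {P : U × V × Z → ℝ} {x y : ℝ}
    (h : (1, x, y) ∈ sliceCone P) :
    ∃ f : U → Fin (Fintype.card U + 4) → ℝ, IsKernel f ∧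
      ∑ w, sliceV P (fun u => f u w) = x ∧ ∑ w, sliceU P (fun u => f u w) = y := by
  have hU : (0 : ℝ) < Fintype.card U := by exact_mod_cast Fintype.card_pos
  obtain ⟨c, hc, s, hs, hcs⟩ := exists_smul_convexHull_of_mem_sliceCone h
  have hc1 : c = 1 := by
    have h1 := congrArg (fun a : (U → ℝ) × ℝ × ℝ => ∑ u, a.1 u) hcs
    simp only [Prod.smul_fst, Pi.smul_apply, smul_eq_mul, ← Finset.mul_sum,
      sum_fst_of_mem_convexHull hs, Pi.one_apply, Finset.sum_const, Finset.card_univ,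
      nsmul_eq_mul, mul_one] at h1
    nlinarith
  rw [hc1, one_smul] at hcs
  rw [← hcs] at hs
  obtain ⟨ι, _, z, w, hz, hind, hw, hw1, hsum⟩ := eq_pos_convex_span_of_mem_convexHull hs
  have hcard : Fintype.card ι ≤ Fintype.card U + 4 := by
    have := hind.card_le_finrank_succ
    have h2 : Module.finrank ℝ (vectorSpan ℝ (Set.range z)) ≤ Fintype.card U + 2 := by
      refine (Submodule.finrank_le _).trans ?_
      simp [Module.finrank_prod]
    omega
  obtain ⟨e⟩ : Nonempty (ι ↪ Fin (Fintype.card U + 4)) :=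
    Function.Embedding.nonempty_of_card_le (by simpa using hcard)
  have ht : ∀ i, ∃ t : U → ℝ, (∀ u, 0 ≤ t u) ∧ z i = (t, sliceV P t, sliceU P t) := by
    intro i
    obtain ⟨t, ht, _, h⟩ := hz ⟨i, rfl⟩
    exact ⟨t, ht, h⟩
  choose t ht0 htz using ht
  classical
  set f : U → Fin (Fintype.card U + 4) → ℝ := fun u => Function.extend e (fun i => w i * t i u) 0
    with hf
  have hsumf : ∀ F : (U → ℝ) → ℝ, F 0 = 0 →
      ∑ a, F (fun u => f u a) = ∑ i, F (w i • t i) := by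
    intro F hF
    rw [← Finset.sum_subset (Finset.subset_univ (Finset.univ.map e)), Finset.sum_map]
    · refine Finset.sum_congr rfl fun i _ => ?_
      congr 1; funext u
      simp [hf, e.injective.extend_apply]
    · intro a _ ha
      rw [← hF]; congr 1; funext u
      rw [hf]
      simp only
      rw [Function.extend_apply']
      · rfl
      · rintro ⟨i, rfl⟩
        exact ha (by simp)
  have hVz : sliceV P 0 = 0 := by simpa using sliceV_smul P 0 0
  have hUz : sliceU P 0 = 0 := by simpa using sliceU_smul P 0 0
  simp only [htz] at hsum
  refine ⟨f, fun u => ⟨fun a => ?_, ?_⟩, ?_, ?_⟩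
  · by_cases ha : ∃ i, e i = a
    · obtain ⟨i, rfl⟩ := ha
      simp only [hf, e.injective.extend_apply]
      exact mul_nonneg (hw i).le (ht0 i u)
    · simp only [hf, Function.extend_apply' _ _ _ ha]
      exact le_rfl
  · rw [hsumf (fun g => g u) rfl]
    have := congrFun (congrArg Prod.fst hsum) u
    simpa [Prod.fst_sum, Finset.sum_apply] using this
  · rw [hsumf _ hVz]
    have := congrArg (fun a : (U → ℝ) × ℝ × ℝ => a.2.1) hsum
    simpa [Prod.fst_sum, Prod.snd_sum, sliceV_smul] using this
  · rw [hsumf _ hUz]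
    have := congrArg (fun a : (U → ℝ) × ℝ × ℝ => a.2.2) hsum
    simpa [Prod.fst_sum, Prod.snd_sum, sliceU_smul] using this

end Caratheodory

section Channel

variable {X Y : Type} [Fintype X] [Fintype Y]

/-- `n` independent uses of a channel. -/
def seqChannel (Ch : X → Y → ℝ) (n : ℕ) : (Fin n → X) → (Fin n → Y) → ℝ :=
  fun x y => ∏ j, Ch (x j) (y j)

lemma isKernel_seqChannel {Ch : X → Y → ℝ} (hCh : IsKernel Ch) (n : ℕ) :
    IsKernel (seqChannel Ch n) := by
  refine fun x => ⟨fun y => Finset.prod_nonneg fun j _ => (hCh _).1 _, ?_⟩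
  unfold seqChannel
  rw [sum_pi_prod fun j => Ch (x j)]
  simp [(hCh _).2]

lemma mutualInfo_le_logb_card {q : X → ℝ} {Ch : X → Y → ℝ} (hq : IsPMF q) (hCh : IsKernel Ch) :
    mutualInfo (fun xy : X × Y => q xy.1 * Ch xy.1 xy.2) ≤ logb 2 (Fintype.card Y) := by
  rw [mutualInfo_channel_eq hq hCh]
  have h1 := massEntropy_le_logb_card (g := fun b => ∑ a, q a * Ch a b)
    fun b => Finset.sum_nonneg fun a _ => mul_nonneg (hq.1 a) ((hCh a).1 b)
  rw [sum_sum_mul_kernel hCh, hq.2, one_mul] at h1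
  have h2 : 0 ≤ ∑ a, q a * massEntropy (Ch a) :=
    Finset.sum_nonneg fun a _ => mul_nonneg (hq.1 a) (massEntropy_nonneg (hCh a).1)
  linarith

lemma mutualInfo_nonneg {q : X → ℝ} {Ch : X → Y → ℝ} (hq : IsPMF q) (hCh : IsKernel Ch) :
    0 ≤ mutualInfo (fun xy : X × Y => q xy.1 * Ch xy.1 xy.2) := by
  rw [mutualInfo_channel_eq hq hCh, sub_nonneg]
  simp only [← massEntropy_smul]
  exact sum_massEntropy_le fun a b => mul_nonneg (hq.1 a) ((hCh a).1 b)

lemma capacity_nonneg {Ch : X → Y → ℝ} (hCh : IsKernel Ch) : 0 ≤ capacity Ch := by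
  refine Real.sSup_nonneg ?_
  rintro _ ⟨q, hq, rfl⟩
  exact mutualInfo_nonneg hq hCh

lemma mutualInfo_le_capacity {q : X → ℝ} {Ch : X → Y → ℝ} (hq : IsPMF q) (hCh : IsKernel Ch) :
    mutualInfo (fun xy : X × Y => q xy.1 * Ch xy.1 xy.2) ≤ capacity Ch := by
  refine le_csSup ⟨logb 2 (Fintype.card Y), ?_⟩ ⟨q, hq, rfl⟩
  rintro _ ⟨q, hq, rfl⟩
  exact mutualInfo_le_logb_card hq hCh

lemma massEntropy_channel_le_capacity {q : X → ℝ} {Ch : X → Y → ℝ} (hq : IsPMF q)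
    (hCh : IsKernel Ch) :
    massEntropy (fun b => ∑ a, q a * Ch a b) - ∑ a, q a * massEntropy (Ch a) ≤ capacity Ch :=
  (mutualInfo_channel_eq hq hCh).symm.le.trans (mutualInfo_le_capacity hq hCh)

lemma massEntropy_seqChannel_le {Ch : X → Y → ℝ} (hCh : IsKernel Ch) (n : ℕ)
    {p : (Fin n → X) → ℝ} (hp : IsPMF p) :
    massEntropy (fun y => ∑ x, p x * seqChannel Ch n x y) -
      ∑ x, p x * massEntropy (seqChannel Ch n x) ≤ n * capacity Ch := by
  induction n with
  | zero =>
    simp [massEntropy_of_subsingleton]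
  | succ n ih =>
    have hK := isKernel_seqChannel hCh n
    have hcons : ∀ x x' y y', seqChannel Ch (n + 1) (Fin.cons x x') (Fin.cons y y') =
        Ch x y * seqChannel Ch n x' y' := by
      intro x x' y y'
      simp [seqChannel, Fin.prod_univ_succ]
    set e := Fin.consEquiv fun _ : Fin (n + 1) => Y
    have h1 : ∀ x x', massEntropy (seqChannel Ch (n + 1) (Fin.cons x x')) =
        massEntropy (Ch x) + massEntropy (seqChannel Ch n x') := by
      intro x x'
      rw [← massEntropy_comp_equiv e, massEntropy_prod
        fun y => (isKernel_seqChannel hCh (n + 1) _).1 _]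
      have : ∀ y y', e (y, y') = Fin.cons y y' := fun _ _ => rfl
      simp only [this, hcons, ← Finset.mul_sum, (hK _).2, mul_one, massEntropy_smul,
        ← Finset.sum_mul, (hCh _).2, one_mul]
    have hq1 : IsPMF fun x => ∑ x', p (Fin.cons x x') :=
      ⟨fun x => Finset.sum_nonneg fun _ _ => hp.1 _, by rw [← hp.2, sum_fin_succ_fun]⟩
    have hq2 : IsPMF fun x' => ∑ x, p (Fin.cons x x') :=
      ⟨fun x => Finset.sum_nonneg fun _ _ => hp.1 _, by
        rw [← hp.2, sum_fin_succ_fun, Finset.sum_comm]⟩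
    have h2 : massEntropy (fun y => ∑ x, p x * seqChannel Ch (n + 1) x y) ≤
        massEntropy (fun y => ∑ x, (∑ x', p (Fin.cons x x')) * Ch x y) +
        massEntropy (fun y' => ∑ x', (∑ x, p (Fin.cons x x')) * seqChannel Ch n x' y') := by
      rw [← massEntropy_comp_equiv e]
      refine (massEntropy_prod_le fun y => Finset.sum_nonneg fun x _ =>
        mul_nonneg (hp.1 _) ((isKernel_seqChannel hCh (n + 1) _).1 _)).trans (le_of_eq ?_)
      have : ∀ y y', e (y, y') = Fin.cons y y' := fun _ _ => rfl
      simp only [this, sum_fin_succ_fun n (fun x => p x * _), hcons]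
      congr 2
      · funext y
        rw [Finset.sum_comm]
        refine Finset.sum_congr rfl fun x _ => ?_
        rw [Finset.sum_comm, Finset.sum_mul]
        simp only [← Finset.mul_sum, (hK _).2, mul_one]
      · funext y'
        rw [Finset.sum_comm, Finset.sum_congr rfl fun x _ => Finset.sum_comm, Finset.sum_comm]
        refine Finset.sum_congr rfl fun x' _ => ?_
        rw [Finset.sum_mul]
        refine Finset.sum_congr rfl fun x _ => ?_
        simp only [← Finset.mul_sum, ← Finset.sum_mul, (hCh _).2, one_mul]
    have h3 : ∑ x, p x * massEntropy (seqChannel Ch (n + 1) x) =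
        (∑ x, (∑ x', p (Fin.cons x x')) * massEntropy (Ch x)) +
        ∑ x', (∑ x, p (Fin.cons x x')) * massEntropy (seqChannel Ch n x') := by
      rw [sum_fin_succ_fun]
      simp only [h1, mul_add, Finset.sum_add_distrib, Finset.sum_mul]
      congr 1
      exact Finset.sum_comm
    have h4 := massEntropy_channel_le_capacity hq1 hCh
    have h5 := ih hq2
    push_cast
    linarith

end Channel

section Converse

variable {U V Z X Y : Type} [Fintype U] [Fintype V] [Fintype Z] [Fintype X] [Fintype Y]

/-- Probability of recovering `v` from the index `φ v`, the output `y` of the kernel `F` and the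
side information `z`, when `(u, v, z)` is drawn from `Q`. -/
def correctMass {m : ℕ} (Q : U × V × Z → ℝ) (F : U → Y → ℝ) (φ : V → Fin m)
    (g : Fin m × Y × Z → V) : ℝ :=
  ∑ y, ∑ v, ∑ z, ind (g (φ v, y, z) = v) * ∑ u, Q (u, v, z) * F u y

/-- Composition of two kernels. -/
def compKernel (f : U → X → ℝ) (K : X → Y → ℝ) : U → Y → ℝ :=
  fun u y => ∑ x, f u x * K x y

lemma isKernel_compKernel {f : U → X → ℝ} {K : X → Y → ℝ} (hf : IsKernel f) (hK : IsKernel K) :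
    IsKernel (compKernel f K) := fun u =>
  ⟨fun y => Finset.sum_nonneg fun x _ => mul_nonneg ((hf u).1 x) ((hK x).1 y),
    by unfold compKernel; rw [sum_sum_mul_kernel hK, (hf u).2]⟩

lemma ind_nonneg (p : Prop) : 0 ≤ ind p := by unfold ind; split_ifs <;> simp

lemma ind_of {p : Prop} (h : p) : ind p = 1 := by simp [ind, h]

lemma ind_of_not {p : Prop} (h : ¬ p) : ind p = 0 := by simp [ind, h]

lemma ind_le_one (p : Prop) : ind p ≤ 1 := by unfold ind; split_ifs <;> simp

lemma probCorrect_eq_correctMass (P : U × V × Z → ℝ) (Ch : X → Y → ℝ) (k n m : ℕ)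
    (f : Fin 1 → (Fin k → U) → (Fin n → X) → ℝ) (φ : (Fin k → V) → Fin m)
    (g : Fin m × (Fin 1 → Fin n → Y) × (Fin k → Z) → (Fin k → V)) :
    probCorrect (L := 1) (U := fun _ => U) (X := fun _ => X) (Y := fun _ => Y)
        (fun x => P (x.1 0, x.2.1, x.2.2)) (fun _ => Ch) k n m f φ g =
      correctMass (seqSource P k) (compKernel (f 0) (seqChannel Ch n)) φ
        (fun s => g (s.1, fun _ => s.2.1, s.2.2)) := by
  unfold probCorrect correctMass inducedDist compKernel seqSource seqChannel
  simp only [Fintype.sum_prod_type]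
  refine ((Equiv.funUnique (Fin 1) (Fin n → Y)).symm.sum_comp _).symm.trans ?_
  refine Finset.sum_congr rfl fun y _ => Finset.sum_congr rfl fun v _ =>
    Finset.sum_congr rfl fun z _ => ?_
  congr 1
  refine ((Equiv.funUnique (Fin 1) (Fin k → U)).symm.sum_comp _).symm.trans ?_
  refine Finset.sum_congr rfl fun u _ => ?_
  refine ((Equiv.funUnique (Fin 1) (Fin n → X)).symm.sum_comp _).symm.trans ?_
  rw [Finset.mul_sum]
  refine Finset.sum_congr rfl fun x _ => ?_
  simp [Equiv.funUnique, uniqueElim]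

lemma sum_correctMass_total {Q : U × V × Z → ℝ} (hQ : IsPMF Q) {F : U → Y → ℝ} (hF : IsKernel F) :
    ∑ y, ∑ v, ∑ z, ∑ u, Q (u, v, z) * F u y = 1 := by
  rw [← hQ.2, Fintype.sum_prod_type, Finset.sum_comm]
  simp only [Fintype.sum_prod_type]
  rw [Finset.sum_comm (s := (Finset.univ : Finset U))]
  refine Finset.sum_congr rfl fun v _ => ?_
  rw [Finset.sum_comm, Finset.sum_comm (s := (Finset.univ : Finset U))]
  refine Finset.sum_congr rfl fun z _ => ?_
  exact sum_sum_mul_kernel hF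

/-- Fano's inequality for a decoder with an `m`-valued hint. -/
lemma sum_sliceV_le_of_correctMass {m : ℕ} (hm : 1 ≤ m) [Nonempty V] {Q : U × V × Z → ℝ}
    (hQ : IsPMF Q) {F : U → Y → ℝ} (hF : IsKernel F) (φ : V → Fin m) (g : Fin m × Y × Z → V) :
    ∑ y, sliceV Q (fun u => F u y) ≤
      1 + logb 2 m + (1 - correctMass Q F φ g) * logb 2 (Fintype.card V) := by
  classical
  have hm0 : (0 : ℝ) < m := by exact_mod_cast hm
  have hV0 : (0 : ℝ) < Fintype.card V := by exact_mod_cast Fintype.card_pos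
  have hlm : 0 ≤ logb 2 (m : ℝ) := logb_nonneg (by norm_num) (by exact_mod_cast hm)
  have hlV : 0 ≤ logb 2 (Fintype.card V : ℝ) :=
    logb_nonneg (by norm_num) (by exact_mod_cast Fintype.card_pos)
  have key : ∀ y z, massEntropy (fun v => ∑ u, Q (u, v, z) * F u y) ≤
      ∑ v, (∑ u, Q (u, v, z) * F u y) * (1 + logb 2 m +
        (1 - ind (g (φ v, y, z) = v)) * logb 2 (Fintype.card V)) := by
    intro y z
    set q : V → ℝ := fun v => ((∑ i : Fin m, ind (g (i, y, z) = v)) / m + 1 / Fintype.card V) / 2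
      with hq
    have hs : ∀ v, 0 ≤ ∑ i : Fin m, ind (g (i, y, z) = v) :=
      fun v => Finset.sum_nonneg fun i _ => ind_nonneg _
    have hqpos : ∀ v, 0 < q v := fun v => by have := hs v; simp only [hq]; positivity
    have hq1 : ∑ v, q v = 1 := by
      simp only [hq]
      rw [← Finset.sum_div, Finset.sum_add_distrib, ← Finset.sum_div, Finset.sum_comm]
      have : ∀ i : Fin m, ∑ v, ind (g (i, y, z) = v) = 1 := fun i => by simp [ind]
      simp only [this, Finset.sum_const, Finset.card_univ, Fintype.card_fin, nsmul_eq_mul]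
      field_simp
      norm_num
    have hn : ∀ v, 0 ≤ ∑ u, Q (u, v, z) * F u y :=
      fun v => Finset.sum_nonneg fun u _ => mul_nonneg (hQ.1 _) ((hF u).1 y)
    refine (massEntropy_le_crossEntropy hn (fun v => (hqpos v).le) hq1.le
      fun v _ => hqpos v).trans ?_
    rw [← Finset.sum_neg_distrib]
    refine Finset.sum_le_sum fun v _ => ?_
    rw [← mul_neg]
    refine mul_le_mul_of_nonneg_left ?_ (hn v)
    by_cases hc : g (φ v, y, z) = v
    · rw [ind_of hc, sub_self, zero_mul, add_zero]
      have h1 : 1 / (2 * (m : ℝ)) ≤ q v := by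
        have : 1 ≤ ∑ i : Fin m, ind (g (i, y, z) = v) :=
          (ind_of hc).symm.le.trans (Finset.single_le_sum
            (f := fun i : Fin m => ind (g (i, y, z) = v)) (fun i _ => ind_nonneg _)
            (Finset.mem_univ (φ v)))
        have h2 : 1 / (m : ℝ) ≤ (∑ i : Fin m, ind (g (i, y, z) = v)) / m := by gcongr
        have h3 : 0 < 1 / (Fintype.card V : ℝ) := by positivity
        simp only [hq]
        rw [← div_div, div_right_comm]
        linarith
      have := logb_le_logb_of_le (b := 2) (by norm_num) (by positivity) h1
      rw [one_div, logb_inv, logb_mul (by norm_num) hm0.ne', logb_self_eq_one (by norm_num)] at this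
      linarith
    · rw [ind_of_not hc, sub_zero, one_mul]
      have h1 : 1 / (2 * (Fintype.card V : ℝ)) ≤ q v := by
        have := hs v
        have h2 : 0 ≤ (∑ i : Fin m, ind (g (i, y, z) = v)) / m := by positivity
        simp only [hq]
        rw [← div_div, div_right_comm]
        linarith
      have := logb_le_logb_of_le (b := 2) (by norm_num) (by positivity) h1
      rw [one_div, logb_inv, logb_mul (by norm_num) hV0.ne', logb_self_eq_one (by norm_num)] at this
      linarith
  have hsum : ∑ y, sliceV Q (fun u => F u y) ≤
      ∑ y, ∑ v, ∑ z, (∑ u, Q (u, v, z) * F u y) * (1 + logb 2 m +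
        (1 - ind (g (φ v, y, z) = v)) * logb 2 (Fintype.card V)) := by
    refine Finset.sum_le_sum fun y _ => ?_
    rw [Finset.sum_comm]
    exact Finset.sum_le_sum fun z _ => key y z
  refine hsum.trans (le_of_eq ?_)
  have ht := sum_correctMass_total hQ hF
  have : ∀ y v z, (∑ u, Q (u, v, z) * F u y) * (1 + logb 2 m +
        (1 - ind (g (φ v, y, z) = v)) * logb 2 (Fintype.card V)) =
      (∑ u, Q (u, v, z) * F u y) * (1 + logb 2 m + logb 2 (Fintype.card V)) -
        (ind (g (φ v, y, z) = v) * ∑ u, Q (u, v, z) * F u y) * logb 2 (Fintype.card V) :=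
    fun y v z => by ring
  simp only [this, Finset.sum_sub_distrib, ← Finset.sum_mul]
  rw [ht, correctMass]
  ring

lemma sliceU_sub_le_channel {Q : U × V × Z → ℝ} (hQ : IsPMF Q) {f : U → X → ℝ} (hf : IsKernel f)
    {K : X → Y → ℝ} (hK : IsKernel K) :
    ∃ p : X → ℝ, IsPMF p ∧
      sliceU Q 1 - ∑ y, sliceU Q (fun u => compKernel f K u y) ≤
        massEntropy (fun y => ∑ x, p x * K x y) - ∑ x, p x * massEntropy (K x) := by
  set a : Z → U → ℝ := fun z u => ∑ v, Q (u, v, z) with ha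
  have ha0 : ∀ z u, 0 ≤ a z u := fun z u => Finset.sum_nonneg fun v _ => hQ.1 _
  have ha1 : ∑ z, ∑ u, a z u = 1 := sum_sum_sum_eq_one hQ
  have hF := isKernel_compKernel hf hK
  refine ⟨fun x => ∑ z, ∑ u, a z u * f u x, ⟨fun x => Finset.sum_nonneg fun z _ =>
    Finset.sum_nonneg fun u _ => mul_nonneg (ha0 z u) ((hf u).1 x), ?_⟩, ?_⟩
  · rw [Finset.sum_comm, ← ha1]
    exact Finset.sum_congr rfl fun z _ => sum_sum_mul_kernel hf
  have h1 : sliceU Q 1 - ∑ y, sliceU Q (fun u => compKernel f K u y) =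
      ∑ z, massEntropy (fun y => ∑ u, a z u * compKernel f K u y) -
        ∑ z, ∑ u, a z u * massEntropy (compKernel f K u) := by
    unfold sliceU
    rw [Finset.sum_comm, ← Finset.sum_sub_distrib, ← Finset.sum_sub_distrib]
    refine Finset.sum_congr rfl fun z _ => ?_
    have := massEntropy_swap (g := fun u y => a z u * compKernel f K u y)
      fun u y => mul_nonneg (ha0 z u) ((hF u).1 y)
    simp only [massEntropy_smul, ← Finset.mul_sum, (hF _).2] at this
    simpa [ha] using this
  have h2 : ∑ z, massEntropy (fun y => ∑ u, a z u * compKernel f K u y) ≤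
      massEntropy (fun y => ∑ x, (∑ z, ∑ u, a z u * f u x) * K x y) := by
    refine (sum_massEntropy_le fun z y => Finset.sum_nonneg fun u _ =>
      mul_nonneg (ha0 z u) ((hF u).1 y)).trans (le_of_eq ?_)
    congr 1
    funext y
    simp only [compKernel, Finset.mul_sum, Finset.sum_mul]
    rw [Finset.sum_comm' (t' := Finset.univ) (s' := fun _ => Finset.univ) (by simp)]
    rw [Finset.sum_comm]
    rw [Finset.sum_comm (s := (Finset.univ : Finset X))]
    refine Finset.sum_congr rfl fun z _ => ?_
    rw [Finset.sum_comm]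
    refine Finset.sum_congr rfl fun x _ => Finset.sum_congr rfl fun u _ => by ring
  have h3 : ∑ x, (∑ z, ∑ u, a z u * f u x) * massEntropy (K x) ≤
      ∑ z, ∑ u, a z u * massEntropy (compKernel f K u) := by
    have : ∑ x, (∑ z, ∑ u, a z u * f u x) * massEntropy (K x) =
        ∑ z, ∑ u, a z u * ∑ x, f u x * massEntropy (K x) := by
      simp only [Finset.sum_mul, Finset.mul_sum]
      rw [Finset.sum_comm]
      refine Finset.sum_congr rfl fun z _ => ?_
      rw [Finset.sum_comm]
      refine Finset.sum_congr rfl fun x _ => Finset.sum_congr rfl fun u _ => by ring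
    rw [this]
    refine Finset.sum_le_sum fun z _ => Finset.sum_le_sum fun u _ =>
      mul_le_mul_of_nonneg_left ?_ (ha0 z u)
    have := sum_massEntropy_le (g := fun x y => f u x * K x y)
      fun x y => mul_nonneg ((hf u).1 x) ((hK x).1 y)
    simp only [massEntropy_smul] at this
    exact this
  rw [h1]
  exact sub_le_sub h2 h3

/-- Converse: every achievable rate is approached by a single-letter test channel. -/
lemma exists_kernel_of_achievable {P : U × V × Z → ℝ} (hP : IsPMF P) {Ch : X → Y → ℝ}
    (hCh : IsKernel Ch) {τ R ε : ℝ} (hε : 0 < ε)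
    (h : JSCCAchievable (L := 1) (U := fun _ => U) (X := fun _ => X) (Y := fun _ => Y)
      (fun x => P (x.1 0, x.2.1, x.2.2)) (fun _ => Ch) τ R) :
    ∃ f : U → Fin (Fintype.card U + 4) → ℝ, IsKernel f ∧
      sliceU P 1 - ∑ w, sliceU P (fun u => f u w) ≤ τ * capacity Ch ∧
      ∑ w, sliceV P (fun u => f u w) ≤ R + ε := by
  obtain ⟨⟨u₀, v₀, z₀⟩⟩ : Nonempty (U × V × Z) := by
    by_contra hne
    rw [not_nonempty_iff] at hne
    simpa using hP.2
  have : Nonempty U := ⟨u₀⟩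
  have : Nonempty V := ⟨v₀⟩
  set l := logb 2 (Fintype.card V : ℝ) with hl
  have hl0 : 0 ≤ l := logb_nonneg (by norm_num) (by exact_mod_cast Fintype.card_pos)
  obtain ⟨nseq, mseq, δ, f, φ, g, -, hδ, hk⟩ := h (min 1 (ε / (3 * (l + 1))))
    (lt_min one_pos (by positivity)) (min_le_left _ _)
  obtain ⟨k, hk1, hkδ, hkε⟩ : ∃ k : ℕ, 1 ≤ k ∧ δ k < ε / 3 ∧ (1 : ℝ) / k < ε / 3 :=
    ((eventually_ge_atTop 1).and ((hδ.eventually (gt_mem_nhds (by positivity))).and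
      (tendsto_one_div_atTop_nhds_zero_nat.eventually (gt_mem_nhds (by positivity))))).exists
  obtain ⟨hn, hm, hf, hc, hR⟩ := hk k hk1
  have hk0 : (0 : ℝ) < k := by exact_mod_cast hk1
  rw [probCorrect_eq_correctMass] at hc
  have hQ := isPMF_seqSource hP k
  have hF := isKernel_compKernel (hf 0) (isKernel_seqChannel hCh (nseq k))
  have hfano := sum_sliceV_le_of_correctMass hm hQ hF (φ k)
    (fun s => g k (s.1, fun _ => s.2.1, s.2.2))
  obtain ⟨p, hp, hI⟩ := sliceU_sub_le_channel hQ (hf 0) (isKernel_seqChannel hCh (nseq k))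
  have hI := hI.trans (massEntropy_seqChannel_le hCh (nseq k) hp)
  rw [sliceU_seqSource_one hP] at hI
  obtain ⟨x, y, hxy, hx, hy⟩ := exists_mem_sliceCone_of_kernel hP hk1 hF
  obtain ⟨t, ht, rfl, rfl⟩ := exists_kernel_of_mem_sliceCone hxy
  refine ⟨t, ht, ?_, ?_⟩
  · have h1 : k * (sliceU P 1 - ∑ w, sliceU P (fun u => t u w)) ≤ k * (τ * capacity Ch) := by
      have := mul_le_mul_of_nonneg_right hn (capacity_nonneg hCh)
      nlinarith
    exact le_of_mul_le_mul_left h1 hk0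
  · have hcard : logb 2 (Fintype.card (Fin k → V) : ℝ) = k * l := by
      rw [Fintype.card_fun, Fintype.card_fin]
      push_cast
      rw [logb_pow]
    rw [hcard] at hfano
    have h2 : (1 - correctMass (seqSource P k) (compKernel (f k 0) (seqChannel Ch (nseq k))) (φ k)
        (fun s => g k (s.1, fun _ => s.2.1, s.2.2))) * (k * l) ≤ k * (ε / 3) := by
      have h3 : ε / (3 * (l + 1)) * l ≤ ε / 3 := by
        rw [div_mul_eq_mul_div, div_le_div_iff₀ (by positivity) (by norm_num)]
        nlinarith
      have h4 := min_le_right 1 (ε / (3 * (l + 1)))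
      calc _ ≤ ε / (3 * (l + 1)) * (k * l) := by
            refine mul_le_mul_of_nonneg_right ?_ (by positivity)
            linarith
        _ = k * (ε / (3 * (l + 1)) * l) := by ring
        _ ≤ _ := mul_le_mul_of_nonneg_left h3 hk0.le
    rw [div_le_iff₀ hk0] at hR
    rw [div_lt_iff₀ hk0] at hkε
    have h5 : k * ∑ w, sliceV P (fun u => t u w) ≤ k * (R + ε) := by
      nlinarith
    exact le_of_mul_le_mul_left h5 hk0

end Converse

section Product

variable {ι α : Type*} [Fintype ι] [DecidableEq ι] [Fintype α]

lemma exists_le_of_sum_mul_le {p F : α → ℝ} (hp : IsPMF p) {B : ℝ} (h : ∑ a, p a * F a ≤ B) :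
    ∃ a, F a ≤ B := by
  by_contra! hlt
  have h1 : ∑ a, p a * B ≤ ∑ a, p a * F a :=
    Finset.sum_le_sum fun a _ => mul_le_mul_of_nonneg_left (hlt a).le (hp.1 a)
  rw [← Finset.sum_mul, hp.2, one_mul] at h1
  have h2 : ∑ a, p a * (F a - B) = 0 := by
    simp only [mul_sub, Finset.sum_sub_distrib, ← Finset.sum_mul, hp.2]
    linarith
  have h3 := (Finset.sum_eq_zero_iff_of_nonneg fun a _ =>
    mul_nonneg (hp.1 a) (sub_pos.2 (hlt a)).le).1 h2
  have h4 : ∀ a, p a = 0 := fun a =>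
    (mul_eq_zero.1 (h3 a (Finset.mem_univ a))).resolve_right (sub_pos.2 (hlt a)).ne'
  simpa [h4] using hp.2

lemma isPMF_pi_prod {p : α → ℝ} (hp : IsPMF p) : IsPMF (fun c : ι → α => ∏ i, p (c i)) := by
  classical
  exact ⟨fun c => Finset.prod_nonneg fun i _ => hp.1 _, by
    rw [sum_pi_prod (fun _ => p)]; simp [hp.2]⟩

lemma sum_pi_prod_mul_two {p : α → ℝ} (hp : IsPMF p) {i j : ι} (hij : i ≠ j) (g h : α → ℝ) :
    ∑ c : ι → α, (∏ l, p (c l)) * (g (c i) * h (c j)) = (∑ a, p a * g a) * ∑ a, p a * h a := by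
  classical
  have h1 : ∀ c : ι → α, (∏ l, p (c l)) * (g (c i) * h (c j)) =
      ∏ l, p (c l) * ((if l = i then g (c l) else 1) * (if l = j then h (c l) else 1)) := by
    intro c
    rw [Finset.prod_mul_distrib, Finset.prod_mul_distrib, Fintype.prod_ite_eq',
      Fintype.prod_ite_eq']
  simp only [h1]
  rw [sum_pi_prod (fun l a => p a * ((if l = i then g a else 1) * (if l = j then h a else 1))),
    ← Finset.mul_prod_erase _ _ (Finset.mem_univ i),
    ← Finset.mul_prod_erase _ _ (Finset.mem_erase.2 ⟨hij.symm, Finset.mem_univ j⟩)]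
  rw [Finset.prod_eq_one, mul_one]
  · simp [hij, hij.symm]
  · intro l hl
    simp only [Finset.mem_erase] at hl
    simp [hl.1, hl.2.1, hp.2]

lemma sum_pi_prod_mul_one {p : α → ℝ} (hp : IsPMF p) (i : ι) (g : α → ℝ) :
    ∑ c : ι → α, (∏ l, p (c l)) * g (c i) = ∑ a, p a * g a := by
  classical
  have h1 : ∀ c : ι → α, (∏ l, p (c l)) * g (c i) =
      ∏ l, p (c l) * (if l = i then g (c l) else 1) := by
    intro c
    rw [Finset.prod_mul_distrib, Fintype.prod_ite_eq']
  simp only [h1]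
  rw [sum_pi_prod (fun l a => p a * (if l = i then g a else 1)),
    ← Finset.mul_prod_erase _ _ (Finset.mem_univ i), Finset.prod_eq_one, mul_one]
  · simp
  · intro l hl
    simp [(Finset.mem_erase.1 hl).1, hp.2]

lemma sum_pi_prod_mul_apply_two {p : α → ℝ} (hp : IsPMF p) {i j : ι} (hij : i ≠ j)
    (h : α → α → ℝ) :
    ∑ c : ι → α, (∏ l, p (c l)) * h (c i) (c j) = ∑ a, ∑ b, p a * (p b * h a b) := by
  classical
  have h1 : ∀ c : ι → α, (∏ l, p (c l)) * h (c i) (c j) =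
      ∑ a, (∏ l, p (c l)) * ((if c i = a then 1 else 0) * h a (c j)) := by
    intro c
    simp
  simp only [h1]
  rw [Finset.sum_comm]
  refine Finset.sum_congr rfl fun a _ => ?_
  rw [sum_pi_prod_mul_two hp hij (fun x => if x = a then 1 else 0) (h a)]
  simp [Finset.mul_sum]

/-- Second moment of a centred sum of independent variables. -/
lemma sum_pi_prod_mul_sq {p : α → ℝ} (hp : IsPMF p) {g : α → ℝ} (hg : ∑ a, p a * g a = 0) :
    ∑ c : ι → α, (∏ l, p (c l)) * (∑ i, g (c i)) ^ 2 =
      Fintype.card ι * ∑ a, p a * g a ^ 2 := by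
  classical
  have h1 : ∀ c : ι → α, (∏ l, p (c l)) * (∑ i, g (c i)) ^ 2 =
      ∑ i, ∑ j, (∏ l, p (c l)) * (g (c i) * g (c j)) := by
    intro c
    rw [sq, Finset.sum_mul_sum]
    simp only [Finset.mul_sum]
  simp only [h1]
  rw [Finset.sum_comm]
  have h2 : ∀ i : ι, ∑ c : ι → α, ∑ j, (∏ l, p (c l)) * (g (c i) * g (c j)) =
      ∑ a, p a * g a ^ 2 := by
    intro i
    rw [Finset.sum_comm, Finset.sum_eq_single i]
    · rw [sum_pi_prod_mul_one hp i (fun a => g a * g a)]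
      simp only [sq]
    · intro j _ hji
      rw [sum_pi_prod_mul_two hp hji.symm, hg, zero_mul]
    · simp
  simp [h2]

/-- Weak law of large numbers for a likelihood ratio. -/
lemma eventually_tail_le {p A B : α → ℝ} (hp : IsPMF p) (hA : ∀ a, 0 < p a → 0 < A a)
    (hB : ∀ a, 0 < p a → 0 < B a) {ε η : ℝ} (hε : 0 < ε) (hη : 0 < η) :
    ∀ᶠ k : ℕ in atTop, ∑ c : Fin k → α, (∏ i, p (c i)) *
      ind (∏ i, A (c i) < 2 ^ (k * ((∑ a, p a * logb 2 (A a / B a)) - ε)) * ∏ i, B (c i)) ≤ η := by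
  set μ := ∑ a, p a * logb 2 (A a / B a) with hμ
  set g : α → ℝ := fun a => logb 2 (A a / B a) - μ with hg
  have hg0 : ∑ a, p a * g a = 0 := by
    simp only [hg, mul_sub, Finset.sum_sub_distrib, ← Finset.sum_mul, hp.2]
    simp [hμ]
  set σ := ∑ a, p a * g a ^ 2 with hσ
  have hlim : Tendsto (fun k : ℕ => σ / ε ^ 2 * (1 / (k : ℝ))) atTop (nhds 0) := by
    simpa using tendsto_one_div_atTop_nhds_zero_nat.const_mul (σ / ε ^ 2)
  filter_upwards [hlim.eventually (gt_mem_nhds hη), eventually_ge_atTop 1] with k hk hk1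
  have hk0 : (0 : ℝ) < k := by exact_mod_cast hk1
  refine le_trans ?_ hk.le
  have key : ∀ c : Fin k → α, (∏ i, p (c i)) *
      ind (∏ i, A (c i) < 2 ^ (k * (μ - ε)) * ∏ i, B (c i)) ≤
      ((∏ i, p (c i)) * (∑ i, g (c i)) ^ 2) * (1 / (k * ε) ^ 2) := by
    intro c
    have hpc : 0 ≤ ∏ i, p (c i) := Finset.prod_nonneg fun i _ => hp.1 _
    rw [mul_assoc]
    rcases hpc.eq_or_lt with h0 | h0
    · rw [← h0]; simp
    refine mul_le_mul_of_nonneg_left ?_ hpc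
    by_cases hlt : ∏ i, A (c i) < 2 ^ (k * (μ - ε)) * ∏ i, B (c i)
    swap
    · rw [ind_of_not hlt]; positivity
    rw [ind_of hlt]
    have hpi : ∀ i, 0 < p (c i) := fun i => (hp.1 _).lt_of_ne' fun h =>
      h0.ne' (Finset.prod_eq_zero (Finset.mem_univ i) h)
    have hAi : ∀ i, 0 < A (c i) := fun i => hA _ (hpi i)
    have hBi : ∀ i, 0 < B (c i) := fun i => hB _ (hpi i)
    have hBp : 0 < ∏ i, B (c i) := Finset.prod_pos fun i _ => hBi i
    have hAp : 0 < ∏ i, A (c i) := Finset.prod_pos fun i _ => hAi i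
    have h1 := logb_lt_logb (b := 2) (by norm_num) hAp hlt
    rw [logb_mul (by positivity) hBp.ne', logb_rpow (by norm_num) (by norm_num)] at h1
    have h2 : ∑ i, g (c i) = logb 2 (∏ i, A (c i)) - logb 2 (∏ i, B (c i)) - k * μ := by
      rw [logb_prod _ _ fun i _ => (hAi i).ne', logb_prod _ _ fun i _ => (hBi i).ne']
      simp only [hg, Finset.sum_sub_distrib]
      simp [fun i => logb_div (b := 2) (hAi i).ne' (hBi i).ne', Finset.sum_sub_distrib]
    have h3 : ∑ i, g (c i) < -(k * ε) := by rw [h2]; linarith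
    have h4 : (k * ε) ^ 2 ≤ (∑ i, g (c i)) ^ 2 := by
      have : 0 < k * ε := by positivity
      nlinarith
    rw [mul_one_div, le_div_iff₀ (by positivity)]
    linarith
  refine (Finset.sum_le_sum fun c _ => key c).trans (le_of_eq ?_)
  rw [← Finset.sum_mul, sum_pi_prod_mul_sq hp hg0, Fintype.card_fin, ← hσ]
  field_simp

end Product

section Binning

variable {V S : Type} [Fintype V] [Fintype S]

/-- One-shot Slepian–Wolf coding by random binning. -/
lemma exists_binning [Nonempty V] {μ q : V → S → ℝ} (hμ : ∀ v s, 0 ≤ μ v s)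
    (hq : ∀ v s, 0 ≤ q v s) (hq1 : ∀ s, ∑ v, q v s ≤ 1) {T : ℝ} (hT : 0 < T) {m : ℕ}
    (hm : 1 ≤ m) :
    ∃ (φ : V → Fin m) (g : Fin m → S → V),
      ∑ v, ∑ s, μ v s * ind (g (φ v) s ≠ v) ≤
        (∑ v, ∑ s, μ v s * ind (q v s < T)) + (∑ v, ∑ s, μ v s) / (T * m) := by
  classical
  have hm0 : (0 : ℝ) < m := by exact_mod_cast hm
  have hunif : IsPMF (fun _ : Fin m => (1 : ℝ) / m) :=
    ⟨fun _ => by positivity, by simp [hm0.ne']⟩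
  let dec : (V → Fin m) → Fin m → S → V := fun φ i s =>
    if h : ∃ v, φ v = i ∧ T ≤ q v s then h.choose else Classical.arbitrary V
  have hdec : ∀ φ v s, ind (dec φ (φ v) s ≠ v) ≤ ind (q v s < T) +
      ∑ v' ∈ Finset.univ.erase v, ind (φ v' = φ v) * ind (T ≤ q v' s) := by
    intro φ v s
    have hnn : ∀ v' ∈ Finset.univ.erase v, 0 ≤ ind (φ v' = φ v) * ind (T ≤ q v' s) :=
      fun v' _ => mul_nonneg (ind_nonneg _) (ind_nonneg _)
    by_cases hqv : q v s < T
    · rw [ind_of hqv]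
      exact (ind_le_one _).trans (le_add_of_nonneg_right (Finset.sum_nonneg hnn))
    have hex : ∃ v', φ v' = φ v ∧ T ≤ q v' s := ⟨v, rfl, not_lt.1 hqv⟩
    have hd : dec φ (φ v) s = hex.choose := dif_pos hex
    by_cases heq : dec φ (φ v) s = v
    · rw [ind_of_not (by simpa using heq)]
      exact add_nonneg (ind_nonneg _) (Finset.sum_nonneg hnn)
    · rw [ind_of heq, ind_of_not hqv, zero_add]
      have hspec := hex.choose_spec
      rw [← hd] at hspec
      have := Finset.single_le_sum hnn
        (Finset.mem_erase.2 ⟨heq, Finset.mem_univ (dec φ (φ v) s)⟩)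
      rwa [ind_of hspec.1, ind_of hspec.2, mul_one] at this
  have hcount : ∀ s, ∑ v, ind (T ≤ q v s) ≤ 1 / T := by
    intro s
    rw [le_div_iff₀ hT, Finset.sum_mul]
    refine (Finset.sum_le_sum fun v _ => ?_).trans (hq1 s)
    by_cases h : T ≤ q v s
    · rwa [ind_of h, one_mul]
    · rw [ind_of_not h, zero_mul]; exact hq v s
  have hpair : ∀ v v' : V, v' ≠ v →
      ∑ φ : V → Fin m, (∏ _l : V, (1 : ℝ) / m) * ind (φ v' = φ v) = 1 / m := by
    intro v v' h
    rw [sum_pi_prod_mul_apply_two hunif h (fun a b => ind (a = b))]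
    have h1 : ∀ a : Fin m, ∑ b, ind (a = b) = 1 := fun a => by
      rw [Finset.sum_eq_single a (fun b _ hb => ind_of_not hb.symm) (by simp), ind_of rfl]
    simp only [← Finset.mul_sum, h1]
    simp [hm0.ne']
  obtain ⟨φ, hφ⟩ := exists_le_of_sum_mul_le (isPMF_pi_prod (ι := V) hunif)
    (F := fun φ => ∑ v, ∑ s, μ v s * ind (dec φ (φ v) s ≠ v))
    (B := (∑ v, ∑ s, μ v s * ind (q v s < T)) + (∑ v, ∑ s, μ v s) / (T * m)) (by
      have hstep : ∀ v s, ∑ φ : V → Fin m, (∏ _l : V, (1 : ℝ) / m) *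
          (μ v s * ind (dec φ (φ v) s ≠ v)) ≤ μ v s * ind (q v s < T) + μ v s / (T * m) := by
        intro v s
        calc _ ≤ ∑ φ : V → Fin m, (μ v s * ((∏ _l : V, (1 : ℝ) / m) * ind (q v s < T)) +
              ∑ v' ∈ Finset.univ.erase v, μ v s * ind (T ≤ q v' s) *
                ((∏ _l : V, (1 : ℝ) / m) * ind (φ v' = φ v))) := by
              refine Finset.sum_le_sum fun φ _ => ?_
              have h1 := mul_le_mul_of_nonneg_left (hdec φ v s)
                (mul_nonneg ((isPMF_pi_prod (ι := V) hunif).1 φ) (hμ v s))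
              rw [← mul_assoc]
              refine h1.trans (le_of_eq ?_)
              rw [mul_add, Finset.mul_sum]
              congr 1
              · ring
              · exact Finset.sum_congr rfl fun v' _ => by ring
          _ = μ v s * ind (q v s < T) + ∑ v' ∈ Finset.univ.erase v,
                μ v s * ind (T ≤ q v' s) * (1 / m) := by
              rw [Finset.sum_add_distrib, ← Finset.mul_sum, ← Finset.sum_mul,
                (isPMF_pi_prod (ι := V) hunif).2, one_mul, Finset.sum_comm]
              congr 1
              refine Finset.sum_congr rfl fun v' hv' => ?_
              rw [← Finset.mul_sum, hpair v v' (Finset.ne_of_mem_erase hv')]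
          _ ≤ _ := by
              refine add_le_add le_rfl ?_
              rw [← Finset.sum_mul, ← Finset.mul_sum]
              have h2 : ∑ v' ∈ Finset.univ.erase v, ind (T ≤ q v' s) ≤ 1 / T :=
                (Finset.sum_le_sum_of_subset_of_nonneg (Finset.erase_subset _ _)
                  fun _ _ _ => ind_nonneg _).trans (hcount s)
              have h3 := mul_le_mul_of_nonneg_left h2 (hμ v s)
              calc _ ≤ μ v s * (1 / T) * (1 / m) := by gcongr
                _ = _ := by field_simp
      simp only [Finset.mul_sum]
      rw [Finset.sum_comm, Finset.sum_div, ← Finset.sum_add_distrib]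
      refine Finset.sum_le_sum fun v _ => ?_
      rw [Finset.sum_comm, Finset.sum_div, ← Finset.sum_add_distrib]
      exact Finset.sum_le_sum fun s _ => hstep v s)
  exact ⟨φ, dec φ, hφ⟩

end Binning

section Codebook

variable {α β : Type*} [Fintype α] [Fintype β]

/-- Soft covering: the empirical mean of a density over a random codebook concentrates at `1`. -/
lemma soft_covering {p a : α → ℝ} (hp : IsPMF p) (ha : ∀ x, 0 ≤ a x) (hsum : ∑ x, p x * a x = 1)
    {T η : ℝ} (hT : 0 ≤ T) (hη : 0 < η) {M : ℕ} (hM : 1 ≤ M)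
    (hTM : T ≤ M * η ^ 2) :
    ∑ c : Fin M → α, (∏ l, p (c l)) * |1 - (∑ j, a (c j)) / M| ≤
      η + 2 * ∑ x, p x * a x * ind (T < a x) := by
  have hM0 : (0 : ℝ) < M := by exact_mod_cast hM
  set b : α → ℝ := fun x => a x * (1 - ind (T < a x)) with hb
  set d : α → ℝ := fun x => a x * ind (T < a x) with hd
  set s := ∑ x, p x * b x with hs
  have hb0 : ∀ x, 0 ≤ b x := fun x => mul_nonneg (ha x) (sub_nonneg.2 (ind_le_one _))
  have hd0 : ∀ x, 0 ≤ d x := fun x => mul_nonneg (ha x) (ind_nonneg _)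
  have hbT : ∀ x, b x ≤ T := fun x => by
    by_cases h : T < a x
    · simp only [hb, ind_of h]; linarith
    · simp only [hb, ind_of_not h]; linarith
  have hsd : s + ∑ x, p x * d x = 1 := by
    rw [← hsum, hs, ← Finset.sum_add_distrib]
    exact Finset.sum_congr rfl fun x _ => by simp only [hb, hd]; ring
  have hd1 : ∑ x, p x * d x = ∑ x, p x * a x * ind (T < a x) :=
    Finset.sum_congr rfl fun x _ => by simp only [hd]; ring
  have hdn : 0 ≤ ∑ x, p x * d x := Finset.sum_nonneg fun x _ => mul_nonneg (hp.1 x) (hd0 x)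
  have hs0 : 0 ≤ s := Finset.sum_nonneg fun x _ => mul_nonneg (hp.1 x) (hb0 x)
  have hcent : ∑ x, p x * (b x - s) = 0 := by
    simp only [mul_sub, Finset.sum_sub_distrib, ← Finset.sum_mul, hp.2]
    simp [hs]
  have hvar : ∑ x, p x * (b x - s) ^ 2 ≤ T := by
    have e1 : ∑ x, p x * (b x - s) ^ 2 = ∑ x, p x * (b x * b x) - s * s := by
      have : ∀ x, p x * (b x - s) ^ 2 = p x * (b x * b x) - 2 * s * (p x * b x) + s * s * p x :=
        fun x => by ring
      simp only [this, Finset.sum_add_distrib, Finset.sum_sub_distrib, ← Finset.mul_sum, hp.2, ← hs]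
      ring
    have e2 : ∑ x, p x * (b x * b x) ≤ ∑ x, T * (p x * b x) :=
      Finset.sum_le_sum fun x _ => by
        have := mul_le_mul_of_nonneg_left (hbT x) (mul_nonneg (hp.1 x) (hb0 x))
        linarith
    rw [← Finset.mul_sum, ← hs] at e2
    nlinarith
  have hpt : ∀ c : Fin M → α, |1 - (∑ j, a (c j)) / M| ≤
      η / 2 + (∑ j, (b (c j) - s)) ^ 2 * (1 / (2 * M ^ 2 * η)) + (1 - s) +
        (∑ j, d (c j)) * (1 / M) := by
    intro c
    have e1 : 1 - (∑ j, a (c j)) / M =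
        -((∑ j, (b (c j) - s)) / M) + ((1 - s) - (∑ j, d (c j)) / M) := by
      have : ∑ j, a (c j) = ∑ j, (b (c j) - s) + M * s + ∑ j, d (c j) := by
        have h3 : ∀ j, a (c j) = b (c j) - s + s + d (c j) := fun j => by
          simp only [hb, hd]; ring
        simp only [fun j => h3 j, Finset.sum_add_distrib]
        simp
      rw [this]
      field_simp
      ring
    have e2 : |(∑ j, (b (c j) - s)) / M| ≤
        η / 2 + (∑ j, (b (c j) - s)) ^ 2 * (1 / (2 * M ^ 2 * η)) := by
      set t := (∑ j, (b (c j) - s)) / M with ht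
      have h4 : (∑ j, (b (c j) - s)) ^ 2 * (1 / (2 * M ^ 2 * η)) = t ^ 2 / (2 * η) := by
        rw [ht]; field_simp
      rw [h4]
      have h5 : 0 ≤ (η - |t|) ^ 2 / (2 * η) := by positivity
      have h6 : (η - |t|) ^ 2 / (2 * η) = η / 2 + t ^ 2 / (2 * η) - |t| := by
        rw [sub_sq, sq_abs]; field_simp; ring
      linarith
    have e3 : |(1 - s) - (∑ j, d (c j)) / M| ≤ (1 - s) + (∑ j, d (c j)) * (1 / M) := by
      have h7 : 0 ≤ ∑ j, d (c j) := Finset.sum_nonneg fun j _ => hd0 _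
      have h8 : 0 ≤ (∑ j, d (c j)) * (1 / M) := by positivity
      rw [div_eq_mul_one_div]
      exact (abs_sub _ _).trans (by rw [abs_of_nonneg (by linarith), abs_of_nonneg h8])
    rw [e1]
    refine (abs_add_le _ _).trans ?_
    rw [abs_neg]
    linarith
  have hpc := isPMF_pi_prod (ι := Fin M) hp
  refine (Finset.sum_le_sum fun c _ => mul_le_mul_of_nonneg_left (hpt c) (hpc.1 c)).trans ?_
  have hE : ∑ c : Fin M → α, (∏ l, p (c l)) * ∑ j, d (c j) = M * ∑ x, p x * d x := by
    simp only [Finset.mul_sum]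
    rw [Finset.sum_comm]
    simp only [← Finset.mul_sum, sum_pi_prod_mul_one hp]
    simp
  simp only [mul_add, Finset.sum_add_distrib, ← mul_assoc, ← Finset.sum_mul, hpc.2, hE]
  rw [sum_pi_prod_mul_sq hp hcent, Fintype.card_fin, ← hd1]
  have e4 : ((M : ℝ) * ∑ x, p x * (b x - s) ^ 2) * (1 / (2 * M ^ 2 * η)) ≤ η / 2 := by
    calc _ ≤ (M * T) * (1 / (2 * M ^ 2 * η)) := by gcongr
      _ ≤ (M * (M * η ^ 2)) * (1 / (2 * M ^ 2 * η)) := by gcongr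
      _ = η / 2 := by field_simp
  have e5 : (M : ℝ) * (∑ x, p x * d x) * (1 / M) = ∑ x, p x * d x := by field_simp
  rw [e5]
  linarith

/-- Union bound for a random codebook decoded by a test `C`. -/
lemma sum_codebook_error_le {p : α → ℝ} (hp : IsPMF p) {M : ℕ} (hM : 1 ≤ M) {R bad : α → β → ℝ}
    (hR : ∀ x t, 0 ≤ R x t) (C : α → β → Prop) (E : (Fin M → α) → β → Prop)
    (hE : ∀ c t j, R (c j) t * ind (E c t) ≤
      R (c j) t * (bad (c j) t + ∑ i ∈ Finset.univ.erase j, ind (C (c i) t))) :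
    ∑ c : Fin M → α, (∏ l, p (c l)) * ∑ t, (∑ j, R (c j) t) / M * ind (E c t) ≤
      (∑ t, ∑ x, p x * (R x t * bad x t)) +
        M * ∑ t, (∑ x, p x * R x t) * ∑ x, p x * ind (C x t) := by
  have hM0 : (0 : ℝ) < M := by exact_mod_cast hM
  have hpc := isPMF_pi_prod (ι := Fin M) hp
  rw [Finset.mul_sum, ← Finset.sum_add_distrib]
  simp only [Finset.mul_sum]
  rw [Finset.sum_comm]
  refine Finset.sum_le_sum fun t _ => ?_
  simp only [← Finset.mul_sum]
  have hpair : ∀ j, ∀ i ∈ Finset.univ.erase j,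
      ∑ c : Fin M → α, (∏ l, p (c l)) * (R (c j) t * ind (C (c i) t)) =
        (∑ x, p x * R x t) * ∑ x, p x * ind (C x t) := fun j i hi =>
    sum_pi_prod_mul_two hp (Finset.ne_of_mem_erase hi).symm (fun x => R x t)
      (fun x => ind (C x t))
  have hcross : 0 ≤ (∑ x, p x * R x t) * ∑ x, p x * ind (C x t) :=
    mul_nonneg (Finset.sum_nonneg fun x _ => mul_nonneg (hp.1 x) (hR x t))
      (Finset.sum_nonneg fun x _ => mul_nonneg (hp.1 x) (ind_nonneg _))
  have hj : ∀ j, ∑ c : Fin M → α, (∏ l, p (c l)) * (R (c j) t * ind (E c t)) ≤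
      (∑ x, p x * (R x t * bad x t)) + M * ((∑ x, p x * R x t) * ∑ x, p x * ind (C x t)) := by
    intro j
    calc _ ≤ ∑ c : Fin M → α, (∏ l, p (c l)) *
          (R (c j) t * (bad (c j) t + ∑ i ∈ Finset.univ.erase j, ind (C (c i) t))) :=
          Finset.sum_le_sum fun c _ => mul_le_mul_of_nonneg_left (hE c t j) (hpc.1 c)
      _ = (∑ c : Fin M → α, (∏ l, p (c l)) * (R (c j) t * bad (c j) t)) +
          ∑ i ∈ Finset.univ.erase j,
            ∑ c : Fin M → α, (∏ l, p (c l)) * (R (c j) t * ind (C (c i) t)) := by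
          rw [Finset.sum_comm, ← Finset.sum_add_distrib]
          refine Finset.sum_congr rfl fun c _ => ?_
          rw [← Finset.mul_sum, ← Finset.mul_sum]
          ring
      _ = (∑ x, p x * (R x t * bad x t)) + ∑ i ∈ Finset.univ.erase j,
            (∑ x, p x * R x t) * ∑ x, p x * ind (C x t) := by
          rw [sum_pi_prod_mul_one hp j (fun x => R x t * bad x t),
            Finset.sum_congr rfl (hpair j)]
      _ ≤ _ := by
          refine add_le_add le_rfl ?_
          rw [Finset.sum_const, nsmul_eq_mul]
          refine mul_le_mul_of_nonneg_right ?_ hcross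
          exact_mod_cast (Finset.card_le_univ _).trans (Fintype.card_fin M).le
  have hre : ∑ c : Fin M → α, (∏ l, p (c l)) * ((∑ j, R (c j) t) / M * ind (E c t)) =
      (∑ j, ∑ c : Fin M → α, (∏ l, p (c l)) * (R (c j) t * ind (E c t))) / M := by
    rw [Finset.sum_comm, Finset.sum_div]
    refine Finset.sum_congr rfl fun c _ => ?_
    rw [← Finset.mul_sum, ← Finset.sum_mul]
    ring
  rw [hre, div_le_iff₀ hM0]
  refine (Finset.sum_le_sum fun j _ => hj j).trans (le_of_eq ?_)
  rw [Finset.sum_const, Finset.card_univ, Fintype.card_fin, nsmul_eq_mul]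
  ring

/-- The likelihood encoder associated with nonnegative weights. -/
lemma exists_likelihood_encoder {U : Type*} {M : ℕ} (hM : 1 ≤ M) {a : U → Fin M → ℝ}
    (ha : ∀ u j, 0 ≤ a u j) :
    ∃ e : U → Fin M → ℝ, IsKernel e ∧ ∀ u j, e u j ≤ a u j + e u j * |1 - ∑ i, a u i| := by
  have hM0 : (0 : ℝ) < M := by exact_mod_cast hM
  suffices ∀ u, ∃ e : Fin M → ℝ, ((∀ j, 0 ≤ e j) ∧ ∑ j, e j = 1) ∧
      ∀ j, e j * ∑ i, a u i = a u j by
    choose e he h using this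
    refine ⟨e, he, fun u j => ?_⟩
    have h1 := mul_le_mul_of_nonneg_left (le_abs_self (1 - ∑ i, a u i)) ((he u).1 j)
    rw [mul_sub, h u j] at h1
    linarith
  intro u
  rcases (Finset.sum_nonneg fun j _ => ha u j : 0 ≤ ∑ j, a u j).eq_or_lt with h0 | h0
  · refine ⟨fun _ => 1 / M, ⟨fun _ => by positivity, by simp [hM0.ne']⟩, fun j => ?_⟩
    rw [← h0, mul_zero, (Finset.sum_eq_zero_iff_of_nonneg fun j _ => ha u j).1 h0.symm j
      (Finset.mem_univ j)]
  · exact ⟨fun j => a u j / ∑ i, a u i, ⟨fun j => div_nonneg (ha u j) h0.le, by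
      rw [← Finset.sum_div, div_self h0.ne']⟩, fun j => div_mul_cancel₀ _ h0.ne'⟩

end Codebook

section OneShot

variable {U V Z W X Y : Type} [Fintype U] [Fintype V] [Fintype Z] [Fintype W] [Fintype X]
  [Fintype Y]

/-- Marginal mass of `(v, z, w)` under the source `Q` and the test channel `f`. -/
def massVZW (Q : U × V × Z → ℝ) (f : U → W → ℝ) (v : V) (z : Z) (w : W) : ℝ :=
  ∑ u, Q (u, v, z) * f u w

/-- Marginal mass of `(z, w)`. -/
def massZW (Q : U × V × Z → ℝ) (f : U → W → ℝ) (z : Z) (w : W) : ℝ := ∑ v, massVZW Q f v z w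

/-- Marginal mass of `w`. -/
def massW (Q : U × V × Z → ℝ) (f : U → W → ℝ) (w : W) : ℝ := ∑ z, massZW Q f z w

/-- Marginal mass of `z`. -/
def massZ (Q : U × V × Z → ℝ) (z : Z) : ℝ := ∑ v, ∑ u, Q (u, v, z)

/-- Marginal mass of `u`. -/
def massU (Q : U × V × Z → ℝ) (u : U) : ℝ := ∑ z, ∑ v, Q (u, v, z)

/-- Output mass of the channel `K` with input distribution `p`. -/
def massY (p : X → ℝ) (K : X → Y → ℝ) (y : Y) : ℝ := ∑ x, p x * K x y

section Marginals

variable {Q : U × V × Z → ℝ} {f : U → W → ℝ}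

lemma massVZW_nonneg (hQ : ∀ x, 0 ≤ Q x) (hf : IsKernel f) (v : V) (z : Z) (w : W) :
    0 ≤ massVZW Q f v z w :=
  Finset.sum_nonneg fun u _ => mul_nonneg (hQ _) ((hf u).1 w)

lemma massZW_nonneg (hQ : ∀ x, 0 ≤ Q x) (hf : IsKernel f) (z : Z) (w : W) :
    0 ≤ massZW Q f z w :=
  Finset.sum_nonneg fun v _ => massVZW_nonneg hQ hf v z w

lemma massW_nonneg (hQ : ∀ x, 0 ≤ Q x) (hf : IsKernel f) (w : W) : 0 ≤ massW Q f w :=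
  Finset.sum_nonneg fun z _ => massZW_nonneg hQ hf z w

lemma massU_nonneg (hQ : ∀ x, 0 ≤ Q x) (u : U) : 0 ≤ massU Q u :=
  Finset.sum_nonneg fun _ _ => Finset.sum_nonneg fun _ _ => hQ _

lemma sum_massU (hQ : IsPMF Q) : ∑ u, massU Q u = 1 := by
  rw [← sum_sum_sum_eq_one hQ, Finset.sum_comm]
  rfl

lemma massW_eq (Q : U × V × Z → ℝ) (f : U → W → ℝ) (w : W) :
    massW Q f w = ∑ u, massU Q u * f u w := by
  simp only [massW, massZW, massVZW, massU, Finset.sum_mul]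
  rw [Finset.sum_comm (s := (Finset.univ : Finset U))]
  exact Finset.sum_congr rfl fun z _ => Finset.sum_comm

lemma sum_massZW (hf : IsKernel f) (z : Z) : ∑ w, massZW Q f z w = massZ Q z := by
  simp only [massZW, massVZW, massZ]
  rw [Finset.sum_comm]
  exact Finset.sum_congr rfl fun v _ => sum_sum_mul_kernel hf

lemma sum_massW (hQ : IsPMF Q) (hf : IsKernel f) : ∑ w, massW Q f w = 1 := by
  simp only [massW_eq]
  rw [sum_sum_mul_kernel hf, sum_massU hQ]

lemma sum_massZ (hQ : IsPMF Q) : ∑ z, massZ Q z = 1 := by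
  rw [← sum_sum_sum_eq_one hQ]
  exact Finset.sum_congr rfl fun z _ => Finset.sum_comm

lemma sum_sum_massZW (hQ : IsPMF Q) (hf : IsKernel f) : ∑ z, ∑ w, massZW Q f z w = 1 := by
  simp only [sum_massZW hf, sum_massZ hQ]

lemma sum_massVZW (hQ : IsPMF Q) (hf : IsKernel f) :
    ∑ v, ∑ z, ∑ w, massVZW Q f v z w = 1 := by
  rw [← sum_sum_massZW hQ hf, Finset.sum_comm]
  exact Finset.sum_congr rfl fun z _ => Finset.sum_comm

lemma massW_pos (hQ : ∀ x, 0 ≤ Q x) (hf : IsKernel f) {u : U} (hu : 0 < massU Q u) {w : W}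
    (hw : 0 < f u w) : 0 < massW Q f w := by
  rw [massW_eq]
  exact sum_pos_of_nonneg_of_pos (fun u => mul_nonneg (massU_nonneg hQ u) ((hf u).1 w))
    (mul_pos hu hw)

end Marginals

lemma mul_div_le_self_of_nonneg {a b : ℝ} (hb : 0 ≤ b) : a * (b / a) ≤ b := by
  rcases eq_or_ne a 0 with h | h
  · simpa [h] using hb
  · rw [mul_div_cancel₀ _ h]

lemma sum_codebook_sep (A : V → Z → W → ℝ) (B : X → Y → ℝ) :
    ∑ t : V × Y × Z, ∑ c : W × X, A t.1 t.2.2 c.1 * B c.2 t.2.1 =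
      (∑ v, ∑ z, ∑ w, A v z w) * ∑ x, ∑ y, B x y := by
  simp only [Fintype.sum_prod_type]
  rw [Finset.sum_mul]
  refine Finset.sum_congr rfl fun v _ => ?_
  rw [Finset.sum_comm, Finset.sum_mul]
  refine Finset.sum_congr rfl fun z _ => ?_
  rw [Finset.sum_comm, Finset.sum_mul]
  refine Finset.sum_congr rfl fun w _ => ?_
  rw [Finset.sum_comm]
  simp only [Finset.mul_sum]

/-- A likelihood encoder over a fixed codebook performs as its idealisation up to the covering
error. -/
lemma correctMass_ge_of_codebook {Q : U × V × Z → ℝ} (hQ : IsPMF Q) {K : X → Y → ℝ}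
    (hK : IsKernel K) {M m : ℕ} (x : Fin M → X) {e a : U → Fin M → ℝ} (he : IsKernel e)
    {d : U → ℝ} (hd : ∀ u, 0 ≤ d u) (h : ∀ u j, e u j ≤ a u j + e u j * d u) (φ : V → Fin m)
    (g : Fin m × Y × Z → V) :
    ∃ enc : U → X → ℝ, IsKernel enc ∧ 1 - correctMass Q (compKernel enc K) φ g ≤
      (∑ v, ∑ s : Y × Z, (∑ j, (∑ u, Q (u, v, s.2) * a u j) * K (x j) s.1) *
        ind (g (φ v, s) ≠ v)) + ∑ u, massU Q u * d u := by
  classical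
  have henc : IsKernel (fun u x' => ∑ j, e u j * if x j = x' then 1 else 0) := fun u =>
    ⟨fun x' => Finset.sum_nonneg fun j _ => mul_nonneg ((he u).1 j) (by split_ifs <;> simp), by
      rw [Finset.sum_comm]
      simp [(he u).2]⟩
  refine ⟨_, henc, ?_⟩
  set F := compKernel (fun u x' => ∑ j, e u j * if x j = x' then 1 else 0) K with hF
  have hFk : IsKernel F := isKernel_compKernel henc hK
  have hFeq : ∀ u y, F u y = ∑ j, e u j * K (x j) y := by
    intro u y
    simp only [hF, compKernel, Finset.sum_mul]
    rw [Finset.sum_comm]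
    simp
  have hFle : ∀ u y, F u y ≤ (∑ j, a u j * K (x j) y) + d u * F u y := by
    intro u y
    rw [hFeq, Finset.mul_sum, ← Finset.sum_add_distrib]
    refine Finset.sum_le_sum fun j _ => ?_
    have := mul_le_mul_of_nonneg_right (h u j) ((hK (x j)).1 y)
    linarith
  have h1 : 1 - correctMass Q F φ g =
      ∑ v, ∑ s : Y × Z, (∑ u, Q (u, v, s.2) * F u s.1) * ind (g (φ v, s) ≠ v) := by
    rw [← sum_correctMass_total hQ hFk, correctMass]
    simp only [← Finset.sum_sub_distrib, Fintype.sum_prod_type]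
    rw [Finset.sum_comm]
    refine Finset.sum_congr rfl fun v _ => Finset.sum_congr rfl fun y _ =>
      Finset.sum_congr rfl fun z _ => ?_
    by_cases hc : g (φ v, y, z) = v
    · rw [ind_of hc, ind_of_not (by simpa using hc)]; ring
    · rw [ind_of_not hc, ind_of hc]; ring
  have h2 : ∑ u, massU Q u * d u =
      ∑ v, ∑ s : Y × Z, ∑ u, Q (u, v, s.2) * (d u * F u s.1) := by
    simp only [Fintype.sum_prod_type, massU, Finset.sum_mul]
    have h3 : ∀ v : V, ∑ y, ∑ z, ∑ u, Q (u, v, z) * (d u * F u y) =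
        ∑ z, ∑ u, Q (u, v, z) * d u := by
      intro v
      rw [Finset.sum_comm]
      refine Finset.sum_congr rfl fun z _ => ?_
      rw [Finset.sum_comm]
      refine Finset.sum_congr rfl fun u _ => ?_
      simp only [← mul_assoc, ← Finset.mul_sum, (hFk u).2, mul_one]
    simp only [h3]
    rw [Finset.sum_comm, Finset.sum_comm (s := (Finset.univ : Finset V))]
    refine Finset.sum_congr rfl fun z _ => Finset.sum_comm
  rw [h1, h2, ← Finset.sum_add_distrib]
  refine Finset.sum_le_sum fun v _ => ?_
  rw [← Finset.sum_add_distrib]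
  refine Finset.sum_le_sum fun s _ => ?_
  have h4 : ∑ u, Q (u, v, s.2) * F u s.1 ≤
      (∑ j, (∑ u, Q (u, v, s.2) * a u j) * K (x j) s.1) +
        ∑ u, Q (u, v, s.2) * (d u * F u s.1) := by
    have h5 : ∑ j, (∑ u, Q (u, v, s.2) * a u j) * K (x j) s.1 =
        ∑ u, Q (u, v, s.2) * ∑ j, a u j * K (x j) s.1 := by
      simp only [Finset.sum_mul, Finset.mul_sum]
      rw [Finset.sum_comm]
      exact Finset.sum_congr rfl fun u _ => Finset.sum_congr rfl fun j _ => by ring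
    rw [h5, ← Finset.sum_add_distrib]
    refine Finset.sum_le_sum fun u _ => ?_
    rw [← mul_add]
    exact mul_le_mul_of_nonneg_left (hFle u s.1) (hQ.1 _)
  have h6 := mul_le_mul_of_nonneg_right h4 (ind_nonneg (g (φ v, s) ≠ v))
  have h7 : 0 ≤ ∑ u, Q (u, v, s.2) * (d u * F u s.1) := Finset.sum_nonneg fun u _ =>
    mul_nonneg (hQ.1 _) (mul_nonneg (hd u) ((hFk u).1 _))
  have h8 := mul_le_mul_of_nonneg_left (ind_le_one (g (φ v, s) ≠ v)) h7
  rw [add_mul] at h6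
  linarith

/-- Existence of a good codebook for the hybrid code, with a list of error terms. -/
lemma exists_codebook {Q : U × V × Z → ℝ} (hQ : IsPMF Q) {f : U → W → ℝ} (hf : IsKernel f)
    {K : X → Y → ℝ} (hK : IsKernel K) {p : X → ℝ} (hp : IsPMF p) {T₀ S₁ S₂ T₂ η : ℝ}
    (hT₀ : 0 ≤ T₀) (hS₁ : 0 < S₁) (hS₂ : 0 < S₂) (hη : 0 < η) {M : ℕ} (hM : 1 ≤ M)
    (hTM : T₀ ≤ M * η ^ 2) :
    ∃ (c : Fin M → W × X) (q : V → Y × Z → ℝ), (∀ v s, 0 ≤ q v s) ∧ (∀ s, ∑ v, q v s ≤ 1) ∧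
      (∑ u, massU Q u * |1 - (∑ j, f u (c j).1 / massW Q f (c j).1) / M|) +
        (∑ v, ∑ s : Y × Z, (∑ j, massVZW Q f v s.2 (c j).1 / massW Q f (c j).1 *
          K (c j).2 s.1) / M * ind (q v s < T₂)) ≤
      η + 2 * (∑ u, ∑ w, massU Q u * f u w * ind (T₀ * massW Q f w < f u w)) +
        (∑ z, ∑ w, massZW Q f z w * ind (massZW Q f z w < S₁ * (massZ Q z * massW Q f w))) +
        (∑ x, ∑ y, p x * K x y * ind (K x y < S₂ * massY p K y)) +
        (∑ v, ∑ z, ∑ w, massVZW Q f v z w * ind (massVZW Q f v z w < T₂ * massZW Q f z w)) +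
        M / (S₁ * S₂) := by
  classical
  have hVZW := massVZW_nonneg (f := f) hQ.1 hf
  have hZW := massZW_nonneg (f := f) hQ.1 hf
  have hW := massW_nonneg (f := f) hQ.1 hf
  have hpK : ∀ x y, 0 ≤ p x * K x y := fun x y => mul_nonneg (hp.1 x) ((hK x).1 y)
  have hpK1 : ∑ x, ∑ y, p x * K x y = 1 := by
    rw [Finset.sum_comm, sum_sum_mul_kernel hK, hp.2]
  set P : W × X → ℝ := fun c => massW Q f c.1 * p c.2 with hPdef
  have hP : IsPMF P := ⟨fun c => mul_nonneg (hW _) (hp.1 _), by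
    rw [Fintype.sum_prod_type]
    simp only [hPdef, ← Finset.mul_sum, hp.2, mul_one, sum_massW hQ hf]⟩
  let C : W × X → V × Y × Z → Prop := fun c t =>
    ¬ massZW Q f t.2.2 c.1 < S₁ * (massZ Q t.2.2 * massW Q f c.1) ∧
      ¬ K c.2 t.2.1 < S₂ * massY p K t.2.1
  let C' : W × X → Y × Z → Prop := fun c s =>
    ¬ massZW Q f s.2 c.1 < S₁ * (massZ Q s.2 * massW Q f c.1) ∧
      ¬ K c.2 s.1 < S₂ * massY p K s.1
  let dec : (Fin M → W × X) → Y × Z → Fin M := fun c s =>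
    if h : ∃ j, C' (c j) s then h.choose else ⟨0, hM⟩
  let q : (Fin M → W × X) → V → Y × Z → ℝ := fun c v s =>
    massVZW Q f v s.2 (c (dec c s)).1 / massZW Q f s.2 (c (dec c s)).1
  have hq0 : ∀ c v s, 0 ≤ q c v s := fun c v s => div_nonneg (hVZW _ _ _) (hZW _ _)
  have hq1 : ∀ c s, ∑ v, q c v s ≤ 1 := fun c s => by
    simp only [q, ← Finset.sum_div]
    exact div_self_le_one _
  let R : W × X → V × Y × Z → ℝ := fun c t =>
    massVZW Q f t.1 t.2.2 c.1 / massW Q f c.1 * K c.2 t.2.1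
  let bad : W × X → V × Y × Z → ℝ := fun c t =>
    ind (massVZW Q f t.1 t.2.2 c.1 < T₂ * massZW Q f t.2.2 c.1) +
      ind (massZW Q f t.2.2 c.1 < S₁ * (massZ Q t.2.2 * massW Q f c.1)) +
      ind (K c.2 t.2.1 < S₂ * massY p K t.2.1)
  have hR : ∀ c t, 0 ≤ R c t := fun c t =>
    mul_nonneg (div_nonneg (hVZW _ _ _) (hW _)) ((hK _).1 _)
  have hbad : ∀ c t, 0 ≤ bad c t := fun c t =>
    add_nonneg (add_nonneg (ind_nonneg _) (ind_nonneg _)) (ind_nonneg _)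
  have hPR : ∀ c t, P c * R c t ≤ massVZW Q f t.1 t.2.2 c.1 * (p c.2 * K c.2 t.2.1) := by
    intro c t
    have := mul_le_mul_of_nonneg_right
      (mul_div_le_self_of_nonneg (a := massW Q f c.1) (hVZW t.1 t.2.2 c.1)) (hpK c.2 t.2.1)
    simp only [hPdef, R]
    linarith
  have hE : ∀ (c : Fin M → W × X) t j, R (c j) t * ind (q c t.1 t.2 < T₂) ≤
      R (c j) t * (bad (c j) t + ∑ i ∈ Finset.univ.erase j, ind (C (c i) t)) := by
    intro c t j
    have hsn : ∀ i ∈ Finset.univ.erase j, 0 ≤ ind (C (c i) t) := fun i _ => ind_nonneg _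
    rcases (hVZW t.1 t.2.2 (c j).1).eq_or_lt with h0 | h0
    · simp only [R, ← h0]; simp
    refine mul_le_mul_of_nonneg_left ?_ (hR _ _)
    by_cases hq : q c t.1 t.2 < T₂
    swap
    · rw [ind_of_not hq]
      exact add_nonneg (hbad _ _) (Finset.sum_nonneg hsn)
    rw [ind_of hq]
    by_cases hb : C (c j) t
    · have hex : ∃ j, C' (c j) t.2 := ⟨j, hb⟩
      have hspec := hex.choose_spec
      have hd : dec c t.2 = hex.choose := dif_pos hex
      rw [← hd] at hspec
      by_cases hj : dec c t.2 = j
      · have hz : 0 < massZW Q f t.2.2 (c j).1 :=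
          sum_pos_of_nonneg_of_pos (fun v => hVZW v _ _) h0
        have h1 : massVZW Q f t.1 t.2.2 (c j).1 < T₂ * massZW Q f t.2.2 (c j).1 := by
          simp only [q, hj] at hq
          rwa [div_lt_iff₀ hz] at hq
        have := Finset.sum_nonneg hsn
        simp only [bad, ind_of h1]
        linarith [ind_nonneg (massZW Q f t.2.2 (c j).1 < S₁ * (massZ Q t.2.2 * massW Q f (c j).1)),
          ind_nonneg (K (c j).2 t.2.1 < S₂ * massY p K t.2.1)]
      · have := Finset.single_le_sum hsn (Finset.mem_erase.2 ⟨hj, Finset.mem_univ _⟩)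
        rw [ind_of (show C (c (dec c t.2)) t from hspec)] at this
        linarith [hbad (c j) t]
    · have := Finset.sum_nonneg hsn
      rw [not_and_or, not_not, not_not] at hb
      have h3 := ind_nonneg (massVZW Q f t.1 t.2.2 (c j).1 < T₂ * massZW Q f t.2.2 (c j).1)
      rcases hb with hb | hb
      · simp only [bad, ind_of hb]
        linarith [ind_nonneg (K (c j).2 t.2.1 < S₂ * massY p K t.2.1)]
      · simp only [bad, ind_of hb]
        linarith [ind_nonneg
          (massZW Q f t.2.2 (c j).1 < S₁ * (massZ Q t.2.2 * massW Q f (c j).1))]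
  have hbadsum : ∑ t, ∑ c, P c * (R c t * bad c t) ≤
      (∑ v, ∑ z, ∑ w, massVZW Q f v z w * ind (massVZW Q f v z w < T₂ * massZW Q f z w)) +
      (∑ z, ∑ w, massZW Q f z w * ind (massZW Q f z w < S₁ * (massZ Q z * massW Q f w))) +
      (∑ x, ∑ y, p x * K x y * ind (K x y < S₂ * massY p K y)) := by
    have e1 := sum_codebook_sep
      (fun v z w => massVZW Q f v z w * ind (massVZW Q f v z w < T₂ * massZW Q f z w))
      (fun x y => p x * K x y)
    have e2 := sum_codebook_sep (V := V)
      (fun v z w => massVZW Q f v z w *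
        ind (massZW Q f z w < S₁ * (massZ Q z * massW Q f w))) (fun x y => p x * K x y)
    have e3 := sum_codebook_sep (massVZW Q f)
      (fun x y => p x * K x y * ind (K x y < S₂ * massY p K y))
    have e4 : ∑ v, ∑ z, ∑ w, massVZW Q f v z w *
        ind (massZW Q f z w < S₁ * (massZ Q z * massW Q f w)) =
        ∑ z, ∑ w, massZW Q f z w * ind (massZW Q f z w < S₁ * (massZ Q z * massW Q f w)) := by
      rw [Finset.sum_comm]
      refine Finset.sum_congr rfl fun z _ => ?_
      rw [Finset.sum_comm]
      refine Finset.sum_congr rfl fun w _ => ?_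
      rw [← Finset.sum_mul]
      rfl
    rw [hpK1, mul_one] at e1
    rw [hpK1, mul_one, e4] at e2
    rw [sum_massVZW hQ hf, one_mul] at e3
    rw [← e1, ← e2, ← e3, ← Finset.sum_add_distrib, ← Finset.sum_add_distrib]
    refine Finset.sum_le_sum fun t _ => ?_
    rw [← Finset.sum_add_distrib, ← Finset.sum_add_distrib]
    refine Finset.sum_le_sum fun c _ => ?_
    have := mul_le_mul_of_nonneg_right (hPR c t) (hbad c t)
    rw [mul_assoc] at this
    refine this.trans (le_of_eq ?_)
    simp only [bad]
    ring
  have hcross : ∑ t, (∑ c, P c * R c t) * ∑ c, P c * ind (C c t) ≤ 1 / (S₁ * S₂) := by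
    have e1 : ∀ t : V × Y × Z, ∑ c, P c * R c t ≤
        (∑ w, massVZW Q f t.1 t.2.2 w) * massY p K t.2.1 := by
      intro t
      refine (Finset.sum_le_sum fun c _ => hPR c t).trans (le_of_eq ?_)
      rw [Fintype.sum_prod_type, massY, Finset.sum_mul]
      simp only [Finset.mul_sum]
    have e2 : ∀ y z, massZ Q z * massY p K y * ∑ c, P c * ind (C' c (y, z)) ≤
        massZ Q z * massY p K y / (S₁ * S₂) := by
      intro y z
      have : massZ Q z * massY p K y / (S₁ * S₂) =
          ∑ c : W × X, massZW Q f z c.1 / S₁ * (p c.2 * K c.2 y / S₂) := by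
        rw [Fintype.sum_prod_type, ← sum_massZW hf, massY, Finset.sum_mul_sum, Finset.sum_div]
        refine Finset.sum_congr rfl fun w _ => ?_
        rw [Finset.sum_div]
        exact Finset.sum_congr rfl fun x _ => by field_simp
      rw [this, Finset.mul_sum]
      refine Finset.sum_le_sum fun c _ => ?_
      by_cases hc : C' c (y, z)
      · rw [ind_of hc, mul_one]
        have h1 := not_lt.1 hc.1
        have h2 := not_lt.1 hc.2
        simp only at h1 h2
        rw [← le_div_iff₀' hS₁] at h1
        rw [← le_div_iff₀' hS₂] at h2
        have hY : 0 ≤ massY p K y := Finset.sum_nonneg fun x _ => hpK x y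
        calc massZ Q z * massY p K y * P c =
            massZ Q z * massW Q f c.1 * (p c.2 * massY p K y) := by simp only [hPdef]; ring
          _ ≤ massZW Q f z c.1 / S₁ * (p c.2 * (K c.2 y / S₂)) :=
            mul_le_mul h1 (mul_le_mul_of_nonneg_left h2 (hp.1 _))
              (mul_nonneg (hp.1 _) hY) (div_nonneg (hZW _ _) hS₁.le)
          _ = _ := by ring
      · rw [ind_of_not hc]
        simp only [mul_zero]
        exact mul_nonneg (div_nonneg (hZW _ _) hS₁.le) (div_nonneg (hpK _ _) hS₂.le)
    calc _ ≤ ∑ t : V × Y × Z, (∑ w, massVZW Q f t.1 t.2.2 w) * massY p K t.2.1 *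
          ∑ c, P c * ind (C' c t.2) :=
          Finset.sum_le_sum fun t _ => mul_le_mul_of_nonneg_right (e1 t)
            (Finset.sum_nonneg fun c _ => mul_nonneg (hP.1 c) (ind_nonneg _))
      _ = ∑ y, ∑ z, massZ Q z * massY p K y * ∑ c, P c * ind (C' c (y, z)) := by
          simp only [Fintype.sum_prod_type]
          rw [Finset.sum_comm]
          refine Finset.sum_congr rfl fun y _ => ?_
          rw [Finset.sum_comm]
          refine Finset.sum_congr rfl fun z _ => ?_
          rw [← Finset.sum_mul, ← Finset.sum_mul, Finset.sum_comm, ← sum_massZW hf]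
          rfl
      _ ≤ ∑ y, ∑ z, massZ Q z * massY p K y / (S₁ * S₂) :=
          Finset.sum_le_sum fun y _ => Finset.sum_le_sum fun z _ => e2 y z
      _ = 1 / (S₁ * S₂) := by
          simp only [← Finset.sum_div, ← Finset.sum_mul, sum_massZ hQ, one_mul]
          congr 1
          simp only [massY]
          rw [sum_sum_mul_kernel hK, hp.2]
  have hcov : ∑ c : Fin M → W × X, (∏ l, P (c l)) *
      ∑ u, massU Q u * |1 - (∑ j, f u (c j).1 / massW Q f (c j).1) / M| ≤
      η + 2 * ∑ u, ∑ w, massU Q u * f u w * ind (T₀ * massW Q f w < f u w) := by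
    have hu : ∀ u, massU Q u * ∑ c : Fin M → W × X, (∏ l, P (c l)) *
        |1 - (∑ j, f u (c j).1 / massW Q f (c j).1) / M| ≤
        massU Q u * (η + 2 * ∑ w, f u w * ind (T₀ * massW Q f w < f u w)) := by
      intro u
      rcases (massU_nonneg hQ.1 u).eq_or_lt with h0 | h0
      · rw [← h0]; simp
      refine mul_le_mul_of_nonneg_left ?_ h0.le
      have hcan : ∀ w, massW Q f w * (f u w / massW Q f w) = f u w := by
        intro w
        rcases ((hf u).1 w).eq_or_lt with h1 | h1
        · rw [← h1]; simp
        · exact mul_div_cancel₀ _ (massW_pos hQ.1 hf h0 h1).ne'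
      refine (soft_covering hP (a := fun c : W × X => f u c.1 / massW Q f c.1)
        (fun c => div_nonneg ((hf u).1 _) (hW _)) ?_ hT₀ hη hM hTM).trans ?_
      · rw [Fintype.sum_prod_type, ← (hf u).2]
        refine Finset.sum_congr rfl fun w _ => ?_
        rw [← hcan w]
        calc _ = ∑ x, p x * (massW Q f w * (f u w / massW Q f w)) :=
              Finset.sum_congr rfl fun x _ => by simp only [hPdef]; ring
          _ = _ := by rw [← Finset.sum_mul, hp.2, one_mul]
      · gcongr
        rw [Fintype.sum_prod_type]
        refine Finset.sum_le_sum fun w _ => ?_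
        have e5 : ind (T₀ < f u w / massW Q f w) ≤ ind (T₀ * massW Q f w < f u w) := by
          by_cases hlt : T₀ < f u w / massW Q f w
          · rw [ind_of hlt, ind_of]
            rcases (hW w).eq_or_lt with h2 | h2
            · rw [← h2] at hlt
              simp at hlt
              linarith
            · rwa [lt_div_iff₀ h2] at hlt
          · rw [ind_of_not hlt]; exact ind_nonneg _
        calc _ = ∑ x, p x * (massW Q f w * (f u w / massW Q f w) *
                ind (T₀ < f u w / massW Q f w)) :=
              Finset.sum_congr rfl fun x _ => by simp only [hPdef]; ring
          _ = f u w * ind (T₀ < f u w / massW Q f w) := by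
              rw [← Finset.sum_mul, hp.2, one_mul, hcan]
          _ ≤ _ := mul_le_mul_of_nonneg_left e5 ((hf u).1 w)
    calc _ = ∑ u, massU Q u * ∑ c : Fin M → W × X, (∏ l, P (c l)) *
          |1 - (∑ j, f u (c j).1 / massW Q f (c j).1) / M| := by
          simp only [Finset.mul_sum]
          rw [Finset.sum_comm]
          exact Finset.sum_congr rfl fun u _ => Finset.sum_congr rfl fun c _ => by ring
      _ ≤ _ := Finset.sum_le_sum fun u _ => hu u
      _ = _ := by
          simp only [mul_add, Finset.sum_add_distrib, ← Finset.sum_mul, sum_massU hQ, one_mul]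
          simp only [Finset.mul_sum]
          congr 1
          exact Finset.sum_congr rfl fun u _ => Finset.sum_congr rfl fun w _ => by ring
  have herr := sum_codebook_error_le hP hM hR C (fun c t => q c t.1 t.2 < T₂) hE
    (bad := bad)
  obtain ⟨c, hc⟩ := exists_le_of_sum_mul_le (isPMF_pi_prod (ι := Fin M) hP)
    (F := fun c => (∑ u, massU Q u * |1 - (∑ j, f u (c j).1 / massW Q f (c j).1) / M|) +
      ∑ t, (∑ j, R (c j) t) / M * ind (q c t.1 t.2 < T₂)) (B := _) (by
      simp only [mul_add, Finset.sum_add_distrib]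
      exact add_le_add hcov herr)
  refine ⟨c, q c, hq0 c, hq1 c, ?_⟩
  rw [Fintype.sum_prod_type (fun t : V × Y × Z => _)] at hc
  refine hc.trans ?_
  have hMc : (M : ℝ) * ∑ t, (∑ c, P c * R c t) * ∑ c, P c * ind (C c t) ≤ M / (S₁ * S₂) := by
    rw [← mul_one_div]
    exact mul_le_mul_of_nonneg_left hcross (Nat.cast_nonneg M)
  linarith

/-- One-shot achievability of the hybrid code. -/
lemma exists_hybrid_code [Nonempty V] {Q : U × V × Z → ℝ} (hQ : IsPMF Q) {f : U → W → ℝ}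
    (hf : IsKernel f) {K : X → Y → ℝ} (hK : IsKernel K) {p : X → ℝ} (hp : IsPMF p)
    {T₀ S₁ S₂ T₂ η : ℝ} (hT₀ : 0 ≤ T₀) (hS₁ : 0 < S₁) (hS₂ : 0 < S₂) (hT₂ : 0 < T₂) (hη : 0 < η)
    {M m : ℕ} (hM : 1 ≤ M) (hm : 1 ≤ m) (hTM : T₀ ≤ M * η ^ 2) :
    ∃ enc : U → X → ℝ, IsKernel enc ∧ ∃ (φ : V → Fin m) (g : Fin m × Y × Z → V),
      1 - correctMass Q (compKernel enc K) φ g ≤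
      η + 2 * (∑ u, ∑ w, massU Q u * f u w * ind (T₀ * massW Q f w < f u w)) +
        (∑ z, ∑ w, massZW Q f z w * ind (massZW Q f z w < S₁ * (massZ Q z * massW Q f w))) +
        (∑ x, ∑ y, p x * K x y * ind (K x y < S₂ * massY p K y)) +
        (∑ v, ∑ z, ∑ w, massVZW Q f v z w * ind (massVZW Q f v z w < T₂ * massZW Q f z w)) +
        M / (S₁ * S₂) + 1 / (T₂ * m) := by
  have hM0 : (0 : ℝ) < M := by exact_mod_cast hM
  have hm0 : (0 : ℝ) < m := by exact_mod_cast hm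
  have hW := massW_nonneg (f := f) hQ.1 hf
  obtain ⟨c, q, hq0, hq1, hc⟩ := exists_codebook hQ hf hK hp (T₂ := T₂) hT₀ hS₁ hS₂ hη hM hTM
  set μ : V → Y × Z → ℝ := fun v s =>
    (∑ j, massVZW Q f v s.2 (c j).1 / massW Q f (c j).1 * K (c j).2 s.1) / M with hμdef
  have hμ : ∀ v s, 0 ≤ μ v s := fun v s => div_nonneg (Finset.sum_nonneg fun j _ =>
    mul_nonneg (div_nonneg (massVZW_nonneg hQ.1 hf _ _ _) (hW _)) ((hK _).1 _)) hM0.le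
  have hμ1 : ∑ v, ∑ s, μ v s ≤ 1 := by
    have h1 : ∀ j, ∑ v, ∑ s : Y × Z,
        massVZW Q f v s.2 (c j).1 / massW Q f (c j).1 * K (c j).2 s.1 ≤ 1 := by
      intro j
      have : ∀ v, ∑ s : Y × Z, massVZW Q f v s.2 (c j).1 / massW Q f (c j).1 * K (c j).2 s.1 =
          (∑ z, massVZW Q f v z (c j).1) / massW Q f (c j).1 := by
        intro v
        rw [Fintype.sum_prod_type, Finset.sum_comm, Finset.sum_div]
        refine Finset.sum_congr rfl fun z _ => ?_
        change ∑ y, massVZW Q f v z (c j).1 / massW Q f (c j).1 * K (c j).2 y = _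
        rw [← Finset.mul_sum, (hK _).2, mul_one]
      simp only [this]
      rw [← Finset.sum_div, Finset.sum_comm]
      exact div_self_le_one _
    have h2 : ∑ v, ∑ s, μ v s = (∑ j, ∑ v, ∑ s : Y × Z,
        massVZW Q f v s.2 (c j).1 / massW Q f (c j).1 * K (c j).2 s.1) / M := by
      simp only [hμdef, ← Finset.sum_div]
      congr 1
      rw [Finset.sum_comm' (s' := fun _ => Finset.univ) (t' := Finset.univ) (by simp)]
      rw [Finset.sum_comm]
      exact (Finset.sum_congr rfl fun v _ => Finset.sum_comm).trans Finset.sum_comm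
    rw [h2, div_le_one hM0]
    refine (Finset.sum_le_sum fun j _ => h1 j).trans ?_
    simp
  obtain ⟨φ, g, hφ⟩ := exists_binning hμ hq0 hq1 hT₂ hm
  obtain ⟨e, he, hea⟩ := exists_likelihood_encoder hM
    (a := fun u j => f u (c j).1 / massW Q f (c j).1 / M)
    (fun u j => div_nonneg (div_nonneg ((hf u).1 _) (hW _)) hM0.le)
  simp only [← Finset.sum_div] at hea
  obtain ⟨enc, henc, hle⟩ := correctMass_ge_of_codebook hQ hK (fun j => (c j).2) he
    (d := fun u => |1 - (∑ j, f u (c j).1 / massW Q f (c j).1) / M|) (fun u => abs_nonneg _) hea φ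
    (fun s => g s.1 s.2)
  refine ⟨enc, henc, φ, fun s => g s.1 s.2, ?_⟩
  have hμeq : ∀ v (s : Y × Z), ∑ j, (∑ u, Q (u, v, s.2) *
      (f u (c j).1 / massW Q f (c j).1 / M)) * K (c j).2 s.1 = μ v s := by
    intro v s
    simp only [hμdef]
    rw [Finset.sum_div]
    refine Finset.sum_congr rfl fun j _ => ?_
    rw [massVZW, mul_div_right_comm, Finset.sum_div, Finset.sum_div]
    congr 1
    exact Finset.sum_congr rfl fun u _ => by ring
  simp only [hμeq] at hle
  have hlast : (∑ v, ∑ s, μ v s) / (T₂ * m) ≤ 1 / (T₂ * m) := by gcongr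
  linarith

end OneShot

section Tails

variable {A B D : Type} [Fintype A] [Fintype B] [Fintype D]

lemma sum_sum_arrow {k : ℕ} (F : (Fin k → A) → (Fin k → B) → ℝ) :
    ∑ a, ∑ b, F a b = ∑ c : Fin k → A × B, F (fun i => (c i).1) (fun i => (c i).2) := by
  rw [← Fintype.sum_prod_type' F,
    ← (Equiv.arrowProdEquivProdArrow (Fin k) (fun _ => A) (fun _ => B)).sum_comp]
  rfl

lemma sum_sum_sum_arrow {k : ℕ} (F : (Fin k → A) → (Fin k → B) → (Fin k → D) → ℝ) :
    ∑ a, ∑ b, ∑ d, F a b d =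
      ∑ c : Fin k → A × B × D, F (fun i => (c i).1) (fun i => (c i).2.1) (fun i => (c i).2.2) := by
  rw [← (seqEquiv A B D k).symm.sum_comp]
  simp only [Fintype.sum_prod_type]
  rfl

lemma eventually_tail_le₂ {p a b : A → B → ℝ} (hp : ∀ x y, 0 ≤ p x y) (hp1 : ∑ x, ∑ y, p x y = 1)
    (ha : ∀ x y, 0 < p x y → 0 < a x y) (hb : ∀ x y, 0 < p x y → 0 < b x y) {ε η : ℝ}
    (hε : 0 < ε) (hη : 0 < η) :
    ∀ᶠ k : ℕ in atTop, ∑ x : Fin k → A, ∑ y : Fin k → B, (∏ i, p (x i) (y i)) *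
      ind (∏ i, a (x i) (y i) <
        2 ^ (k * ((∑ x, ∑ y, p x y * logb 2 (a x y / b x y)) - ε)) * ∏ i, b (x i) (y i)) ≤ η := by
  have h := eventually_tail_le (p := fun c : A × B => p c.1 c.2) (A := fun c => a c.1 c.2)
    (B := fun c => b c.1 c.2) ⟨fun c => hp _ _, by rwa [Fintype.sum_prod_type]⟩
    (fun c => ha _ _) (fun c => hb _ _) hε hη
  filter_upwards [h] with k hk
  rw [sum_sum_arrow]
  simpa only [Fintype.sum_prod_type (fun c : A × B => _)] using hk

lemma eventually_tail_le₃ {p a b : A → B → D → ℝ} (hp : ∀ x y z, 0 ≤ p x y z)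
    (hp1 : ∑ x, ∑ y, ∑ z, p x y z = 1) (ha : ∀ x y z, 0 < p x y z → 0 < a x y z)
    (hb : ∀ x y z, 0 < p x y z → 0 < b x y z) {ε η : ℝ} (hε : 0 < ε) (hη : 0 < η) :
    ∀ᶠ k : ℕ in atTop, ∑ x : Fin k → A, ∑ y : Fin k → B, ∑ z : Fin k → D,
      (∏ i, p (x i) (y i) (z i)) * ind (∏ i, a (x i) (y i) (z i) <
        2 ^ (k * ((∑ x, ∑ y, ∑ z, p x y z * logb 2 (a x y z / b x y z)) - ε)) *
          ∏ i, b (x i) (y i) (z i)) ≤ η := by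
  have h := eventually_tail_le (p := fun c : A × B × D => p c.1 c.2.1 c.2.2)
    (A := fun c => a c.1 c.2.1 c.2.2) (B := fun c => b c.1 c.2.1 c.2.2)
    ⟨fun c => hp _ _ _, by simpa only [Fintype.sum_prod_type] using hp1⟩
    (fun c => ha _ _ _) (fun c => hb _ _ _) hε hη
  filter_upwards [h] with k hk
  rw [sum_sum_sum_arrow]
  simpa only [Fintype.sum_prod_type (fun c : A × B × D => _),
    Fintype.sum_prod_type (fun c : B × D => _)] using hk

end Tails

section Products

variable {U V Z W X Y : Type} [Fintype U] [Fintype V] [Fintype Z] [Fintype W] [Fintype X]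
  [Fintype Y]

variable (P : U × V × Z → ℝ) (f : U → W → ℝ) (k : ℕ)

lemma massVZW_seqSource (v : Fin k → V) (z : Fin k → Z) (w : Fin k → W) :
    massVZW (seqSource P k) (seqChannel f k) v z w = ∏ i, massVZW P f (v i) (z i) (w i) := by
  simp only [massVZW, seqSource, seqChannel, ← Finset.prod_mul_distrib]
  exact sum_pi_prod fun i u => P (u, v i, z i) * f u (w i)

lemma massZW_seqSource (z : Fin k → Z) (w : Fin k → W) :
    massZW (seqSource P k) (seqChannel f k) z w = ∏ i, massZW P f (z i) (w i) := by
  simp only [massZW, massVZW_seqSource]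
  exact sum_pi_prod fun i v => massVZW P f v (z i) (w i)

lemma massW_seqSource (w : Fin k → W) :
    massW (seqSource P k) (seqChannel f k) w = ∏ i, massW P f (w i) := by
  simp only [massW, massZW_seqSource]
  exact sum_pi_prod fun i z => massZW P f z (w i)

lemma massZ_seqSource (z : Fin k → Z) : massZ (seqSource P k) z = ∏ i, massZ P (z i) := by
  simp only [massZ, seqSource]
  rw [← sum_pi_prod fun i v => ∑ u, P (u, v, z i)]
  exact Finset.sum_congr rfl fun v _ => sum_pi_prod fun i u => P (u, v i, z i)

lemma massU_seqSource (u : Fin k → U) : massU (seqSource P k) u = ∏ i, massU P (u i) := by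
  simp only [massU, seqSource]
  rw [← sum_pi_prod fun i z => ∑ v, P (u i, v, z)]
  exact Finset.sum_congr rfl fun z _ => sum_pi_prod fun i v => P (u i, v, z i)

lemma massY_prod (q : X → ℝ) (Ch : X → Y → ℝ) (n : ℕ) (y : Fin n → Y) :
    massY (fun x : Fin n → X => ∏ j, q (x j)) (seqChannel Ch n) y = ∏ j, massY q Ch (y j) := by
  simp only [massY, seqChannel, ← Finset.prod_mul_distrib]
  exact sum_pi_prod fun i x => q x * Ch x (y i)

end Products

section Exponents

variable {U V Z W X Y : Type} [Fintype U] [Fintype V] [Fintype Z] [Fintype W] [Fintype X]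
  [Fintype Y]

lemma mutualInfo_eq_log_ratio {q : X → ℝ} {Ch : X → Y → ℝ} (hCh : IsKernel Ch) :
    mutualInfo (fun xy : X × Y => q xy.1 * Ch xy.1 xy.2) =
      ∑ x, ∑ y, q x * Ch x y * logb 2 (Ch x y / massY q Ch y) := by
  rw [mutualInfo, Fintype.sum_prod_type]
  refine Finset.sum_congr rfl fun x _ => Finset.sum_congr rfl fun y _ => ?_
  simp only [← Finset.mul_sum, (hCh _).2, mul_one]
  rcases eq_or_ne (q x) 0 with h | h
  · simp [h]
  · rw [mul_div_mul_left _ _ h]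
    rfl

variable {P : U × V × Z → ℝ} {f : U → W → ℝ}

lemma massZ_pos (hP : ∀ x, 0 ≤ P x) (hf : IsKernel f) {z : Z} {w : W} (h : 0 < massZW P f z w) :
    0 < massZ P z := by
  rw [← sum_massZW hf]
  exact sum_pos_of_nonneg_of_pos (massZW_nonneg hP hf z) h

lemma massW_pos_of_massZW (hP : ∀ x, 0 ≤ P x) (hf : IsKernel f) {z : Z} {w : W}
    (h : 0 < massZW P f z w) : 0 < massW P f w :=
  sum_pos_of_nonneg_of_pos (fun z => massZW_nonneg hP hf z w) h

lemma massZW_pos (hP : ∀ x, 0 ≤ P x) (hf : IsKernel f) {v : V} {z : Z} {w : W}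
    (h : 0 < massVZW P f v z w) : 0 < massZW P f z w :=
  sum_pos_of_nonneg_of_pos (fun v => massVZW_nonneg hP hf v z w) h

lemma sum_massVZW_mul_log (P : U × V × Z → ℝ) (f : U → W → ℝ) :
    ∑ v, ∑ z, ∑ w, massVZW P f v z w * logb 2 (massVZW P f v z w / massZW P f z w) =
      -∑ w, sliceV P (fun u => f u w) := by
  rw [Finset.sum_comm, Finset.sum_congr rfl fun z _ => Finset.sum_comm, Finset.sum_comm,
    ← Finset.sum_neg_distrib]
  refine Finset.sum_congr rfl fun w _ => ?_
  rw [sliceV, ← Finset.sum_neg_distrib]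
  refine Finset.sum_congr rfl fun z _ => ?_
  rw [massEntropy, neg_neg]
  rfl

/-- `I(Z;W)` in terms of entropies. -/
lemma sum_massZW_mul_log (hP : IsPMF P) (hf : IsKernel f) :
    ∑ z, ∑ w, massZW P f z w * logb 2 (massZW P f z w / (massZ P z * massW P f w)) =
      massEntropy (massW P f) - ∑ z, massEntropy (massZW P f z) := by
  have h1 : massEntropy (massW P f) = -∑ z, ∑ w, massZW P f z w * logb 2 (massW P f w) := by
    rw [massEntropy, sum_massW hP hf, Finset.sum_comm]
    simp only [div_one, ← Finset.sum_mul]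
    rfl
  simp only [massEntropy] at h1 ⊢
  rw [h1, Finset.sum_neg_distrib, neg_sub_neg, ← Finset.sum_sub_distrib]
  refine Finset.sum_congr rfl fun z _ => ?_
  rw [← Finset.sum_sub_distrib, sum_massZW hf]
  refine Finset.sum_congr rfl fun w _ => ?_
  rcases (massZW_nonneg hP.1 hf z w).eq_or_lt with h | h
  · simp [← h]
  · have hz := massZ_pos hP.1 hf h
    have hw := massW_pos_of_massZW hP.1 hf h
    rw [← mul_sub, ← Real.logb_div (by positivity) hw.ne', div_div]

/-- `I(U;W) - I(Z;W) = I(U;W|Z)` under the Markov chain `Z - U - W`. -/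
lemma mutualInfo_sub_eq (hP : IsPMF P) (hf : IsKernel f) :
    mutualInfo (fun x : U × W => massU P x.1 * f x.1 x.2) -
      ∑ z, ∑ w, massZW P f z w * logb 2 (massZW P f z w / (massZ P z * massW P f w)) =
      sliceU P 1 - ∑ w, sliceU P (fun u => f u w) := by
  rw [mutualInfo_channel_eq ⟨massU_nonneg hP.1, sum_massU hP⟩ hf, sum_massZW_mul_log hP hf]
  have h1 : (fun w => ∑ u, massU P u * f u w) = massW P f := funext fun w => (massW_eq P f w).symm
  have h2 : ∀ z, massEntropy (massZW P f z) - ∑ u, (∑ v, P (u, v, z)) * massEntropy (f u) =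
      massEntropy (fun u => ∑ v, P (u, v, z)) -
        ∑ w, massEntropy (fun u => (∑ v, P (u, v, z)) * f u w) := by
    intro z
    have := massEntropy_swap (g := fun w u => (∑ v, P (u, v, z)) * f u w)
      (fun w u => mul_nonneg (Finset.sum_nonneg fun v _ => hP.1 _) ((hf u).1 w))
    simp only [← Finset.mul_sum, (hf _).2, mul_one, massEntropy_smul] at this
    rw [← this]
    congr 2
    funext w
    simp only [massZW, massVZW, Finset.sum_mul]
    exact Finset.sum_comm
  have h3 : ∑ u, massU P u * massEntropy (f u) =
      ∑ z, ∑ u, (∑ v, P (u, v, z)) * massEntropy (f u) := by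
    simp only [massU, Finset.sum_mul]
    rw [Finset.sum_comm]
  rw [h1, h3, sub_sub_sub_cancel_left, ← Finset.sum_sub_distrib, Finset.sum_congr rfl fun z _ => h2 z,
    Finset.sum_sub_distrib, sliceU]
  simp only [Pi.one_apply, mul_one, sliceU]
  rw [Finset.sum_comm]

end Exponents

section AsymptoticTails

variable {U V Z W X Y : Type} [Fintype U] [Fintype V] [Fintype Z] [Fintype W] [Fintype X]
  [Fintype Y] {P : U × V × Z → ℝ} {f : U → W → ℝ} {ε θ : ℝ}

lemma eventually_tail_encoder (hP : IsPMF P) (hf : IsKernel f) (hε : 0 < ε) (hθ : 0 < θ) :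
    ∀ᶠ k : ℕ in atTop, ∑ u, ∑ w, massU (seqSource P k) u * seqChannel f k u w *
      ind (2 ^ (k * (mutualInfo (fun x : U × W => massU P x.1 * f x.1 x.2) + ε)) *
        massW (seqSource P k) (seqChannel f k) w < seqChannel f k u w) ≤ θ := by
  have hU := massU_nonneg hP.1
  have hpos : ∀ u w, 0 < massU P u * f u w → 0 < massU P u ∧ 0 < f u w := fun u w h =>
    ⟨(hU u).lt_of_ne' (left_ne_zero_of_mul h.ne'),
      ((hf u).1 w).lt_of_ne' (right_ne_zero_of_mul h.ne')⟩
  have h := eventually_tail_le₂ (p := fun u w => massU P u * f u w) (a := fun _ w => massW P f w)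
    (b := fun u w => f u w) (fun u w => mul_nonneg (hU u) ((hf u).1 w))
    (by simp only [← Finset.mul_sum, (hf _).2, mul_one, sum_massU hP])
    (fun u w h => massW_pos hP.1 hf (hpos u w h).1 (hpos u w h).2)
    (fun u w h => (hpos u w h).2) hε hθ
  have hI : (∑ u, ∑ w, massU P u * f u w * logb 2 (massW P f w / f u w)) =
      -mutualInfo (fun x : U × W => massU P x.1 * f x.1 x.2) := by
    rw [mutualInfo_eq_log_ratio hf]
    simp only [← Finset.sum_neg_distrib]
    refine Finset.sum_congr rfl fun u _ => Finset.sum_congr rfl fun w _ => ?_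
    rw [← mul_neg, ← Real.logb_inv, inv_div, massW_eq]
    rfl
  rw [hI] at h
  filter_upwards [h] with k hk
  refine le_of_eq_of_le ?_ hk
  refine Finset.sum_congr rfl fun u _ => Finset.sum_congr rfl fun w _ => ?_
  rw [massU_seqSource, massW_seqSource, seqChannel, Finset.prod_mul_distrib]
  congr 2
  rw [show (k : ℝ) * (-mutualInfo (fun x : U × W => massU P x.1 * f x.1 x.2) - ε) =
    -(k * (mutualInfo (fun x : U × W => massU P x.1 * f x.1 x.2) + ε)) by ring,
    Real.rpow_neg zero_le_two, lt_inv_mul_iff₀ (by positivity)]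

lemma eventually_tail_side (hP : IsPMF P) (hf : IsKernel f) (hε : 0 < ε) (hθ : 0 < θ) :
    ∀ᶠ k : ℕ in atTop, ∑ z, ∑ w, massZW (seqSource P k) (seqChannel f k) z w *
      ind (massZW (seqSource P k) (seqChannel f k) z w < 2 ^ (k * ((∑ z, ∑ w, massZW P f z w *
        logb 2 (massZW P f z w / (massZ P z * massW P f w))) - ε)) *
          (massZ (seqSource P k) z * massW (seqSource P k) (seqChannel f k) w)) ≤ θ := by
  have h := eventually_tail_le₂ (p := massZW P f) (a := massZW P f)
    (b := fun z w => massZ P z * massW P f w) (massZW_nonneg hP.1 hf) (sum_sum_massZW hP hf)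
    (fun z w h => h) (fun z w h => mul_pos (massZ_pos hP.1 hf h) (massW_pos_of_massZW hP.1 hf h))
    hε hθ
  simpa only [massZW_seqSource, massZ_seqSource, massW_seqSource, Finset.prod_mul_distrib] using h

lemma eventually_tail_channel {q : X → ℝ} (hq : IsPMF q) {Ch : X → Y → ℝ} (hCh : IsKernel Ch)
    (hε : 0 < ε) (hθ : 0 < θ) :
    ∀ᶠ n : ℕ in atTop, ∑ x, ∑ y, (∏ j, q (x j)) * seqChannel Ch n x y *
      ind (seqChannel Ch n x y < 2 ^ (n * (mutualInfo (fun x : X × Y => q x.1 * Ch x.1 x.2) - ε)) *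
        massY (fun x : Fin n → X => ∏ j, q (x j)) (seqChannel Ch n) y) ≤ θ := by
  have hpos : ∀ x y, 0 < q x * Ch x y → 0 < Ch x y := fun x y h =>
    ((hCh x).1 y).lt_of_ne' (right_ne_zero_of_mul h.ne')
  have h := eventually_tail_le₂ (p := fun x y => q x * Ch x y) (a := Ch) (b := fun _ y => massY q Ch y)
    (fun x y => mul_nonneg (hq.1 x) ((hCh x).1 y))
    (by simp only [← Finset.mul_sum, (hCh _).2, mul_one, hq.2])
    hpos (fun x y h => sum_pos_of_nonneg_of_pos (fun x => mul_nonneg (hq.1 x) ((hCh x).1 y)) h)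
    hε hθ
  rw [← mutualInfo_eq_log_ratio hCh] at h
  simpa only [massY_prod, seqChannel, Finset.prod_mul_distrib] using h

lemma eventually_tail_source (hP : IsPMF P) (hf : IsKernel f) (hε : 0 < ε) (hθ : 0 < θ) :
    ∀ᶠ k : ℕ in atTop, ∑ v, ∑ z, ∑ w, massVZW (seqSource P k) (seqChannel f k) v z w *
      ind (massVZW (seqSource P k) (seqChannel f k) v z w <
        2 ^ (k * (-(∑ w, sliceV P (fun u => f u w)) - ε)) *
          massZW (seqSource P k) (seqChannel f k) z w) ≤ θ := by
  have h := eventually_tail_le₃ (p := massVZW P f) (a := massVZW P f) (b := fun _ => massZW P f)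
    (massVZW_nonneg hP.1 hf) (sum_massVZW hP hf) (fun v z w h => h)
    (fun v z w h => massZW_pos hP.1 hf h) hε hθ
  rw [sum_massVZW_mul_log] at h
  simpa only [massVZW_seqSource, massZW_seqSource] using h

end AsymptoticTails

lemma le_ceil_two_rpow {x : ℝ} (hx : 0 ≤ x) :
    1 ≤ ⌈(2 : ℝ) ^ x⌉₊ ∧ (2 : ℝ) ^ x ≤ ⌈(2 : ℝ) ^ x⌉₊ ∧ (⌈(2 : ℝ) ^ x⌉₊ : ℝ) ≤ 2 ^ (1 + x) := by
  have h1 : (1 : ℝ) ≤ 2 ^ x := Real.one_le_rpow one_le_two hx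
  refine ⟨Nat.one_le_ceil_iff.2 (by linarith), Nat.le_ceil _, ?_⟩
  rw [Real.rpow_add two_pos, Real.rpow_one]
  have := Nat.ceil_lt_add_one (zero_le_one.trans h1)
  linarith

lemma eventually_two_rpow_le {c θ : ℝ} (D : ℝ) (hc : 0 < c) (hθ : 0 < θ) :
    ∀ᶠ k : ℕ in atTop, (2 : ℝ) ^ (D - c * k) ≤ θ := by
  have h : Tendsto (fun k : ℕ => c * (k : ℝ)) atTop atTop :=
    tendsto_natCast_atTop_atTop.const_mul_atTop hc
  filter_upwards [h.eventually_ge_atTop (D - logb 2 θ)] with k hk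
  rw [← Real.le_logb_iff_rpow_le one_lt_two hθ]
  linarith

section Code

variable {U V Z W X Y : Type} [Fintype U] [Fintype V] [Fintype Z] [Fintype W] [Fintype X]
  [Fintype Y]

/-- There are codes for `k` source symbols and at most `τ k` channel uses, of rate at most `R` and
with probability of correct decoding at least `1 - lam`. -/
def HasCode (P : U × V × Z → ℝ) (Ch : X → Y → ℝ) (τ R lam : ℝ) (k : ℕ) : Prop :=
  ∃ n m : ℕ, (n : ℝ) ≤ τ * k ∧ 1 ≤ m ∧ ∃ enc : (Fin k → U) → (Fin n → X) → ℝ, IsKernel enc ∧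
    ∃ (φ : (Fin k → V) → Fin m) (g : Fin m × (Fin n → Y) × (Fin k → Z) → (Fin k → V)),
      1 - lam ≤ correctMass (seqSource P k) (compKernel enc (seqChannel Ch n)) φ g ∧
      logb 2 m / k ≤ R

lemma logb_ceil_div_le {H ε : ℝ} {k : ℕ} (hH : 0 ≤ H) (hε : 0 < ε) (hk : 1 ≤ ε * k) :
    logb 2 ⌈(2 : ℝ) ^ (k * (H + 2 * ε))⌉₊ / k ≤ H + 3 * ε := by
  have hk0 : (0 : ℝ) < k := by
    by_contra! h
    nlinarith
  obtain ⟨h1, -, h2⟩ := le_ceil_two_rpow (x := k * (H + 2 * ε)) (by positivity)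
  have h1' : (0 : ℝ) < ⌈(2 : ℝ) ^ (k * (H + 2 * ε))⌉₊ := by exact_mod_cast h1
  rw [div_le_iff₀ hk0]
  refine (Real.logb_le_logb_of_le one_lt_two h1' h2).trans ?_
  rw [Real.logb_rpow two_pos (by norm_num)]
  linarith

lemma eventually_hasCode [Nonempty V] {P : U × V × Z → ℝ} (hP : IsPMF P) {f : U → W → ℝ}
    (hf : IsKernel f) {Ch : X → Y → ℝ} (hCh : IsKernel Ch) {q : X → ℝ} (hq : IsPMF q) {τ R lam : ℝ}
    (hτ : 0 < τ) (hlam : 0 < lam)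
    (hΔ : sliceU P 1 - ∑ w, sliceU P (fun u => f u w) <
      τ * mutualInfo (fun x : X × Y => q x.1 * Ch x.1 x.2))
    (hR : ∑ w, sliceV P (fun u => f u w) < R) : ∀ᶠ k in atTop, HasCode P Ch τ R lam k := by
  set I₀ := mutualInfo (fun x : U × W => massU P x.1 * f x.1 x.2) with hI₀
  set I₁ := ∑ z, ∑ w, massZW P f z w * logb 2 (massZW P f z w / (massZ P z * massW P f w)) with hI₁
  set I₂ := mutualInfo (fun x : X × Y => q x.1 * Ch x.1 x.2) with hI₂
  set H := ∑ w, sliceV P (fun u => f u w) with hHdef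
  have hI₀0 : 0 ≤ I₀ := mutualInfo_nonneg ⟨massU_nonneg hP.1, sum_massU hP⟩ hf
  have hI₂0 : 0 ≤ I₂ := mutualInfo_nonneg hq hCh
  have hH0 : 0 ≤ H := Finset.sum_nonneg fun w _ => sliceV_nonneg hP.1 fun u => (hf u).1 w
  have hsub : I₀ - I₁ < τ * I₂ := (mutualInfo_sub_eq hP hf).trans_lt hΔ
  obtain ⟨ε, hε, hε1, hε2⟩ : ∃ ε : ℝ, 0 < ε ∧ 5 * ε ≤ τ * I₂ - (I₀ - I₁) ∧ 3 * ε ≤ R - H := by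
    refine ⟨min ((τ * I₂ - (I₀ - I₁)) / 5) ((R - H) / 3), lt_min (by linarith) (by linarith), ?_, ?_⟩
    · have := min_le_left ((τ * I₂ - (I₀ - I₁)) / 5) ((R - H) / 3)
      linarith
    · have := min_le_right ((τ * I₂ - (I₀ - I₁)) / 5) ((R - H) / 3)
      linarith
  have hθ : 0 < lam / 8 := by positivity
  have hn : Tendsto (fun k : ℕ => ⌊τ * (k : ℝ)⌋₊) atTop atTop :=
    tendsto_nat_floor_atTop.comp (tendsto_natCast_atTop_atTop.const_mul_atTop hτ)
  have hk1 : ∀ᶠ k : ℕ in atTop, 1 ≤ ε * (k : ℝ) :=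
    (tendsto_natCast_atTop_atTop.const_mul_atTop hε).eventually_ge_atTop 1
  filter_upwards [eventually_tail_encoder hP hf hε hθ, eventually_tail_side hP hf hε hθ,
    hn.eventually (eventually_tail_channel hq hCh (div_pos hε hτ) hθ),
    eventually_tail_source hP hf hε hθ, eventually_two_rpow_le 0 (half_pos hε) hθ,
    eventually_two_rpow_le (1 + I₂) hε hθ, eventually_two_rpow_le 0 hε hθ, hk1]
    with k h0 h1 h2 h3 h4 h5 h6 hk
  set n := ⌊τ * (k : ℝ)⌋₊ with hndef
  have hnle : (n : ℝ) ≤ τ * k := Nat.floor_le (by positivity)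
  have hnge : τ * k < n + 1 := Nat.lt_floor_add_one _
  obtain ⟨hM1, hM2, hM3⟩ := le_ceil_two_rpow (x := k * (I₀ + 2 * ε)) (by positivity)
  obtain ⟨hm1, hm2, hm3⟩ := le_ceil_two_rpow (x := k * (H + 2 * ε)) (by positivity)
  obtain ⟨enc, henc, φ, g, hg⟩ := exists_hybrid_code (isPMF_seqSource hP k)
    (isKernel_seqChannel hf k) (isKernel_seqChannel hCh n) (isPMF_pi_prod (ι := Fin n) hq)
    (T₀ := 2 ^ (k * (I₀ + ε))) (S₁ := 2 ^ (k * (I₁ - ε))) (S₂ := 2 ^ (n * (I₂ - ε / τ)))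
    (T₂ := 2 ^ (k * (-H - ε))) (η := 2 ^ (0 - ε / 2 * k)) (by positivity) (by positivity)
    (by positivity) (by positivity) (by positivity) hM1 hm1 (by
      rw [← Real.rpow_mul_natCast zero_le_two]
      refine le_trans (le_of_eq ?_) (mul_le_mul_of_nonneg_right hM2 (by positivity))
      rw [← Real.rpow_add two_pos]
      congr 1
      push_cast
      ring)
  refine ⟨n, _, hnle, hm1, enc, henc, φ, g, ?_, (logb_ceil_div_le hH0 hε hk).trans (by linarith)⟩
  have e1 : (⌈(2 : ℝ) ^ (k * (I₀ + 2 * ε))⌉₊ : ℝ) /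
      (2 ^ (k * (I₁ - ε)) * 2 ^ (n * (I₂ - ε / τ))) ≤ lam / 8 := by
    refine le_trans ?_ h5
    rw [← Real.rpow_add two_pos, div_le_iff₀ (by positivity), ← Real.rpow_add two_pos]
    refine hM3.trans (Real.rpow_le_rpow_of_exponent_le one_le_two ?_)
    have a1 : (n : ℝ) * (ε / τ) ≤ ε * k := by
      rw [mul_div_assoc', div_le_iff₀ hτ]
      nlinarith
    have a2 : (τ * k - 1) * I₂ ≤ n * I₂ := mul_le_mul_of_nonneg_right (by linarith) hI₂0
    have a3 : (k : ℝ) * (5 * ε) ≤ k * (τ * I₂ - (I₀ - I₁)) :=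
      mul_le_mul_of_nonneg_left hε1 (Nat.cast_nonneg k)
    linarith
  have e2 : 1 / (2 ^ (k * (-H - ε)) * (⌈(2 : ℝ) ^ (k * (H + 2 * ε))⌉₊ : ℝ)) ≤ lam / 8 := by
    refine le_trans ?_ h6
    rw [div_le_iff₀ (by positivity)]
    refine le_trans ?_ (mul_le_mul_of_nonneg_left
      (mul_le_mul_of_nonneg_left hm2 (by positivity)) (by positivity))
    rw [← Real.rpow_add two_pos, ← Real.rpow_add two_pos]
    refine Real.one_le_rpow one_le_two (le_of_eq ?_)
    ring
  linarith

/-- Codes without helper: the message alone conveys `V` at any rate above `H(V|Z)`. -/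
lemma eventually_hasCode_of_silent [Nonempty V] {P : U × V × Z → ℝ} (hP : IsPMF P)
    (Ch : X → Y → ℝ) {τ R lam : ℝ} (hτ : 0 < τ) (hlam : 0 < lam) (hR : sliceV P 1 < R) :
    ∀ᶠ k in atTop, HasCode P Ch τ R lam k := by
  have hf : IsKernel (fun (_ : U) (_ : Unit) => (1 : ℝ)) := fun u => ⟨fun _ => zero_le_one, by simp⟩
  have hH0 : 0 ≤ sliceV P 1 := sliceV_nonneg hP.1 fun u => zero_le_one
  obtain ⟨ε, hε, hε2⟩ : ∃ ε : ℝ, 0 < ε ∧ 3 * ε ≤ R - sliceV P 1 :=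
    ⟨(R - sliceV P 1) / 3, by linarith, by linarith⟩
  have hθ : 0 < lam / 2 := by positivity
  have hk1 : ∀ᶠ k : ℕ in atTop, 1 ≤ ε * (k : ℝ) :=
    (tendsto_natCast_atTop_atTop.const_mul_atTop hε).eventually_ge_atTop 1
  filter_upwards [eventually_tail_source hP hf hε hθ, eventually_two_rpow_le 0 hε hθ, hk1]
    with k h3 h6 hk
  have hQ := isPMF_seqSource hP k
  have hH1 : ∑ _w : Unit, sliceV P (fun _ => 1) = sliceV P 1 := by simp; rfl
  have hchan : seqChannel (fun (_ : U) (_ : Unit) => (1 : ℝ)) k = fun _ _ => 1 := by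
    funext u w; simp [seqChannel]
  rw [hH1, hchan] at h3
  obtain ⟨hm1, hm2, hm3⟩ := le_ceil_two_rpow (x := k * (sliceV P 1 + 2 * ε)) (by positivity)
  set μ : (Fin k → V) → (Fin 0 → Y) × (Fin k → Z) → ℝ :=
    fun v s => ∑ u, seqSource P k (u, v, s.2) with hμdef
  have hμ : ∀ v s, 0 ≤ μ v s := fun v s => Finset.sum_nonneg fun u _ => hQ.1 _
  obtain ⟨φ, g, hg⟩ := exists_binning (q := fun v s => μ v s / ∑ v, μ v s) hμ
    (fun v s => div_nonneg (hμ v s) (Finset.sum_nonneg fun v _ => hμ v s))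
    (fun s => by rw [← Finset.sum_div]; exact div_self_le_one _)
    (T := 2 ^ (k * (-sliceV P 1 - ε))) (by positivity) hm1
  have henc : IsKernel (fun (_ : Fin k → U) (_ : Fin 0 → X) => (1 : ℝ)) :=
    fun u => ⟨fun _ => zero_le_one, by simp⟩
  refine ⟨0, _, by simp; positivity, hm1, _, henc, φ, fun s => g s.1 s.2, ?_,
    (logb_ceil_div_le hH0 hε hk).trans (by linarith)⟩
  have hK : compKernel (fun (_ : Fin k → U) (_ : Fin 0 → X) => (1 : ℝ)) (seqChannel Ch 0) =
      fun _ _ => 1 := by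
    funext u y; simp [compKernel, seqChannel]
  have hμ1 : ∑ v, ∑ s, μ v s = 1 := by
    rw [← sum_massZ hQ, Finset.sum_comm]
    simp [Fintype.sum_prod_type, hμdef, massZ]
  have hc : correctMass (seqSource P k) (fun _ _ => (1 : ℝ)) φ (fun s : _ × (Fin 0 → Y) × _ =>
      g s.1 s.2) = ∑ v, ∑ s, μ v s - ∑ v, ∑ s, μ v s * ind (g (φ v) s ≠ v) := by
    rw [correctMass]
    simp only [← Finset.sum_sub_distrib, Fintype.sum_prod_type]
    rw [Finset.sum_comm]
    refine Finset.sum_congr rfl fun v _ => Finset.sum_congr rfl fun y _ =>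
      Finset.sum_congr rfl fun z _ => ?_
    simp only [mul_one, hμdef]
    by_cases hv : g (φ v) (y, z) = v
    · rw [ind_of hv, ind_of_not (not_not.2 hv)]; ring
    · rw [ind_of_not hv, ind_of hv]; ring
  have ht : ∑ v, ∑ s, μ v s * ind (μ v s / ∑ v, μ v s < 2 ^ (k * (-sliceV P 1 - ε))) ≤ lam / 2 := by
    refine le_trans (le_of_eq ?_) h3
    refine Finset.sum_congr rfl fun v _ => ?_
    simp only [Fintype.sum_prod_type, Fintype.sum_unique, massVZW, massZW, hμdef, mul_one]
    refine Finset.sum_congr rfl fun z _ => ?_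
    rcases (hμ v (default, z)).eq_or_lt with h | h
    · simp only [hμdef] at h
      rw [← h]; simp
    · have : 0 < ∑ v, μ v (default, z) := sum_pos_of_nonneg_of_pos (fun v => hμ v _) h
      simp only [hμdef] at this
      rw [div_lt_iff₀ this]
  have e2 : 1 / (2 ^ (k * (-sliceV P 1 - ε)) *
      (⌈(2 : ℝ) ^ (k * (sliceV P 1 + 2 * ε))⌉₊ : ℝ)) ≤ lam / 2 := by
    refine le_trans ?_ h6
    rw [div_le_iff₀ (by positivity)]
    refine le_trans ?_ (mul_le_mul_of_nonneg_left
      (mul_le_mul_of_nonneg_left hm2 (by positivity)) (by positivity))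
    rw [← Real.rpow_add two_pos, ← Real.rpow_add two_pos]
    refine Real.one_le_rpow one_le_two (le_of_eq ?_)
    ring
  rw [hμ1] at hg hc
  rw [hK, hc]
  linarith

end Code

section Achievability

variable {U V Z X Y : Type} [Fintype U] [Fintype V] [Fintype Z] [Fintype X] [Fintype Y]
  {P : U × V × Z → ℝ} {Ch : X → Y → ℝ} {τ R : ℝ}

lemma HasCode.mono {lam R' : ℝ} {k : ℕ} (h : HasCode P Ch τ R lam k) (hR : R ≤ R') :
    HasCode P Ch τ R' lam k := by
  obtain ⟨n, m, hn, hm, enc, henc, φ, g, hg, hr⟩ := h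
  exact ⟨n, m, hn, hm, enc, henc, φ, g, hg, hr.trans hR⟩

/-- Sending `V` uncoded. -/
lemma hasCode_logb_card [Nonempty V] (hP : IsPMF P) (Ch : X → Y → ℝ) (hτ : 0 < τ) {lam : ℝ}
    (hlam : 0 < lam) (k : ℕ) : HasCode P Ch τ (logb 2 (Fintype.card V)) lam k := by
  classical
  have henc : IsKernel (fun (_ : Fin k → U) (_ : Fin 0 → X) => (1 : ℝ)) :=
    fun u => ⟨fun _ => zero_le_one, by simp⟩
  have hK : compKernel (fun (_ : Fin k → U) (_ : Fin 0 → X) => (1 : ℝ)) (seqChannel Ch 0) =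
      fun _ _ => 1 := by
    funext u y; simp [compKernel, seqChannel]
  have hone : IsKernel (fun (_ : Fin k → U) (_ : Fin 0 → Y) => (1 : ℝ)) :=
    fun u => ⟨fun _ => zero_le_one, by simp⟩
  refine ⟨0, Fintype.card (Fin k → V), by simp; positivity, Fintype.card_pos, _, henc,
    Fintype.equivFin _, fun s => (Fintype.equivFin (Fin k → V)).symm s.1, ?_, ?_⟩
  · rw [hK, correctMass]
    have := sum_correctMass_total (isPMF_seqSource hP k) hone
    simp only [Equiv.symm_apply_apply, ind_of trivial, one_mul, this]
    linarith
  · rcases Nat.eq_zero_or_pos k with rfl | hk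
    · simpa using Real.logb_nonneg one_lt_two (by exact_mod_cast Fintype.card_pos (α := V))
    · have hk' : (0 : ℝ) < k := by exact_mod_cast hk
      rw [Fintype.card_fun, Fintype.card_fin, Nat.cast_pow, Real.logb_pow, mul_div_cancel_left₀ _ hk'.ne']

lemma achievable_of_eventually_hasCode [Nonempty V] (hP : IsPMF P) (hτ : 0 < τ)
    (h : ∀ lam : ℝ, 0 < lam → ∀ᶠ k in atTop, HasCode P Ch τ R lam k) :
    JSCCAchievable (L := 1) (U := fun _ => U) (X := fun _ => X) (Y := fun _ => Y)
      (fun x => P (x.1 0, x.2.1, x.2.2)) (fun _ => Ch) τ R := by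
  classical
  intro lam hlam _
  have hδ : ∀ k, ∃ d : ℝ, 0 ≤ d ∧ (HasCode P Ch τ R lam k → d = 0) ∧
      HasCode P Ch τ (R + d) lam k := by
    intro k
    by_cases hk : HasCode P Ch τ R lam k
    · exact ⟨0, le_rfl, fun _ => rfl, by simpa using hk⟩
    · refine ⟨max 0 (logb 2 (Fintype.card V) - R), le_max_left _ _, fun h => absurd h hk,
        (hasCode_logb_card hP Ch hτ hlam k).mono ?_⟩
      have := le_max_right 0 (logb 2 (Fintype.card V) - R)
      linarith
  choose δ hδ0 hδz hcode using hδ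
  choose n m hn hm enc henc φ g hg hr using hcode
  refine ⟨n, m, δ, fun k _ => enc k, φ, fun k s => g k (s.1, s.2.1 0, s.2.2), hδ0, ?_, ?_⟩
  · refine tendsto_const_nhds.congr' ?_
    filter_upwards [h lam hlam] with k hk
    exact (hδz k hk).symm
  · intro k _
    refine ⟨hn k, hm k, fun _ => henc k, ?_, hr k⟩
    rw [probCorrect_eq_correctMass]
    exact hg k

/-- Direct part of the coding theorem. -/
lemma achievable_of_kernel [Nonempty V] {W : Type} [Fintype W] (hP : IsPMF P) (hCh : IsKernel Ch)
    (hτ : 0 < τ) {f : U → W → ℝ} (hf : IsKernel f)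
    (hI : sliceU P 1 - ∑ w, sliceU P (fun u => f u w) ≤ τ * capacity Ch)
    (hR : ∑ w, sliceV P (fun u => f u w) < R) :
    JSCCAchievable (L := 1) (U := fun _ => U) (X := fun _ => X) (Y := fun _ => Y)
      (fun x => P (x.1 0, x.2.1, x.2.2)) (fun _ => Ch) τ R := by
  refine achievable_of_eventually_hasCode hP hτ fun lam hlam => ?_
  have hdiff := sliceV_sub_le_sliceU_sub hP.1 hf
  rcases lt_or_ge (sliceV P 1) R with hlt | hge
  · exact eventually_hasCode_of_silent hP Ch hτ hlam hlt
  set H := ∑ w, sliceV P (fun u => f u w)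
  set Δ := sliceU P 1 - ∑ w, sliceU P (fun u => f u w)
  have hΔ : 0 < Δ := by linarith
  obtain ⟨ε, hε0, hε1, hε⟩ : ∃ ε : ℝ, 0 < ε ∧ ε < 1 ∧ (1 - ε) * H + ε * sliceV P 1 < R := by
    have hc : Tendsto (fun ε : ℝ => (1 - ε) * H + ε * sliceV P 1) (nhds 0) (nhds H) := by
      have : Continuous (fun ε : ℝ => (1 - ε) * H + ε * sliceV P 1) := by fun_prop
      simpa using this.tendsto 0
    have hev := (hc.eventually_lt_const hR).filter_mono (nhdsWithin_le_nhds (s := Set.Ioi 0))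
    obtain ⟨ε, h1, h2⟩ := (hev.and (Ioo_mem_nhdsGT zero_lt_one)).exists
    exact ⟨ε, h2.1, h2.2, h1⟩
  set f' : U → Option W → ℝ := fun u o => o.elim ε fun w => (1 - ε) * f u w with hf'def
  have hf' : IsKernel f' := by
    refine fun u => ⟨?_, ?_⟩
    · rintro (_ | w)
      · exact hε0.le
      · exact mul_nonneg (by linarith) ((hf u).1 w)
    · rw [Fintype.sum_option]
      simp only [hf'def, Option.elim, ← Finset.mul_sum, (hf u).2]
      ring
  have hnone : (fun u => f' u none) = ε • (1 : U → ℝ) := by funext u; simp [hf'def]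
  have hsome : ∀ w, (fun u => f' u (some w)) = (1 - ε) • (fun u => f u w) := fun w => by
    funext u; simp [hf'def]
  have hV : ∑ o, sliceV P (fun u => f' u o) = (1 - ε) * H + ε * sliceV P 1 := by
    rw [Fintype.sum_option]
    simp only [hnone, hsome, sliceV_smul, ← Finset.mul_sum]
    exact add_comm _ _
  have hU : sliceU P 1 - ∑ o, sliceU P (fun u => f' u o) = (1 - ε) * Δ := by
    rw [Fintype.sum_option]
    simp only [hnone, hsome, sliceU_smul, ← Finset.mul_sum, Δ]
    ring
  have hlt : (1 - ε) * Δ / τ < capacity Ch := by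
    rw [div_lt_iff₀ hτ]
    nlinarith
  have hne : {c | ∃ q : X → ℝ, IsPMF q ∧
      c = mutualInfo (fun xy : X × Y => q xy.1 * Ch xy.1 xy.2)}.Nonempty := by
    by_contra hemp
    rw [Set.not_nonempty_iff_eq_empty] at hemp
    have : capacity Ch = 0 := by rw [capacity, hemp, Real.sSup_empty]
    rw [this, mul_zero] at hI
    linarith
  obtain ⟨_, ⟨q, hq, rfl⟩, hqI⟩ := exists_lt_of_lt_csSup hne hlt
  rw [div_lt_iff₀ hτ, mul_comm _ τ] at hqI
  exact eventually_hasCode hP hf' hCh hq hτ hlam (hU ▸ hqI) (hV ▸ hε)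

lemma rate_nonneg_of_achievable (h : JSCCAchievable (L := 1) (U := fun _ => U) (X := fun _ => X)
    (Y := fun _ => Y) (fun x => P (x.1 0, x.2.1, x.2.2)) (fun _ => Ch) τ R) : 0 ≤ R := by
  obtain ⟨_, m, δ, _, _, _, _, hδ, hk⟩ := h 1 one_pos le_rfl
  have hlim : Tendsto (fun k => R + δ k) atTop (nhds R) := by
    simpa using hδ.const_add R
  refine ge_of_tendsto hlim ?_
  filter_upwards [eventually_ge_atTop 1] with k hk1
  obtain ⟨-, hm, -, -, hr⟩ := hk k hk1
  exact (div_nonneg (Real.logb_nonneg one_lt_two (by exact_mod_cast hm))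
    (Nat.cast_nonneg k)).trans hr

end Achievability

end DHT

/-- For the `1`-helper JSCC problem with bandwidth ratio `τ > 0`,
`R(τ) = inf_W H(V|W,Z)` over all auxiliary `W` (on an alphabet of size `|𝒰|+4`) with
`(Z,V) − U − W` a Markov chain and `I(U;W|Z) ≤ τ·C`. -/
theorem statement_13 {Uu Xx Yy V Z : Type}
    [Fintype Uu] [Fintype Xx] [Fintype Yy] [Fintype V] [Fintype Z]
    (P : Uu × V × Z → ℝ) (hP : IsPMF P)
    (Ch : Xx → Yy → ℝ) (hCh : IsKernel Ch) (τ : ℝ) (hτ : 0 < τ) :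
    Rjscc (L := 1) (U := fun _ => Uu) (X := fun _ => Xx) (Y := fun _ => Yy)
        (fun x => P (x.1 0, x.2.1, x.2.2)) (fun _ => Ch) τ =
      sInf {r | ∃ J : (Uu × V × Z) × Fin (Fintype.card Uu + 4) → ℝ,
        IsPMF J ∧ (∀ x, (∑ w, J (x, w)) = P x) ∧ MarkovZVUW J ∧
        miUW_Z J ≤ τ * capacity Ch ∧ r = entV_WZ J} := by
  have : Nonempty V := by
    obtain ⟨⟨_, v, _⟩⟩ : Nonempty (Uu × V × Z) := by
      by_contra hne
      rw [not_nonempty_iff] at hne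
      simpa using hP.2
    exact ⟨v⟩
  have hset : {r | ∃ J : (Uu × V × Z) × Fin (Fintype.card Uu + 4) → ℝ,
      IsPMF J ∧ (∀ x, (∑ w, J (x, w)) = P x) ∧ MarkovZVUW J ∧
      miUW_Z J ≤ τ * capacity Ch ∧ r = entV_WZ J} =
      {r | ∃ f : Uu → Fin (Fintype.card Uu + 4) → ℝ, IsKernel f ∧
        sliceU P 1 - ∑ w, sliceU P (fun u => f u w) ≤ τ * capacity Ch ∧
        r = ∑ w, sliceV P (fun u => f u w)} := by
    ext r
    constructor
    · rintro ⟨J, hJ, hJP, hM, hI, rfl⟩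
      obtain ⟨f, hf, rfl⟩ := exists_kernel_of_markov hP hJ hJP hM
      exact ⟨f, hf, (miUW_Z_jointOf hP.1 hf).symm.le.trans hI, entV_WZ_jointOf P f⟩
    · rintro ⟨f, hf, hI, rfl⟩
      exact ⟨jointOf P f, isPMF_jointOf hP hf, sum_jointOf P hf, markov_jointOf P hf,
        (miUW_Z_jointOf hP.1 hf).le.trans hI, (entV_WZ_jointOf P f).symm⟩
  rw [hset, Rjscc]
  have hbA : BddBelow {R | JSCCAchievable (L := 1) (U := fun _ => Uu) (X := fun _ => Xx)
      (Y := fun _ => Yy) (fun x => P (x.1 0, x.2.1, x.2.2)) (fun _ => Ch) τ R} :=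
    ⟨0, fun R hR => rate_nonneg_of_achievable hR⟩
  have hneA : {R | JSCCAchievable (L := 1) (U := fun _ => Uu) (X := fun _ => Xx)
      (Y := fun _ => Yy) (fun x => P (x.1 0, x.2.1, x.2.2)) (fun _ => Ch) τ R}.Nonempty :=
    ⟨_, achievable_of_eventually_hasCode hP hτ fun lam hlam =>
      Eventually.of_forall fun k => hasCode_logb_card hP Ch hτ hlam k⟩
  refine le_antisymm (le_csInf ?_ ?_) (le_csInf hneA fun R hR => ?_)
  · obtain ⟨R, hR⟩ := hneA
    obtain ⟨f, hf, hI, -⟩ := exists_kernel_of_achievable hP hCh one_pos hR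
    exact ⟨_, f, hf, hI, rfl⟩
  · rintro _ ⟨f, hf, hI, rfl⟩
    exact le_of_forall_gt_imp_ge_of_dense fun R hR =>
      csInf_le hbA (achievable_of_kernel hP hCh hτ hf hI hR)
  · refine le_of_forall_pos_le_add fun ε hε => ?_
    obtain ⟨f, hf, hI, hle⟩ := exists_kernel_of_achievable hP hCh hε hR
    refine le_trans (csInf_le ⟨0, ?_⟩ ⟨f, hf, hI, rfl⟩) hle
    rintro _ ⟨f, hf, -, rfl⟩
    exact Finset.sum_nonneg fun w _ => sliceV_nonneg hP.1 fun u => (hf u).1 w
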